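/- (Mean invasion speed.) Assume V satisfies (H_coerc) and (H_gen), and let u be a radially symmetric solution satisfying (H_hom) with m = 0 and (H_inv), together with the escape-point setup below. Then the limit mean speeds coincide: c_esc⁻ = c_esc⁺ = c̄. -/

import Mathlib

open Filter Topology Set MeasureTheory

noncomputable section

local notation "⟪" x ", " y "⟫" => @inner ℝ _ _ x y

abbrev Euc (n : ℕ) : Type := EuclideanSpace ℝ (Fin n)

variable {n : ℕ}

/-- Spatial partial derivative `u_r`. -/
def ur (u : ℝ → ℝ → Euc n) (r t : ℝ) : Euc n := deriv (fun s => u s t) r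

/-- Second spatial partial derivative `u_rr`. -/
def urr (u : ℝ → ℝ → Euc n) (r t : ℝ) : Euc n := deriv (fun s => ur u s t) r

/-- Time partial derivative `u_t`. -/
def ut (u : ℝ → ℝ → Euc n) (r t : ℝ) : Euc n := deriv (fun s => u r s) t

/-- Hessian (second differential) of the potential. -/
def hess (V : Euc n → ℝ) (x : Euc n) : Euc n →L[ℝ] Euc n := fderiv ℝ (gradient V) x

/-- Coercivity hypothesis. -/
def HCoerc (V : Euc n → ℝ) : Prop :=
  ∃ ε > (0:ℝ), ∃ R : ℝ, ∀ x : Euc n, R ≤ ‖x‖ → ε * ‖x‖ ^ 2 ≤ ⟪x, gradient V x⟫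

/-- The set of nondegenerate minimum points of `V`. -/
def MinSet (V : Euc n → ℝ) : Set (Euc n) :=
  {m | gradient V m = 0 ∧ ∀ v : Euc n, v ≠ 0 → 0 < ⟪v, hess V m v⟫}

/-- Data of the constants `λ_min`, `λ_max`, `d_Esc` from the paper, together with their
spectral characterizations. -/
structure EscData (n : ℕ) (V : Euc n → ℝ) where
  lmin : ℝ
  lmax : ℝ
  dEsc : ℝ
  lmin_pos : 0 < lmin
  dEsc_pos : 0 < dEsc
  lower : ∀ m ∈ MinSet V, ∀ v : Euc n, lmin * ‖v‖ ^ 2 ≤ ⟪v, hess V m v⟫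
  upper : ∀ m ∈ MinSet V, ∀ v : Euc n, ⟪v, hess V m v⟫ ≤ lmax * ‖v‖ ^ 2
  esc_lower : ∀ m ∈ MinSet V, ∀ x : Euc n, ‖x - m‖ ≤ dEsc →
    ∀ v : Euc n, lmin / 2 * ‖v‖ ^ 2 ≤ ⟪v, hess V x v⟫
  esc_upper : ∀ m ∈ MinSet V, ∀ x : Euc n, ‖x - m‖ ≤ dEsc →
    ∀ v : Euc n, ⟪v, hess V x v⟫ ≤ 2 * lmax * ‖v‖ ^ 2

/-- Radially symmetric solution of `u_t = -∇V(u) + ((d-1)/r) u_r + u_rr` with Neumann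
boundary condition at the origin. -/
structure IsRadialSolution (d : ℕ) (V : Euc n → ℝ) (u : ℝ → ℝ → Euc n) : Prop where
  diff_r : ∀ t > (0:ℝ), ∀ r : ℝ, DifferentiableAt ℝ (fun s => u s t) r
  diff_rr : ∀ t > (0:ℝ), ∀ r : ℝ, DifferentiableAt ℝ (fun s => ur u s t) r
  cont_rr : ∀ t > (0:ℝ), Continuous fun r => urr u r t
  diff_t : ∀ t > (0:ℝ), ∀ r : ℝ, DifferentiableAt ℝ (fun s => u r s) t
  cont_t : ∀ r : ℝ, ContinuousOn (fun s => ut u r s) (Ioi 0)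
  bounded : ∃ C : ℝ, ∀ r t : ℝ, 0 ≤ r → 0 < t →
    ‖u r t‖ + ‖ur u r t‖ + ‖urr u r t‖ + ‖ut u r t‖ ≤ C
  pde : ∀ r > (0:ℝ), ∀ t > (0:ℝ),
    ut u r t = -gradient V (u r t) + (((d : ℝ) - 1) / r) • ur u r t + urr u r t
  neumann : ∀ t > (0:ℝ), ur u 0 t = 0

/-- Profiles of fronts travelling at speed `c` connecting `um` to `up`
(nonconstant solutions of `φ'' = -cφ' + ∇V(φ)`). -/
def Phi (V : Euc n → ℝ) (c : ℝ) (um up : Euc n) : Set (ℝ → Euc n) :=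
  {φ | (∃ ξ₁ ξ₂ : ℝ, φ ξ₁ ≠ φ ξ₂) ∧
    (∀ ξ : ℝ, DifferentiableAt ℝ φ ξ) ∧ (∀ ξ : ℝ, DifferentiableAt ℝ (deriv φ) ξ) ∧
    (∀ ξ : ℝ, deriv (deriv φ) ξ = -(c • deriv φ ξ) + gradient V (φ ξ)) ∧
    Tendsto φ atBot (𝓝 um) ∧ Tendsto φ atTop (𝓝 up)}

/-- Fronts travelling at speed `c` invading the equilibrium `mp`. -/
def PhiInv (V : Euc n → ℝ) (c : ℝ) (mp : Euc n) : Set (ℝ → Euc n) :=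
  ⋃ mm ∈ MinSet V, Phi V c mm mp

/-- Normalized front profiles. -/
def PhiNorm (V : Euc n → ℝ) (dEsc c : ℝ) (mm mp : Euc n) : Set (ℝ → Euc n) :=
  {φ | φ ∈ Phi V c mm mp ∧ ‖φ 0 - mp‖ = dEsc ∧ ∀ ξ > (0:ℝ), ‖φ ξ - mp‖ < dEsc}

/-- Normalized front profiles invading `mp`. -/
def PhiNormInv (V : Euc n → ℝ) (dEsc c : ℝ) (mp : Euc n) : Set (ℝ → Euc n) :=
  ⋃ mm ∈ MinSet V, PhiNorm V dEsc c mm mp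

/-- Every critical point of `V` is nondegenerate. -/
def HNonDeg (V : Euc n → ℝ) : Prop :=
  ∀ x : Euc n, gradient V x = 0 → ∀ v : Euc n, hess V x v = 0 → v = 0

/-- Every front travelling at a positive speed and invading a minimum point is bistable. -/
def HOnlyBist (V : Euc n → ℝ) : Prop :=
  ∀ mp ∈ MinSet V, ∀ um : Euc n, gradient V um = 0 →
    ∀ c > (0:ℝ), (Phi V c um mp).Nonempty → um ∈ MinSet V

/-- The set of invading speeds has empty interior. -/
def HDiscVel (V : Euc n → ℝ) : Prop :=
  ∀ mp ∈ MinSet V, interior {c : ℝ | 0 ≤ c ∧ (PhiInv V c mp).Nonempty} = ∅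

/-- The set of initial values of normalized invading fronts is totally disconnected. -/
def HDiscFront (V : Euc n → ℝ) (dEsc : ℝ) : Prop :=
  ∀ mp ∈ MinSet V, ∀ c > (0:ℝ),
    IsTotallyDisconnected
      {p : Euc n × Euc n | ∃ φ ∈ PhiNormInv V dEsc c mp, p = (φ 0, deriv φ 0)}

/-- The generic hypotheses on the potential. -/
def HGen (V : Euc n → ℝ) (dEsc : ℝ) : Prop :=
  HNonDeg V ∧ HOnlyBist V ∧ HDiscVel V ∧ HDiscFront V dEsc

/-- The solution is stable at infinity, close to the minimum point `m`. -/
def StableAtInfinity (V : Euc n → ℝ) (u : ℝ → ℝ → Euc n) (m : Euc n) : Prop :=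
  m ∈ MinSet V ∧
    Tendsto (fun t => limsup (fun r => ‖u r t - m‖) atTop) atTop (𝓝 0)

/-- Propagating terrace of bistable fronts connecting `mLoc` to `mFar`. -/
def IsTerrace (V : Euc n → ℝ) (mLoc mFar : Euc n) (T : ℝ → ℝ → Euc n) : Prop :=
  ∃ (q : ℕ) (ms : ℕ → Euc n) (cs : ℕ → ℝ) (φs : ℕ → ℝ → Euc n) (rs : ℕ → ℝ → ℝ),
    ms 0 = mFar ∧ ms q = mLoc ∧ (∀ i, i ≤ q → ms i ∈ MinSet V) ∧
    (∀ i, i < q → V (ms (i + 1)) < V (ms i)) ∧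
    (∀ i, 1 ≤ i → i ≤ q → 0 < cs i) ∧
    (∀ i, 1 ≤ i → i + 1 ≤ q → cs (i + 1) ≤ cs i) ∧
    (∀ i, 1 ≤ i → i ≤ q → φs i ∈ Phi V (cs i) (ms i) (ms (i - 1))) ∧
    (∀ i, 1 ≤ i → i ≤ q →
      (∀ t : ℝ, 0 ≤ t → 0 ≤ rs i t) ∧ (∀ t : ℝ, DifferentiableAt ℝ (rs i) t) ∧
        Tendsto (deriv (rs i)) atTop (𝓝 (cs i))) ∧
    (∀ i, 1 ≤ i → i + 1 ≤ q → Tendsto (fun t => rs (i + 1) t - rs i t) atTop atTop) ∧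
    (∀ r t : ℝ, 0 ≤ r → 0 ≤ t →
      T r t = ms 0 + ∑ i ∈ Finset.Icc 1 q, (φs i (r - rs i t) - ms (i - 1)))

/-- Hypothesis `(H_hom)` unbundled: `u` is close to `m` on a growing interval around
`rHom t`, travelling at asymptotic speed `cHom`; closeness is measured in `H¹` norm. -/
def HHomWith (u : ℝ → ℝ → Euc n) (m : Euc n) (cHom : ℝ) (rHom : ℝ → ℝ) : Prop :=
  0 < cHom ∧ (∀ t : ℝ, DifferentiableAt ℝ rHom t) ∧
    Tendsto (deriv rHom) atTop (𝓝 cHom) ∧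
    ∀ L > (0:ℝ),
      Tendsto
        (fun t => ∫ r in (-L)..L,
          (‖u (rHom t + r) t - m‖ ^ 2 + ‖ur u (rHom t + r) t‖ ^ 2))
        atTop (𝓝 0)

/-- The set whose supremum defines the Escape point `r_Esc(t)`. -/
def rEscSet (u : ℝ → ℝ → Euc n) (m : Euc n) (dEsc : ℝ) (rHom : ℝ → ℝ) (t : ℝ) : Set ℝ :=
  {r | r ∈ Icc 0 (rHom t) ∧ ‖u r t - m‖ = dEsc}

/-- The Escape point `r_Esc(t)`. -/
def rEscF (u : ℝ → ℝ → Euc n) (m : Euc n) (dEsc : ℝ) (rHom : ℝ → ℝ) (t : ℝ) : ℝ :=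
  sSup (rEscSet u m dEsc rHom t)

/-- The upper limit mean speed `c_Esc` of the Escape point. -/
def cEscV (u : ℝ → ℝ → Euc n) (m : Euc n) (dEsc : ℝ) (rHom : ℝ → ℝ) : ℝ :=
  limsup (fun t => rEscF u m dEsc rHom t / t) atTop

/-- `q_hull`: minimal convexity of the lower quadratic hulls of `V` at minimum points. -/
def qHull (V : Euc n → ℝ) : ℝ :=
  sInf {q : ℝ | ∃ m ∈ MinSet V, ∃ x : Euc n, x ≠ m ∧ q = (V x - V m) / ‖x - m‖ ^ 2}

/-- The weight `w` of the energy in the firewall functionals. -/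
def wV (V : Euc n → ℝ) : ℝ := 1 / max 1 (-(4 * qHull V))

/-- The decay rate `κ₀`. -/
def kappa0 (lmin : ℝ) : ℝ := min (1 / 2) (lmin / 8)

/-- The "small curvature" radius `r_sc`. -/
def rsc (d : ℕ) (lmin : ℝ) : ℝ := max (2 * ((d : ℝ) - 1)) (8 * ((d : ℝ) - 1) / lmin)

/-- The weight function `T_ρ ψ₀`. -/
def Tpsi (d : ℕ) (lmin : ℝ) (ρ r : ℝ) : ℝ :=
  if r ≤ rsc d lmin then Real.exp (-(kappa0 lmin) * |r - ρ|) * (r / rsc d lmin) ^ (d - 1)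
  else Real.exp (-(kappa0 lmin) * |r - ρ|)

/-- The firewall functional `F₀` in the laboratory frame. -/
def F0 (V : Euc n → ℝ) (d : ℕ) (lmin : ℝ) (u : ℝ → ℝ → Euc n) (ρ t : ℝ) : ℝ :=
  ∫ r in Ioi (0:ℝ),
    Tpsi d lmin ρ r * (wV V * (‖ur u r t‖ ^ 2 / 2 + V (u r t)) + ‖u r t‖ ^ 2 / 2)

/-- The set `Σ₀(t)` where the solution Escapes at distance `dEsc` from the origin. -/
def Sigma0 (u : ℝ → ℝ → Euc n) (dEsc t : ℝ) : Set ℝ := {r | 0 ≤ r ∧ dEsc < ‖u r t‖}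

/-- The firewall differential inequality in the laboratory frame. -/
def FireIneq (V : Euc n → ℝ) (d : ℕ) (lmin dEsc : ℝ) (u : ℝ → ℝ → Euc n) (ν K : ℝ) : Prop :=
  ∀ ρ ≥ rsc d lmin, ∀ t > (0:ℝ),
    DifferentiableAt ℝ (fun s => F0 V d lmin u ρ s) t ∧
    deriv (fun s => F0 V d lmin u ρ s) t ≤
      -ν * F0 V d lmin u ρ t + K * ∫ r in Sigma0 u dEsc t, Tpsi d lmin ρ r

/-- The quantity `δ = d_Esc √(min(w/2,1/4)/(κ₀+1))`. -/
def deltaEsc (dEsc w κ₀ : ℝ) : ℝ := dEsc * Real.sqrt (min (w / 2) (1 / 4) / (κ₀ + 1))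

/-- The length `L₀`. -/
def L0c (κ₀ ν K δ : ℝ) : ℝ := κ₀⁻¹ * Real.log (16 * K / (ν * δ ^ 2 * κ₀))

/-- The no-escape speed `c_noesc`. -/
def cNoEsc (κ₀ K L₀ δ : ℝ) : ℝ := 8 * K * L₀ / (κ₀ * δ ^ 2)

/-- The no-escape hull `h`. -/
def hull (δ L₀ : ℝ) (x : ℝ) : EReal :=
  if x < 0 then ⊤
  else if x ≤ L₀ then ((δ ^ 2 / 2 * (1 - x / (2 * L₀)) : ℝ) : EReal)
  else ((δ ^ 2 / 4 : ℝ) : EReal)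

/-- The standing hypothesis that the firewall is below the two mirror hulls positioned
around `rHom t`. -/
def HullBound (V : Euc n → ℝ) (d : ℕ) (lmin : ℝ) (u : ℝ → ℝ → Euc n) (δ L₀ : ℝ)
    (rHom : ℝ → ℝ) : Prop :=
  ∀ t ≥ (0:ℝ), rsc d lmin ≤ rHom t - 1 ∧
    ∀ r ≥ rsc d lmin, ((F0 V d lmin u r t : ℝ) : EReal) ≤
      max (hull δ L₀ (r - (rHom t - 1))) (hull δ L₀ (rHom t - r))

/-- The set whose infimum defines the escape point `r_esc(t)`. -/
def rescSet (V : Euc n → ℝ) (d : ℕ) (lmin : ℝ) (u : ℝ → ℝ → Euc n) (δ L₀ : ℝ)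
    (rHom : ℝ → ℝ) (t : ℝ) : Set ℝ :=
  {rl | rl ∈ Icc (rsc d lmin) (rHom t) ∧
    ∀ r ≥ rsc d lmin, ((F0 V d lmin u r t : ℝ) : EReal) ≤
      max (hull δ L₀ (r - rl)) (hull δ L₀ (rHom t - r))}

/-- The escape point `r_esc(t)`. -/
def rescF (V : Euc n → ℝ) (d : ℕ) (lmin : ℝ) (u : ℝ → ℝ → Euc n) (δ L₀ : ℝ)
    (rHom : ℝ → ℝ) (t : ℝ) : ℝ :=
  sInf (rescSet V d lmin u δ L₀ rHom t)

/-- `c̄`: upper limit of mean variations of a function over time intervals of length `s`. -/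
def cbarF (f : ℝ → ℝ) : ℝ :=
  limsup (fun s => sSup {x : ℝ | ∃ t ≥ (0:ℝ), x = f (t + s) - f t} / s) atTop

/-- `c̲`: lower limit of mean variations of a function over time intervals of length `s`. -/
def cunderF (f : ℝ → ℝ) : ℝ :=
  liminf (fun s => sInf {x : ℝ | ∃ t ≥ (0:ℝ), x = f (t + s) - f t} / s) atTop

/-- The decay rate `κ` in the travelling frame. -/
def kappaTF (lmin cno : ℝ) : ℝ := min (1 / 4) (lmin / (16 * (cno + 1)))

/-- The cut-off speed `c_cut` in the travelling frame. -/
def ccutTF (lmin lmax cno : ℝ) : ℝ := min (lmin / (8 * lmax)) (lmin / (8 * (cno + 1)))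

/-- The energy weight `w'` in the travelling frame. -/
def wTF (V : Euc n → ℝ) (cno : ℝ) : ℝ := min (wV V) (1 / (cno + 1) ^ 2)

/-- The weight function `χ` of the localized energy in the travelling frame. -/
def chiTF (d : ℕ) (lmin lmax cno c xcut r0 : ℝ) (ρ s : ℝ) : ℝ :=
  if ρ ≤ -r0 - c * s + rsc d lmin then
    Real.exp (c * ρ) * ((r0 + c * s + ρ) / rsc d lmin) ^ (d - 1)
  else if ρ ≤ xcut + ccutTF lmin lmax cno * s then Real.exp (c * ρ)
  else
    Real.exp ((c + kappaTF lmin cno) * (xcut + ccutTF lmin lmax cno * s) -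
      kappaTF lmin cno * ρ)

/-- The weight function `ψ` of the firewall in the travelling frame. -/
def psiTF (d : ℕ) (lmin lmax cno c xcut r0 : ℝ) (ρ s : ℝ) : ℝ :=
  if ρ ≤ -r0 - c * s + rsc d lmin then
    Real.exp ((c + kappaTF lmin cno) * ρ -
        kappaTF lmin cno * (xcut + ccutTF lmin lmax cno * s)) *
      ((r0 + c * s + ρ) / rsc d lmin) ^ (d - 1)
  else if ρ ≤ xcut + ccutTF lmin lmax cno * s then
    Real.exp ((c + kappaTF lmin cno) * ρ -
      kappaTF lmin cno * (xcut + ccutTF lmin lmax cno * s))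
  else
    Real.exp ((c + kappaTF lmin cno) * (xcut + ccutTF lmin lmax cno * s) -
      kappaTF lmin cno * ρ)

/-- The firewall functional `F(s)` in the travelling frame. -/
def FTF (V : Euc n → ℝ) (d : ℕ) (lmin lmax cno : ℝ) (u : ℝ → ℝ → Euc n)
    (t0 c xcut r0 : ℝ) (s : ℝ) : ℝ :=
  ∫ ρ in Ioi (-r0 - c * s),
    psiTF d lmin lmax cno c xcut r0 ρ s *
      (wTF V cno *
          (‖ur u (r0 + c * s + ρ) (t0 + s)‖ ^ 2 / 2 + V (u (r0 + c * s + ρ) (t0 + s))) +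
        ‖u (r0 + c * s + ρ) (t0 + s)‖ ^ 2 / 2)

/-- The set `Σ(s)` where the solution Escapes, in the travelling frame. -/
def SigmaTF (u : ℝ → ℝ → Euc n) (d : ℕ) (lmin dEsc : ℝ) (t0 c r0 : ℝ) (s : ℝ) : Set ℝ :=
  {ρ | -r0 - c * s + rsc d lmin ≤ ρ ∧ dEsc < ‖u (r0 + c * s + ρ) (t0 + s)‖}

/-- The weight function `ψ̃` in the standing frame. -/
def psiSF (d : ℕ) (κ cm cp : ℝ) (r t : ℝ) : ℝ :=
  if r ≤ cm * t then r ^ (d - 1) * Real.exp (-κ * (cm * t - r))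
  else if r ≤ cp * t then r ^ (d - 1)
  else r ^ (d - 1) * Real.exp (-κ * (r - cp * t))

/-- The firewall functional `F̃` in the standing frame. -/
def FSF (V : Euc n → ℝ) (d : ℕ) (κ cm cp : ℝ) (u : ℝ → ℝ → Euc n) (t : ℝ) : ℝ :=
  ∫ r in Ioi (0:ℝ),
    psiSF d κ cm cp r t * (wV V * (‖ur u r t‖ ^ 2 / 2 + V (u r t)) + ‖u r t‖ ^ 2 / 2)

/-- The quantity `δ_dissip(t)` measuring the dissipation around the escape point. -/
def deltaDissip (u : ℝ → ℝ → Euc n) (re : ℝ → ℝ) (cesc : ℝ) (t : ℝ) : ℝ :=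
  sInf {ε : ℝ | 0 < ε ∧
    (∫ τ in (-1:ℝ)..1, ∫ ρ in (-(1/ε))..(1/ε),
      ‖ut u (re (t + τ) + ρ) (t + τ) + cesc • ur u (re (t + τ) + ρ) (t + τ)‖ ^ 2) ≤ ε}

/-- `u` solves the radially symmetric system with initial datum `u₀`, in the sense of the
semi-flow on bounded continuous functions (classical for positive times). -/
def SolvesWithInit (d : ℕ) (V : Euc n → ℝ) (u : ℝ → ℝ → Euc n) (u₀ : ℝ → Euc n) : Prop :=
  (∀ r : ℝ, 0 ≤ r → u r 0 = u₀ r) ∧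
  (∀ t : ℝ, 0 ≤ t → ContinuousOn (fun r => u r t) (Ici 0) ∧ ∃ C, ∀ r : ℝ, 0 ≤ r → ‖u r t‖ ≤ C) ∧
  (∀ t : ℝ, 0 ≤ t → ∀ ε > (0:ℝ), ∃ δ > (0:ℝ), ∀ t' : ℝ, 0 ≤ t' → |t' - t| ≤ δ →
    ∀ r : ℝ, 0 ≤ r → ‖u r t' - u r t‖ ≤ ε) ∧
  (∀ t > (0:ℝ), ∀ r > (0:ℝ),
    DifferentiableAt ℝ (fun s => u s t) r ∧ DifferentiableAt ℝ (fun s => ur u s t) r) ∧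
  (∀ t > (0:ℝ), ∀ r : ℝ, 0 ≤ r → DifferentiableAt ℝ (fun s => u r s) t) ∧
  (∀ t > (0:ℝ), ∀ r > (0:ℝ),
    ut u r t = -gradient V (u r t) + (((d : ℝ) - 1) / r) • ur u r t + urr u r t) ∧
  (∀ t > (0:ℝ), DifferentiableAt ℝ (fun s => u s t) 0 ∧ ur u 0 t = 0)

/-! ### Exponential weights -/

/-- The weight equal to `e^{px}` far to the left and to `e^{-κx}` far to the right. -/
def expWeight (p κ x : ℝ) : ℝ := (Real.exp (-p * x) + Real.exp (κ * x))⁻¹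

/-- Derivative of `expWeight`. -/
def expWeight₁ (p κ x : ℝ) : ℝ :=
  (p * Real.exp (-p * x) - κ * Real.exp (κ * x)) * expWeight p κ x ^ 2

/-- Second derivative of `expWeight`. -/
def expWeight₂ (p κ x : ℝ) : ℝ :=
  (-p ^ 2 * Real.exp (-p * x) - κ ^ 2 * Real.exp (κ * x)) * expWeight p κ x ^ 2 +
    2 * (p * Real.exp (-p * x) - κ * Real.exp (κ * x)) ^ 2 * expWeight p κ x ^ 3

lemma expWeight_pos (p κ x : ℝ) : 0 < expWeight p κ x := by
  unfold expWeight; positivity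

lemma expWeight_mul (p κ x : ℝ) :
    expWeight p κ x * (Real.exp (-p * x) + Real.exp (κ * x)) = 1 := by
  unfold expWeight
  exact inv_mul_cancel₀ (by positivity)

lemma expWeight_le_exp_left (p κ x : ℝ) : expWeight p κ x ≤ Real.exp (p * x) := by
  have h : Real.exp (p * x) = (Real.exp (-p * x))⁻¹ := by
    rw [← Real.exp_neg]; ring_nf
  rw [h, expWeight]
  gcongr
  linarith [Real.exp_pos (κ * x)]

lemma expWeight_le_exp_right (p κ x : ℝ) : expWeight p κ x ≤ Real.exp (-κ * x) := by
  have h : Real.exp (-κ * x) = (Real.exp (κ * x))⁻¹ := by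
    rw [← Real.exp_neg]; ring_nf
  rw [h, expWeight]
  gcongr
  linarith [Real.exp_pos (-p * x)]

lemma le_expWeight {p κ x M : ℝ} (hp : 0 < p + κ) (hx : x ≤ M) :
    Real.exp (p * x) / (1 + Real.exp ((p + κ) * M)) ≤ expWeight p κ x := by
  have h1 : Real.exp (-p * x) * Real.exp (p * x) = 1 := by
    rw [← Real.exp_add]; simp
  have h2 : Real.exp (κ * x) * Real.exp (p * x) ≤ Real.exp ((p + κ) * M) := by
    rw [← Real.exp_add]
    apply Real.exp_le_exp.2
    nlinarith
  rw [div_le_iff₀ (by positivity)]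
  have h3 := expWeight_mul p κ x
  have h4 := expWeight_pos p κ x
  calc Real.exp (p * x)
      = Real.exp (p * x) * (expWeight p κ x * (Real.exp (-p * x) + Real.exp (κ * x))) := by
        rw [h3, mul_one]
    _ = expWeight p κ x * (Real.exp (-p * x) * Real.exp (p * x) +
          Real.exp (κ * x) * Real.exp (p * x)) := by ring
    _ ≤ _ := by rw [h1]; gcongr

lemma hasDerivAt_expWeight (p κ x : ℝ) :
    HasDerivAt (expWeight p κ) (expWeight₁ p κ x) x := by
  have hA : HasDerivAt (fun y => Real.exp (-p * y)) (Real.exp (-p * x) * (-p * 1)) x :=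
    ((hasDerivAt_id x).const_mul (-p)).exp
  have hB : HasDerivAt (fun y => Real.exp (κ * y)) (Real.exp (κ * x) * (κ * 1)) x :=
    ((hasDerivAt_id x).const_mul κ).exp
  have h := (hA.add hB).inv (by simp only [Pi.add_apply]; positivity)
  refine h.congr_deriv ?_
  simp only [expWeight₁, expWeight, Pi.add_apply]
  field_simp
  ring

lemma hasDerivAt_expWeight₁ (p κ x : ℝ) :
    HasDerivAt (expWeight₁ p κ) (expWeight₂ p κ x) x := by
  have hA : HasDerivAt (fun y => Real.exp (-p * y)) (Real.exp (-p * x) * (-p * 1)) x :=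
    ((hasDerivAt_id x).const_mul (-p)).exp
  have hB : HasDerivAt (fun y => Real.exp (κ * y)) (Real.exp (κ * x) * (κ * 1)) x :=
    ((hasDerivAt_id x).const_mul κ).exp
  have h := ((hA.const_mul p).sub (hB.const_mul κ)).mul ((hasDerivAt_expWeight p κ x).pow 2)
  refine h.congr_deriv ?_
  simp only [expWeight₂, expWeight₁, Pi.sub_apply]
  push_cast
  simp only [Pi.pow_apply]
  ring

lemma continuous_expWeight (p κ : ℝ) : Continuous (expWeight p κ) :=
  continuous_iff_continuousAt.2 fun x => (hasDerivAt_expWeight p κ x).continuousAt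

lemma continuous_expWeight₁ (p κ : ℝ) : Continuous (expWeight₁ p κ) :=
  continuous_iff_continuousAt.2 fun x => (hasDerivAt_expWeight₁ p κ x).continuousAt

lemma continuous_expWeight₂ (p κ : ℝ) : Continuous (expWeight₂ p κ) := by
  have h := continuous_expWeight p κ
  unfold expWeight₂
  fun_prop

section
variable {p κ : ℝ} (x : ℝ)

lemma abs_expWeight₁_le (hp : 0 ≤ p) (hκ : 0 ≤ κ) :
    |expWeight₁ p κ x| ≤ (p + κ) * expWeight p κ x := by
  have h3 := expWeight_mul p κ x
  have h4 := expWeight_pos p κ x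
  have hA := Real.exp_pos (-p * x)
  have hB := Real.exp_pos (κ * x)
  unfold expWeight₁
  generalize expWeight p κ x = w at *
  generalize Real.exp (-p * x) = A at *
  generalize Real.exp (κ * x) = B at *
  have e : (p + κ) * w = (p + κ) * (A + B) * w ^ 2 := by
    calc (p + κ) * w = (p + κ) * w * (w * (A + B)) := by rw [h3, mul_one]
      _ = _ := by ring
  rw [e, abs_mul, abs_of_nonneg (sq_nonneg w)]
  gcongr
  rw [abs_le]
  have := mul_nonneg hp hA.le
  have := mul_nonneg hp hB.le
  have := mul_nonneg hκ hA.le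
  have := mul_nonneg hκ hB.le
  constructor <;> nlinarith

lemma abs_expWeight₂_le (hp : 0 ≤ p) (hκ : 0 ≤ κ) :
    |expWeight₂ p κ x| ≤ 3 * (p + κ) ^ 2 * expWeight p κ x := by
  have h1 := abs_expWeight₁_le x hp hκ
  have h3 := expWeight_mul p κ x
  have h4 := expWeight_pos p κ x
  have hA := Real.exp_pos (-p * x)
  have hB := Real.exp_pos (κ * x)
  unfold expWeight₂
  unfold expWeight₁ at h1
  generalize expWeight p κ x = w at *
  generalize Real.exp (-p * x) = A at *
  generalize Real.exp (κ * x) = B at *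
  have e2 : |(-p ^ 2 * A - κ ^ 2 * B) * w ^ 2| ≤ (p + κ) ^ 2 * w := by
    have e : (p + κ) ^ 2 * w = (p + κ) ^ 2 * (A + B) * w ^ 2 := by
      calc (p + κ) ^ 2 * w = (p + κ) ^ 2 * w * (w * (A + B)) := by rw [h3, mul_one]
        _ = _ := by ring
    rw [e, abs_mul, abs_of_nonneg (sq_nonneg w)]
    gcongr
    have h5 : 0 ≤ p ^ 2 * A := by positivity
    have h6 : 0 ≤ κ ^ 2 * B := by positivity
    have h7 : 0 ≤ p ^ 2 * B := by positivity
    have h8 : 0 ≤ κ ^ 2 * A := by positivity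
    have h9 : 0 ≤ p * κ * (A + B) := by positivity
    rw [abs_le]
    constructor <;> nlinarith
  have e3 : 2 * (p * A - κ * B) ^ 2 * w ^ 3 ≤ 2 * ((p + κ) ^ 2 * w) := by
    have h5 : ((p * A - κ * B) * w ^ 2) ^ 2 ≤ ((p + κ) * w) ^ 2 := sq_le_sq.2 (by
      rw [abs_of_nonneg (by positivity : 0 ≤ (p + κ) * w)]; exact h1)
    have h6 : (p * A - κ * B) ^ 2 * w ^ 3 * w ≤ (p + κ) ^ 2 * w * w := by nlinarith
    have := le_of_mul_le_mul_right h6 h4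
    linarith
  have e4 : 0 ≤ 2 * (p * A - κ * B) ^ 2 * w ^ 3 := by positivity
  refine (abs_add_le _ _).trans ?_
  rw [abs_of_nonneg e4]
  linarith

end

section
variable {c κ : ℝ} (x : ℝ)

lemma expWeight_add_le (hc : 0 ≤ c) (hκ : 0 ≤ κ) :
    expWeight (c + κ) κ x ≤ 2 * expWeight c κ x := by
  have hA := Real.exp_pos (-c * x)
  have hA' := Real.exp_pos (-(c + κ) * x)
  have hB := Real.exp_pos (κ * x)
  have key : Real.exp (-c * x) ≤ Real.exp (-(c + κ) * x) + Real.exp (κ * x) := by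
    rcases le_total 0 x with h | h
    · have : Real.exp (-c * x) ≤ Real.exp (κ * x) := Real.exp_le_exp.2 (by nlinarith)
      linarith
    · have : Real.exp (-c * x) ≤ Real.exp (-(c + κ) * x) := Real.exp_le_exp.2 (by nlinarith)
      linarith
  unfold expWeight
  rw [← div_eq_mul_inv, le_div_iff₀ (by positivity), inv_mul_le_iff₀ (by positivity)]
  linarith

lemma expWeight_defect_eq :
    c * expWeight c κ x - expWeight₁ c κ x =
      (c + κ) * Real.exp (κ * x) * expWeight c κ x ^ 2 := by
  have h3 := expWeight_mul c κ x
  unfold expWeight₁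
  linear_combination (-c * expWeight c κ x) * h3

lemma expWeight_defect_nonneg (hc : 0 ≤ c) (hκ : 0 ≤ κ) :
    0 ≤ c * expWeight c κ x - expWeight₁ c κ x := by
  rw [expWeight_defect_eq]
  have := expWeight_pos c κ x
  positivity

lemma expWeight_defect_le (hc : 0 ≤ c) (hκ : 0 ≤ κ) :
    c * expWeight c κ x - expWeight₁ c κ x ≤ 2 * (c + κ) * expWeight (c + κ) κ x := by
  rw [expWeight_defect_eq]
  have hA := Real.exp_pos (-c * x)
  have hA' := Real.exp_pos (-(c + κ) * x)
  have hB := Real.exp_pos (κ * x)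
  have e : Real.exp (κ * x) * Real.exp (-(c + κ) * x) = Real.exp (-c * x) := by
    rw [← Real.exp_add]; ring_nf
  have key : 1 ≤ Real.exp (-c * x) + Real.exp (κ * x) := by
    rcases le_total 0 x with h | h
    · have : 1 ≤ Real.exp (κ * x) := Real.one_le_exp (by nlinarith)
      linarith
    · have : 1 ≤ Real.exp (-c * x) := Real.one_le_exp (by nlinarith)
      linarith
  unfold expWeight
  generalize Real.exp (-c * x) = A at *
  generalize Real.exp (-(c + κ) * x) = A' at *
  generalize Real.exp (κ * x) = B at *
  rw [inv_pow, ← div_eq_mul_inv, ← div_eq_mul_inv, div_le_div_iff₀ (by positivity) (by positivity)]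
  have h1 : B * (A' + B) ≤ 2 * (A + B) ^ 2 := by nlinarith
  have h2 : 0 ≤ c + κ := by positivity
  nlinarith [mul_le_mul_of_nonneg_left h1 h2]

lemma expWeight_defect_sq_le (hc : 0 ≤ c) (hκ : 0 ≤ κ) :
    (c * expWeight c κ x - expWeight₁ c κ x) ^ 2 ≤
      2 * (c + κ) ^ 2 * expWeight (c + κ) κ x * expWeight c κ x := by
  have h1 := expWeight_defect_le x hc hκ
  have h0 := expWeight_defect_nonneg x hc hκ
  have h2 : c * expWeight c κ x - expWeight₁ c κ x ≤ (c + κ) * expWeight c κ x := by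
    rw [expWeight_defect_eq]
    have h3 := expWeight_mul c κ x
    have h4 := expWeight_pos c κ x
    have hA := Real.exp_pos (-c * x)
    have hB := Real.exp_pos (κ * x)
    have h5 : Real.exp (κ * x) * expWeight c κ x ≤ 1 := by nlinarith
    calc (c + κ) * Real.exp (κ * x) * expWeight c κ x ^ 2
        = (c + κ) * expWeight c κ x * (Real.exp (κ * x) * expWeight c κ x) := by ring
      _ ≤ (c + κ) * expWeight c κ x * 1 := by gcongr
      _ = _ := by ring
  calc _ = (c * expWeight c κ x - expWeight₁ c κ x) *
        (c * expWeight c κ x - expWeight₁ c κ x) := by ring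
    _ ≤ (2 * (c + κ) * expWeight (c + κ) κ x) * ((c + κ) * expWeight c κ x) := by
        apply mul_le_mul h1 h2 h0
        have := expWeight_pos (c + κ) κ x
        positivity
    _ = _ := by ring

lemma expWeight₂_sub_le (hc : 0 ≤ c) (hκ : 0 ≤ κ) :
    expWeight₂ (c + κ) κ x - c * expWeight₁ (c + κ) κ x ≤
      κ * (c + κ) * expWeight (c + κ) κ x := by
  have h3 := expWeight_mul (c + κ) κ x
  have h4 := expWeight_pos (c + κ) κ x
  have hA := Real.exp_pos (-(c + κ) * x)
  have hB := Real.exp_pos (κ * x)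
  unfold expWeight₂ expWeight₁
  generalize expWeight (c + κ) κ x = w at *
  generalize Real.exp (-(c + κ) * x) = A at *
  generalize Real.exp (κ * x) = B at *
  have e : κ * (c + κ) * w - (((-(c + κ) ^ 2 * A - κ ^ 2 * B) * w ^ 2 +
      2 * ((c + κ) * A - κ * B) ^ 2 * w ^ 3) - c * (((c + κ) * A - κ * B) * w ^ 2)) =
      ((2 * κ * (c + κ) + (c + κ) ^ 2 + κ ^ 2 + 4 * (c + κ) * κ + c * c) * A * B) * w ^ 3 := by
    have e1 : w = w ^ 3 * (A + B) ^ 2 := by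
      calc w = w * (w * (A + B)) ^ 2 := by rw [h3]; ring
        _ = _ := by ring
    have e2 : w ^ 2 = w ^ 3 * (A + B) := by
      calc w ^ 2 = w ^ 2 * (w * (A + B)) := by rw [h3]; ring
        _ = _ := by ring
    generalize w ^ 3 = z at *
    rw [e2, e1]
    ring
  have : 0 ≤ ((2 * κ * (c + κ) + (c + κ) ^ 2 + κ ^ 2 + 4 * (c + κ) * κ + c * c) * A * B) * w ^ 3 := by
    positivity
  linarith

lemma expWeight₁_defect_le (hc : 0 ≤ c) (hκ : 0 ≤ κ) :
    c * expWeight (c + κ) κ x - expWeight₁ (c + κ) κ x ≤ (c + κ) * expWeight (c + κ) κ x := by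
  have h3 := expWeight_mul (c + κ) κ x
  have h4 := expWeight_pos (c + κ) κ x
  have hA := Real.exp_pos (-(c + κ) * x)
  have hB := Real.exp_pos (κ * x)
  unfold expWeight₁
  generalize expWeight (c + κ) κ x = w at *
  generalize Real.exp (-(c + κ) * x) = A at *
  generalize Real.exp (κ * x) = B at *
  have e : (c + κ) * w - (c * w - ((c + κ) * A - κ * B) * w ^ 2) = (c + 2 * κ) * A * w ^ 2 := by
    linear_combination (-κ * w) * h3
  have : 0 ≤ (c + 2 * κ) * A * w ^ 2 := by positivity
  linarith

end

/-! ### Growth dichotomy for functions satisfying an exponential summation inequality -/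

lemma sum_growth {a : ℕ → ℝ} {A B : ℝ} (hB : 0 < B) {S N₀ : ℕ}
    (ha : ∀ j, 0 < a j)
    (hsum : ∀ N ≤ S, ∑ j ∈ Finset.range N, a j ≤ A + B * a N)
    (h0 : A + 1 ≤ a N₀) {m : ℕ} (hm : N₀ + 1 + m ≤ S) :
    (1 + 1 / B) ^ m / B ≤ a (N₀ + 1 + m) := by
  have step : ∀ m, N₀ + 1 + m ≤ S →
      (1 + 1 / B) ^ m ≤ (∑ j ∈ Finset.range (N₀ + 1 + m), a j) - A := by
    intro m
    induction m with
    | zero =>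
      intro _
      rw [add_zero, Finset.sum_range_succ, pow_zero]
      have : 0 ≤ ∑ j ∈ Finset.range N₀, a j := Finset.sum_nonneg fun j _ => (ha j).le
      linarith
    | succ m ih =>
      intro h
      have h1 := ih (by omega)
      have h2 := hsum (N₀ + 1 + m) (by omega)
      rw [← add_assoc, Finset.sum_range_succ, pow_succ]
      set s := ∑ j ∈ Finset.range (N₀ + 1 + m), a j
      have h3 : (s - A) / B ≤ a (N₀ + 1 + m) := by
        rw [div_le_iff₀ hB]; linarith
      have h4 : (1 + 1 / B) ^ m * (1 + 1 / B) ≤ (s - A) * (1 + 1 / B) := by gcongr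
      have h5 : (s - A) * (1 + 1 / B) = (s - A) + (s - A) / B := by ring
      linarith
  have h1 := step m hm
  have h2 := hsum _ hm
  rw [div_le_iff₀ hB]
  linarith

/-- If the position `f` grows at most linearly and, along windows of any length `S` starting late
and far enough, obeys an exponential summation inequality in the frame of speed `c`, then either
its mean growth rate never exceeds `c'`, or `f` eventually stays above a line of slope `c`. -/
lemma growth_dichotomy {f : ℝ → ℝ} {c c' c₁ C₁ A B : ℝ} (hc : 0 < c) (hcc' : c < c')
    (hA : 0 ≤ A) (hB : 1 ≤ B) (hc₁ : 0 ≤ c₁) (hC₁ : 0 ≤ C₁)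
    (hf0 : ∀ t, 0 ≤ t → 0 ≤ f t)
    (hgrow : ∀ t s, 0 ≤ t → 0 ≤ s → f (t + s) ≤ f t + c₁ * s + C₁)
    (hstar : ∀ S : ℕ, ∃ T R : ℝ, ∀ t, T ≤ t → R ≤ f t → ∀ N ≤ S,
      ∑ j ∈ Finset.range N, Real.exp (c * (f (t + j) - f t - c * j)) ≤
        A + B * Real.exp (c * (f (t + N) - f t - c * N))) :
    (∃ C, ∀ t s, 0 ≤ t → 0 ≤ s → f (t + s) - f t ≤ c' * s + C) ∨
      ∃ C t₁, ∀ t, t₁ ≤ t → c * t - C ≤ f t := by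
  have hB0 : 0 < B := by linarith
  obtain ⟨H, hH0, hH⟩ : ∃ H : ℝ, 0 < H ∧ A + 1 ≤ Real.exp (c * H) := by
    refine ⟨(A + 1) / c, by positivity, ?_⟩
    rw [mul_div_cancel₀ _ hc.ne']
    linarith [Real.add_one_le_exp (A + 1)]
  obtain ⟨γ, hγ⟩ : ∃ γ, γ = Real.log (1 + 1 / B) / c := ⟨_, rfl⟩
  obtain ⟨C₂, hC₂⟩ : ∃ C₂, C₂ = Real.log B / c := ⟨_, rfl⟩
  have hγ0 : 0 < γ := by
    rw [hγ]
    exact div_pos (Real.log_pos (by linarith [div_pos one_pos hB0])) hc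
  have hC₂0 : 0 ≤ C₂ := by rw [hC₂]; exact div_nonneg (Real.log_nonneg hB) hc.le
  obtain ⟨N₀, hN₀⟩ := exists_nat_ge (2 * H / γ + H / (c' - c) + 1)
  have hN₀a : 2 * H ≤ γ * N₀ := by
    have h1 : 0 < H / (c' - c) := div_pos hH0 (by linarith)
    have : 2 * H / γ ≤ N₀ := by linarith
    rw [div_le_iff₀ hγ0] at this
    linarith
  have hN₀b : c * N₀ + H ≤ c' * N₀ := by
    have h1 : 0 < 2 * H / γ := by positivity
    have : H / (c' - c) ≤ N₀ := by linarith
    rw [div_le_iff₀ (by linarith)] at this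
    linarith
  have hN₀c : (1 : ℝ) ≤ N₀ := by
    have h1 : 0 < 2 * H / γ := by positivity
    have h2 : 0 < H / (c' - c) := div_pos hH0 (by linarith)
    linarith
  obtain ⟨M₁, hM₁⟩ := exists_nat_ge (C₂ / γ)
  have hM₁' : C₂ ≤ γ * M₁ := by
    rw [div_le_iff₀ hγ0] at hM₁; linarith
  obtain ⟨M₀, hM₀⟩ : ∃ M₀ : ℕ, M₀ = N₀ + 1 + M₁ := ⟨_, rfl⟩
  obtain ⟨I, hI⟩ := exists_nat_gt ((c₁ * M₀ + C₁ + γ * (N₀ + 1) + C₂) / H)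
  have hI' : c₁ * M₀ + C₁ + γ * (N₀ + 1) + C₂ < I * H := by
    rwa [div_lt_iff₀ hH0] at hI
  obtain ⟨S, hS⟩ : ∃ S : ℕ, S = M₀ + I * N₀ := ⟨_, rfl⟩
  obtain ⟨T, R, hTR⟩ := hstar S
  -- once launched, the position outruns the frame
  have launch : ∀ t, T ≤ t → R ≤ f t → H ≤ f (t + N₀) - f t - c * N₀ →
      ∀ N : ℕ, N₀ + 1 ≤ N → N ≤ S → γ * (N - (N₀ + 1)) - C₂ ≤ f (t + N) - f t - c * N := by
    intro t ht hR hP N hN1 hN2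
    obtain ⟨m, rfl⟩ := Nat.exists_eq_add_of_le hN1
    have h1 := sum_growth (a := fun j : ℕ => Real.exp (c * (f (t + j) - f t - c * j)))
      (A := A) (S := S) (N₀ := N₀) hB0
      (fun j => Real.exp_pos _) (hTR t ht hR)
      (hH.trans (Real.exp_le_exp.2 (mul_le_mul_of_nonneg_left hP hc.le))) hN2
    have h2 : 0 < (1 + 1 / B) ^ m / B := by positivity
    have h3 := Real.log_le_log h2 h1
    rw [Real.log_exp, Real.log_div (by positivity) hB0.ne', Real.log_pow] at h3
    have h4 : γ * m - C₂ = (m * Real.log (1 + 1 / B) - Real.log B) / c := by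
      rw [hγ, hC₂]; ring
    push_cast at h3 ⊢
    have h5 : γ * m - C₂ ≤ f (t + (N₀ + 1 + m)) - f t - c * (N₀ + 1 + m) := by
      rw [h4, div_le_iff₀ hc]
      linarith
    calc _ = γ * m - C₂ := by ring
      _ ≤ _ := h5
  by_cases hex : ∃ t, 0 ≤ t ∧ T ≤ t ∧ R ≤ f t ∧ H ≤ f (t + N₀) - f t - c * N₀
  · right
    obtain ⟨t₀, ht₀, hT₀, hR₀, hP₀⟩ := hex
    have relaunch : ∀ t, 0 ≤ t → T ≤ t → R ≤ f t → H ≤ f (t + N₀) - f t - c * N₀ →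
        ∃ p : ℕ, 1 ≤ p ∧ p ≤ S ∧ f t + c * p ≤ f (t + p) ∧
          H ≤ f (t + p + N₀) - f (t + p) - c * N₀ := by
      intro t h0 ht hR hP
      have hl := launch t ht hR hP
      by_contra! hcon
      have hpos : ∀ i < I, f (t + (M₀ + i * N₀ : ℕ)) - f t - c * (M₀ + i * N₀ : ℕ) ≥ 0 := by
        intro i hi
        have h1 := hl (M₀ + i * N₀) (by rw [hM₀]; have := Nat.zero_le (i * N₀); omega)
          (by rw [hS]; gcongr)
        have h2 : γ * M₁ ≤ γ * ((M₀ + i * N₀ : ℕ) - (N₀ + 1)) := by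
          gcongr
          rw [hM₀]; push_cast
          have : (0 : ℝ) ≤ i * N₀ := by positivity
          linarith
        linarith
      have hstep : ∀ i ≤ I, f (t + (M₀ + i * N₀ : ℕ)) - f t - c * (M₀ + i * N₀ : ℕ) ≤
          f (t + M₀) - f t - c * M₀ + i * H := by
        intro i
        induction i with
        | zero => intro _; simp
        | succ i ih =>
          intro hi
          have h1 := ih (by omega)
          have h2 := hpos i (by omega)
          have h3 := hcon (M₀ + i * N₀) (by rw [hM₀]; have := Nat.zero_le (i * N₀); omega)
            (by rw [hS]; gcongr; omega) (by linarith)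
          have e : ((M₀ + (i + 1) * N₀ : ℕ) : ℝ) = (M₀ + i * N₀ : ℕ) + N₀ := by
            push_cast; ring
          rw [e, ← add_assoc]
          push_cast at *
          linarith
      have h1 := hstep I le_rfl
      have h2 := hl S (by rw [hS, hM₀]; have := Nat.zero_le (I * N₀); omega) le_rfl
      have h3 := hgrow t M₀ h0 (by positivity)
      rw [← hS] at h1
      have h4 : γ * (S - (N₀ + 1)) ≥ 2 * (I * H) - γ * (N₀ + 1) := by
        have e : (S : ℝ) = M₀ + I * N₀ := by rw [hS]; push_cast; ring
        rw [e]
        have : (0 : ℝ) ≤ I := by positivity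
        have h5 := mul_le_mul_of_nonneg_left hN₀a this
        have h6 : 0 ≤ γ * M₀ := by positivity
        nlinarith
      have h7 : 0 ≤ c * M₀ := by positivity
      linarith
    choose! p hp1 hpS hpf hpP using relaunch
    let τ : ℕ → ℝ := fun i => Nat.rec t₀ (fun _ s => s + p s) i
    have hτ0 : τ 0 = t₀ := rfl
    have hτs : ∀ i, τ (i + 1) = τ i + p (τ i) := fun i => rfl
    have inv : ∀ i, 0 ≤ τ i ∧ T ≤ τ i ∧ R ≤ f (τ i) ∧ H ≤ f (τ i + N₀) - f (τ i) - c * N₀ ∧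
        f t₀ + c * (τ i - t₀) ≤ f (τ i) ∧ t₀ + i ≤ τ i := by
      intro i
      induction i with
      | zero => rw [hτ0]; refine ⟨ht₀, hT₀, hR₀, hP₀, by simp, by simp⟩
      | succ i ih =>
        obtain ⟨a1, a2, a3, a4, a5, a6⟩ := ih
        have b1 := hp1 _ a1 a2 a3 a4
        have b3 := hpf _ a1 a2 a3 a4
        have b4 := hpP _ a1 a2 a3 a4
        rw [hτs]
        have b5 : (1 : ℝ) ≤ p (τ i) := by exact_mod_cast b1
        have b6 : 0 ≤ c * p (τ i) := by positivity
        refine ⟨by linarith, by linarith, by linarith, b4, by linarith, ?_⟩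
        push_cast; linarith
    refine ⟨c₁ * S + C₁ - f t₀ + c * t₀, t₀, fun t ht => ?_⟩
    have hexi : ∃ i, t < τ i := by
      obtain ⟨i, hi⟩ := exists_nat_gt (t - t₀)
      exact ⟨i, by linarith [(inv i).2.2.2.2.2]⟩
    classical
    obtain ⟨i, hi, hmin⟩ : ∃ i, t < τ (i + 1) ∧ τ i ≤ t := by
      have h1 := Nat.find_spec hexi
      have h2 : Nat.find hexi ≠ 0 := by
        intro h
        rw [h, hτ0] at h1
        linarith
      obtain ⟨i, hi⟩ := Nat.exists_eq_succ_of_ne_zero h2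
      refine ⟨i, by rw [← Nat.succ_eq_add_one, ← hi]; exact h1, ?_⟩
      have := Nat.find_min hexi (m := i) (by omega)
      linarith
    obtain ⟨a1, a2, a3, a4, a5, a6⟩ := inv i
    obtain ⟨b1, b2, b3, b4, b5, b6⟩ := inv (i + 1)
    have h1 := hgrow t (τ (i + 1) - t) (by linarith) (by linarith)
    rw [add_sub_cancel] at h1
    have h2 : τ (i + 1) - t ≤ S := by
      rw [hτs]
      have : (p (τ i) : ℝ) ≤ S := by exact_mod_cast hpS _ a1 a2 a3 a4
      linarith
    have h3 := mul_le_mul_of_nonneg_left h2 hc₁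
    have h4 := mul_le_mul_of_nonneg_left hi.le hc.le
    linarith
  · left
    push Not at hex
    obtain ⟨C, hC⟩ : ∃ C, C = c₁ * N₀ + C₁ + |R| + (f 0 + c₁ * |T| + C₁) := ⟨_, rfl⟩
    have hf00 := hf0 0 le_rfl
    have hc' : 0 < c' := by linarith
    refine ⟨C, ?_⟩
    have main : ∀ m : ℕ, ∀ t s : ℝ, 0 ≤ t → 0 ≤ s → s ≤ m * N₀ → f (t + s) - f t ≤ c' * s + C := by
      intro m
      induction m with
      | zero =>
        intro t s ht hs hm
        have hs0 : s = 0 := by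
          push_cast at hm
          linarith
        subst hs0
        have : 0 ≤ C := by rw [hC]; positivity
        simpa using this
      | succ m ih =>
        intro t s ht hs hm
        have hT : 0 ≤ c₁ * |T| := by positivity
        rcases le_total s N₀ with h | h
        · have h1 := hgrow t s ht hs
          have h2 := mul_le_mul_of_nonneg_left h hc₁
          have h3 : 0 ≤ c' * s := by positivity
          have := abs_nonneg R
          linarith
        · have e : t + s = (t + s - N₀) + N₀ := by ring
          have hg := hgrow (t + s - N₀) N₀ (by linarith) (by linarith)
          rw [← e] at hg
          have hft := hf0 t ht
          have h3 : 0 ≤ c' * s := by positivity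
          by_cases h1 : T ≤ t + s - N₀
          · by_cases h2 : R ≤ f (t + s - N₀)
            · have h4 := hex (t + s - N₀) (by linarith) h1 h2
              rw [← e] at h4
              have h5 := ih t (s - N₀) ht (by linarith) (by push_cast at hm; linarith)
              rw [← add_sub_assoc] at h5
              linarith
            · have := le_abs_self R
              linarith
          · have h4 := hgrow 0 (t + s - N₀) le_rfl (by linarith)
            rw [zero_add] at h4
            have h5 : t + s - N₀ ≤ |T| := by linarith [le_abs_self T]
            have h6 := mul_le_mul_of_nonneg_left h5 hc₁
            have := abs_nonneg R
            linarith
    intro t s ht hs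
    obtain ⟨m, hm⟩ := exists_nat_ge s
    exact main m t s ht hs (by nlinarith)

section Potential

variable {V : Euc n → ℝ}

lemma hasGradientAt_of_contDiff (hV : ContDiff ℝ 2 V) (x : Euc n) :
    HasGradientAt V (gradient V x) x :=
  ((hV.differentiable (by norm_num)) x).hasGradientAt

lemma contDiff_gradient (hV : ContDiff ℝ 2 V) : ContDiff ℝ 1 (gradient V) := by
  have h : ContDiff ℝ 1 (fderiv ℝ V) := hV.fderiv_right (by norm_num)
  exact ((InnerProductSpace.toDual ℝ (Euc n)).symm.toContinuousLinearEquiv.contDiff).comp h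

lemma hasDerivAt_comp_potential (hV : ContDiff ℝ 2 V) {f : ℝ → Euc n} {f' : Euc n} {t : ℝ}
    (hf : HasDerivAt f f' t) : HasDerivAt (fun s => V (f s)) ⟪gradient V (f t), f'⟫ t := by
  have h := (hasGradientAt_of_contDiff hV (f t)).hasFDerivAt.comp_hasDerivAt t hf
  rw [InnerProductSpace.toDual_apply_apply] at h
  exact h

lemma hasFDerivAt_gradient (hV : ContDiff ℝ 2 V) (x : Euc n) :
    HasFDerivAt (gradient V) (hess V x) x :=
  ((contDiff_gradient hV).differentiable (by norm_num) x).hasFDerivAt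

lemma hasDerivAt_comp_gradient (hV : ContDiff ℝ 2 V) {f : ℝ → Euc n} {f' : Euc n} {t : ℝ}
    (hf : HasDerivAt f f' t) :
    HasDerivAt (fun s => gradient V (f s)) (hess V (f t) f') t :=
  (hasFDerivAt_gradient hV (f t)).comp_hasDerivAt t hf

lemma inner_gradient_ge (hV : ContDiff ℝ 2 V) {m : Euc n} {l R : ℝ} (hm : gradient V m = 0)
    (h : ∀ x : Euc n, ‖x - m‖ ≤ R → ∀ v : Euc n, l * ‖v‖ ^ 2 ≤ ⟪v, hess V x v⟫)
    {x : Euc n} (hx : ‖x - m‖ ≤ R) : l * ‖x - m‖ ^ 2 ≤ ⟪x - m, gradient V x⟫ := by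
  set v := x - m with hv
  have hd : ∀ s : ℝ, HasDerivAt (fun s : ℝ => m + s • v) v s := fun s => by
    simpa using ((hasDerivAt_id s).smul_const v).const_add m
  have hg : ∀ s : ℝ, HasDerivAt (fun s : ℝ => ⟪v, gradient V (m + s • v)⟫)
      ⟪v, hess V (m + s • v) v⟫ s := fun s => by
    simpa using (hasDerivAt_const s v).inner ℝ (hasDerivAt_comp_gradient hV (hd s))
  have := Convex.mul_sub_le_image_sub_of_le_deriv (convex_Icc (0:ℝ) 1)
    (f := fun s : ℝ => ⟪v, gradient V (m + s • v)⟫)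
    (fun s _ => (hg s).continuousAt.continuousWithinAt)
    (fun s _ => (hg s).differentiableAt.differentiableWithinAt) (C := l * ‖v‖ ^ 2)
    (fun s hs => by
      rw [interior_Icc] at hs
      rw [(hg s).deriv]
      refine h _ ?_ v
      rw [add_sub_cancel_left, norm_smul, Real.norm_of_nonneg hs.1.le]
      exact (mul_le_of_le_one_left (norm_nonneg _) hs.2.le).trans hx)
    0 (by simp) 1 (by simp) zero_le_one
  simpa [hm, hv] using this

lemma potential_sub_ge (hV : ContDiff ℝ 2 V) {m : Euc n} {l R : ℝ} (hm : gradient V m = 0)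
    (h : ∀ x : Euc n, ‖x - m‖ ≤ R → ∀ v : Euc n, l * ‖v‖ ^ 2 ≤ ⟪v, hess V x v⟫)
    {x : Euc n} (hx : ‖x - m‖ ≤ R) : l / 2 * ‖x - m‖ ^ 2 ≤ V x - V m := by
  set v := x - m with hv
  have hd : ∀ s : ℝ, HasDerivAt (fun s : ℝ => m + s • v) v s := fun s => by
    simpa using ((hasDerivAt_id s).smul_const v).const_add m
  have hg : ∀ s : ℝ, HasDerivAt (fun s : ℝ => V (m + s • v) - l / 2 * ‖v‖ ^ 2 * s ^ 2)
      (⟪gradient V (m + s • v), v⟫ - l * ‖v‖ ^ 2 * s) s := fun s => by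
    refine ((hasDerivAt_comp_potential hV (hd s)).sub
      ((hasDerivAt_pow 2 s).const_mul (l / 2 * ‖v‖ ^ 2))).congr_deriv ?_
    simp only [Nat.cast_ofNat, Nat.add_one_sub_one, pow_one]
    ring
  have := monotoneOn_of_deriv_nonneg (convex_Icc (0:ℝ) 1)
    (f := fun s : ℝ => V (m + s • v) - l / 2 * ‖v‖ ^ 2 * s ^ 2)
    (fun s _ => (hg s).continuousAt.continuousWithinAt)
    (fun s _ => (hg s).differentiableAt.differentiableWithinAt)
    (fun s hs => by
      rw [interior_Icc] at hs
      rw [(hg s).deriv]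
      have h1 : ‖(m + s • v) - m‖ ≤ R := by
        rw [add_sub_cancel_left, norm_smul, Real.norm_of_nonneg hs.1.le]
        exact (mul_le_of_le_one_left (norm_nonneg _) hs.2.le).trans hx
      have h2 := inner_gradient_ge hV hm h h1
      rw [add_sub_cancel_left, norm_smul, Real.norm_of_nonneg hs.1.le, real_inner_smul_left,
        real_inner_comm] at h2
      have h3 : s * (l * ‖v‖ ^ 2 * s) ≤ s * ⟪gradient V (m + s • v), v⟫ := by
        convert h2 using 1; ring
      linarith [le_of_mul_le_mul_left h3 hs.1])
    (left_mem_Icc.2 zero_le_one) (right_mem_Icc.2 zero_le_one) zero_le_one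
  simp [hv] at this
  simp only [hv]
  linarith

lemma exists_lipschitz_gradient (hV : ContDiff ℝ 2 V) (R : ℝ) :
    ∃ C : ℝ, 0 ≤ C ∧ ∀ x y : Euc n, ‖x‖ ≤ R → ‖y‖ ≤ R →
      ‖gradient V x - gradient V y‖ ≤ C * ‖x - y‖ := by
  have hc : Continuous (hess V) := (contDiff_gradient hV).continuous_fderiv (by norm_num)
  obtain ⟨C, hC⟩ := (isCompact_closedBall (0 : Euc n) R).exists_bound_of_continuousOn hc.continuousOn
  refine ⟨|C|, abs_nonneg _, fun x y hx hy => ?_⟩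
  refine Convex.norm_image_sub_le_of_norm_hasFDerivWithin_le (s := Metric.closedBall 0 R)
    (fun z _ => (hasFDerivAt_gradient hV z).hasFDerivWithinAt)
    (fun z hz => (hC z hz).trans (le_abs_self C)) (convex_closedBall _ _) ?_ ?_ <;> simpa

lemma exists_quadratic_bound (hV : ContDiff ℝ 2 V) (h0 : gradient V 0 = 0) (hV0 : V 0 = 0)
    (R : ℝ) : ∃ C : ℝ, 0 ≤ C ∧ (∀ x y : Euc n, ‖x‖ ≤ R → ‖y‖ ≤ R →
      ‖gradient V x - gradient V y‖ ≤ C * ‖x - y‖) ∧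
      (∀ x : Euc n, ‖x‖ ≤ R → ‖gradient V x‖ ≤ C * ‖x‖) ∧
      ∀ x : Euc n, ‖x‖ ≤ R → |V x| ≤ C * ‖x‖ ^ 2 := by
  obtain ⟨C, hC0, hC⟩ := exists_lipschitz_gradient hV R
  have h1 : ∀ x : Euc n, ‖x‖ ≤ R → ‖gradient V x‖ ≤ C * ‖x‖ := fun x hx => by
    simpa [h0] using hC x 0 hx (by simpa using (norm_nonneg x).trans hx)
  refine ⟨C, hC0, hC, h1, fun x hx => ?_⟩
  have := Convex.norm_image_sub_le_of_norm_hasFDerivWithin_le (s := Metric.closedBall 0 ‖x‖)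
    (C := C * ‖x‖)
    (fun z _ => (hasGradientAt_of_contDiff hV z).hasFDerivAt.hasFDerivWithinAt)
    (fun z hz => by
      rw [mem_closedBall_zero_iff] at hz
      rw [LinearIsometryEquiv.norm_map]
      exact (h1 z (hz.trans hx)).trans (mul_le_mul_of_nonneg_left hz hC0))
    (convex_closedBall _ _) (x := 0) (y := x) (by simp) (by simp)
  simpa [hV0, sq, mul_assoc] using this

lemma bddBelow_of_coercive (hV : ContDiff ℝ 2 V) (hc : HCoerc V) : ∃ C : ℝ, ∀ x, C ≤ V x := by
  obtain ⟨ε, hε, R, h⟩ := hc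
  obtain ⟨C, hC⟩ := (isCompact_closedBall (0 : Euc n) (|R| + 1)).exists_bound_of_continuousOn
    hV.continuous.continuousOn
  refine ⟨-C, fun x => ?_⟩
  have hle : ∀ y : Euc n, ‖y‖ ≤ |R| + 1 → -C ≤ V y := fun y hy =>
    (abs_le.1 (hC y (by simpa using hy))).1
  by_cases hx : ‖x‖ ≤ |R| + 1
  · exact hle x hx
  push Not at hx
  have hR1 : 0 < |R| + 1 := by positivity
  have hx0 : 0 < ‖x‖ := hR1.trans hx
  set a := (|R| + 1) / ‖x‖ with ha
  have ha0 : 0 < a := by positivity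
  have ha1 : a ≤ 1 := (div_le_one hx0).2 hx.le
  have hd : ∀ s : ℝ, HasDerivAt (fun s : ℝ => V (s • x)) ⟪gradient V (s • x), x⟫ s := fun s => by
    have : HasDerivAt (fun s : ℝ => s • x) x s := by
      simpa using (hasDerivAt_id s).smul_const x
    exact hasDerivAt_comp_potential hV this
  have := monotoneOn_of_deriv_nonneg (convex_Icc a 1)
    (f := fun s : ℝ => V (s • x))
    (fun s _ => (hd s).continuousAt.continuousWithinAt)
    (fun s _ => (hd s).differentiableAt.differentiableWithinAt)
    (fun s hs => by
      rw [interior_Icc] at hs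
      have hs0 : 0 < s := ha0.trans hs.1
      rw [(hd s).deriv]
      have h1 : R ≤ ‖s • x‖ := by
        rw [norm_smul, Real.norm_of_nonneg hs0.le]
        have : a * ‖x‖ = |R| + 1 := by rw [ha]; field_simp
        nlinarith [le_abs_self R, hs.1]
      have h2 := h _ h1
      rw [real_inner_smul_left, real_inner_comm] at h2
      exact nonneg_of_mul_nonneg_right ((by positivity : 0 ≤ ε * ‖s • x‖ ^ 2).trans h2) hs0)
    (left_mem_Icc.2 ha1) (right_mem_Icc.2 ha1) ha1
  simp only [one_smul] at this
  refine (hle _ ?_).trans this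
  rw [norm_smul, Real.norm_of_nonneg ha0.le, ha]
  field_simp
  exact le_rfl

lemma qHull_mul_le (hV : ContDiff ℝ 2 V) (hc : HCoerc V) (D : EscData n V)
    (h0 : (0 : Euc n) ∈ MinSet V) (hV0 : V 0 = 0) (x : Euc n) : qHull V * ‖x‖ ^ 2 ≤ V x := by
  rcases eq_or_ne x 0 with rfl | hx
  · simp [hV0]
  have hx' : 0 < ‖x‖ ^ 2 := by positivity
  rw [← le_div_iff₀ hx']
  obtain ⟨A, hA⟩ := bddBelow_of_coercive hV hc
  obtain ⟨ε, hε, R, h⟩ := hc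
  obtain ⟨B, hB⟩ := (isCompact_closedBall (0 : Euc n) |R|).exists_bound_of_continuousOn
    hV.continuous.continuousOn
  refine csInf_le ⟨-((|A| + |B|) / D.dEsc ^ 2), ?_⟩ ⟨0, h0, x, hx, by simp [hV0]⟩
  rintro q ⟨m, hm, y, hy, rfl⟩
  have hmR : ‖m‖ ≤ |R| := by
    by_contra hcon
    push Not at hcon
    have h1 := h m ((le_abs_self R).trans hcon.le)
    rw [hm.1, inner_zero_right] at h1
    have : 0 < ‖m‖ := (abs_nonneg R).trans_lt hcon
    have : 0 < ε * ‖m‖ ^ 2 := by positivity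
    linarith
  have hVm : V m ≤ |B| := ((le_abs_self _).trans (hB m (by simpa using hmR))).trans (le_abs_self B)
  have hpos : 0 < ‖y - m‖ := norm_pos_iff.2 (sub_ne_zero.2 hy)
  have hdE := D.dEsc_pos
  have hl := D.lmin_pos
  rcases le_total ‖y - m‖ D.dEsc with h1 | h1
  · have h2 := potential_sub_ge hV hm.1 (D.esc_lower m hm) h1
    have h3 : 0 ≤ (V y - V m) / ‖y - m‖ ^ 2 := by
      apply div_nonneg _ (by positivity)
      exact le_trans (by positivity) h2
    have : 0 ≤ (|A| + |B|) / D.dEsc ^ 2 := by positivity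
    linarith
  · rw [le_div_iff₀ (by positivity)]
    have h2 : |A| + |B| ≤ (|A| + |B|) / D.dEsc ^ 2 * ‖y - m‖ ^ 2 := by
      rw [div_mul_eq_mul_div, le_div_iff₀ (by positivity)]
      gcongr
    have := hA y
    have := neg_abs_le A
    linarith

lemma wV_pos : 0 < wV V := by unfold wV; positivity

lemma wV_mul_ge (hV : ContDiff ℝ 2 V) (hc : HCoerc V) (D : EscData n V)
    (h0 : (0 : Euc n) ∈ MinSet V) (hV0 : V 0 = 0) (x : Euc n) :
    -(‖x‖ ^ 2 / 4) ≤ wV V * V x := by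
  have h1 := qHull_mul_le hV hc D h0 hV0 x
  have h2 := mul_le_mul_of_nonneg_left h1 (wV_pos (V := V)).le
  refine le_trans ?_ h2
  have h3 : -(4 * qHull V) * wV V ≤ 1 := by
    unfold wV
    rw [mul_one_div, div_le_one (by positivity)]
    exact le_max_right _ _
  nlinarith [sq_nonneg ‖x‖]

lemma firewall_integrand_ge (hV : ContDiff ℝ 2 V) (hc : HCoerc V) (D : EscData n V)
    (h0 : (0 : Euc n) ∈ MinSet V) (hV0 : V 0 = 0) (x p : Euc n) :
    min (wV V / 2) (1 / 4) * (‖p‖ ^ 2 + ‖x‖ ^ 2) ≤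
      wV V * (‖p‖ ^ 2 / 2 + V x) + ‖x‖ ^ 2 / 2 := by
  have h1 := wV_mul_ge hV hc D h0 hV0 x
  have h2 := mul_le_mul_of_nonneg_right (min_le_left (wV V / 2) (1 / 4)) (sq_nonneg ‖p‖)
  have h3 := mul_le_mul_of_nonneg_right (min_le_right (wV V / 2) (1 / 4)) (sq_nonneg ‖x‖)
  linarith

end Potential

section Calculus

variable {E : Type*} [NormedAddCommGroup E] [NormedSpace ℝ E]

lemma norm_sub_sub_smul_le {g g' : ℝ → E} {a b C : ℝ} {v : E} (hab : a ≤ b)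
    (hg : ∀ x ∈ Icc a b, HasDerivAt g (g' x) x) (hC : ∀ x ∈ Icc a b, ‖g' x - v‖ ≤ C) :
    ‖g b - g a - (b - a) • v‖ ≤ C * (b - a) := by
  have := Convex.norm_image_sub_le_of_norm_hasDerivWithin_le (s := Icc a b)
    (f := fun x => g x - x • v) (f' := fun x => g' x - v) (C := C)
    (fun x hx => ((hg x hx).sub
      (by simpa using (hasDerivAt_id x).smul_const v)).hasDerivWithinAt)
    hC (convex_Icc a b) (left_mem_Icc.2 hab) (right_mem_Icc.2 hab)
  rw [Real.norm_of_nonneg (sub_nonneg.2 hab)] at this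
  convert this using 2
  rw [sub_smul]
  abel

lemma norm_sub_le_of_deriv_le {g g' : ℝ → E} {a b C : ℝ} (hab : a ≤ b)
    (hg : ∀ x ∈ Icc a b, HasDerivAt g (g' x) x) (hC : ∀ x ∈ Icc a b, ‖g' x‖ ≤ C) :
    ‖g b - g a‖ ≤ C * (b - a) := by
  simpa using norm_sub_sub_smul_le (v := 0) hab hg (by simpa using hC)

/-- Barbalat's lemma, with a Lipschitz derivative. -/
lemma tendsto_deriv_zero {g g' : ℝ → E} {l : E} {K : ℝ} (hK : 0 ≤ K)
    (hg : ∀ x, HasDerivAt g (g' x) x) (hlip : ∀ x y, ‖g' x - g' y‖ ≤ K * |x - y|)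
    (hl : Tendsto g atTop (𝓝 l)) : Tendsto g' atTop (𝓝 0) := by
  rw [Metric.tendsto_atTop]
  intro ε hε
  set h := ε / (2 * (K + 1)) with hh
  have hh0 : 0 < h := by positivity
  have hd : Tendsto (fun y => g (y + h) - g y) atTop (𝓝 0) := by
    simpa using (hl.comp (tendsto_atTop_add_const_right _ h tendsto_id)).sub hl
  obtain ⟨N, hN⟩ := Metric.tendsto_atTop.1 hd (ε * h / 2) (by positivity)
  refine ⟨N, fun y hy => ?_⟩
  have h1 := hN y hy
  rw [dist_zero_right] at h1 ⊢
  have h2 := norm_sub_sub_smul_le (g := g) (g' := g') (v := g' y) (C := K * h)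
    (by linarith : y ≤ y + h) (fun x _ => hg x) (fun x hx => (hlip x y).trans (by
      gcongr
      rw [abs_of_nonneg (by linarith [hx.1])]
      linarith [hx.2]))
  rw [add_sub_cancel_left] at h2
  have h3 : h * ‖g' y‖ ≤ ‖g (y + h) - g y‖ + K * h * h := by
    calc h * ‖g' y‖ = ‖h • g' y‖ := by rw [norm_smul, Real.norm_of_nonneg hh0.le]
      _ = ‖(g (y + h) - g y) - (g (y + h) - g y - h • g' y)‖ := by congr 1; abel
      _ ≤ _ := (norm_sub_le _ _).trans (by gcongr)
  have h4 : K * h < ε / 2 := by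
    rw [hh]
    have : K * (ε / (2 * (K + 1))) = ε / 2 * (K / (K + 1)) := by field_simp
    rw [this]
    have h5 : K / (K + 1) < 1 := by rw [div_lt_one (by linarith)]; linarith
    exact mul_lt_of_lt_one_right (by positivity) h5
  nlinarith

end Calculus

/-- A bounded continuous curve along which a map with isolated zeros tends to zero converges. -/
lemma exists_tendsto_of_isolated_zeros {E F : Type*} [NormedAddCommGroup E]
    [ProperSpace E] [NormedAddCommGroup F]
    {f : E → F} (hf : Continuous f) (hiso : ∀ x, f x = 0 → ∀ᶠ y in 𝓝[≠] x, f y ≠ 0)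
    {φ : ℝ → E} (hφ : Continuous φ) {B : ℝ} (hB : ∀ y, ‖φ y‖ ≤ B)
    (h : Tendsto (fun y => f (φ y)) atTop (𝓝 0)) :
    ∃ x, f x = 0 ∧ Tendsto φ atTop (𝓝 x) := by
  obtain ⟨x, -, hx⟩ := (isCompact_closedBall (0 : E) B).exists_mapClusterPt (f := atTop) (u := φ)
    (Filter.tendsto_principal.2 (Eventually.of_forall fun y => by simpa using hB y))
  have hcl : ∀ z, MapClusterPt z atTop φ → f z = 0 := fun z hz => by
    by_contra hne
    obtain ⟨U, W, hU, hW, hxU, hxW, hUW⟩ := t2_separation hne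
    have h1 := (hz.continuousAt_comp hf.continuousAt).frequently (hU.mem_nhds hxU)
    have h2 := h.eventually (hW.mem_nhds hxW)
    obtain ⟨y, hy1, hy2⟩ := (h1.and_eventually h2).exists
    exact Set.disjoint_left.1 hUW hy1 hy2
  have hfx : f x = 0 := hcl x hx
  refine ⟨x, hfx, ?_⟩
  obtain ⟨r, hr, hrz⟩ := Metric.mem_nhds_iff.1 (mem_nhdsWithin_iff_exists_mem_nhds_inter.1
    (hiso x hfx)).choose_spec.1
  have hrz' : ∀ y, dist y x < r → y ≠ x → f y ≠ 0 := fun y hy hne =>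
    (mem_nhdsWithin_iff_exists_mem_nhds_inter.1 (hiso x hfx)).choose_spec.2
      ⟨hrz (by simpa using hy), hne⟩
  rw [Metric.tendsto_nhds]
  intro ε hε
  set e := min (ε / 2) (r / 2) with he
  have he0 : 0 < e := by positivity
  have her : e < r := (min_le_right _ _).trans_lt (by linarith)
  have heε : e < ε := (min_le_left _ _).trans_lt (by linarith)
  have hη : ∀ᶠ y in atTop, dist (φ y) x ≠ e := by
    by_contra hcon
    have hcon' : ∃ᶠ y in atTop, dist (φ y) x = e := by
      simpa [Filter.Frequently] using hcon
    obtain ⟨z, hz, hzc⟩ := (isCompact_sphere x e).exists_mapClusterPt_of_frequently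
      (f := φ) (l := atTop) hcon'
    have hfz : f z = 0 := hcl z hzc
    have hz' : dist z x = e := hz
    exact hrz' z (hz'.trans_lt her) (fun h => by rw [h, dist_self] at hz'; linarith) hfz
  obtain ⟨N, hN⟩ := eventually_atTop.1 hη
  obtain ⟨y₀, hy₀, hy₀'⟩ := ((hx.frequently (Metric.ball_mem_nhds x he0)).and_eventually
    (eventually_ge_atTop N)).exists
  filter_upwards [eventually_ge_atTop y₀] with y hy
  by_contra hcon
  push Not at hcon
  have hcont : ContinuousOn (fun y => dist (φ y) x) (Icc y₀ y) :=
    (hφ.dist continuous_const).continuousOn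
  obtain ⟨z, hz, hze⟩ := intermediate_value_Icc hy hcont
    ⟨(Metric.mem_ball.1 hy₀).le, heε.le.trans hcon⟩
  exact hN z (hy₀'.trans hz.1) hze

section Front

variable {V : Euc n → ℝ}

lemma tendsto_of_bounded_profile (hV : ContDiff ℝ 2 V) {c B : ℝ} (hc : c ≠ 0)
    {φ ψ : ℝ → Euc n} (hφ : ∀ y, HasDerivAt φ (ψ y) y)
    (hψ : ∀ y, HasDerivAt ψ (-(c • ψ y) + gradient V (φ y)) y)
    (hφB : ∀ y, ‖φ y‖ ≤ B) (hψB : ∀ y, ‖ψ y‖ ≤ B) :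
    Tendsto (fun y => gradient V (φ y)) atTop (𝓝 0) := by
  have hB : 0 ≤ B := (norm_nonneg _).trans (hφB 0)
  obtain ⟨C, hC0, hClip⟩ := exists_lipschitz_gradient hV B
  obtain ⟨A, hA⟩ := (isCompact_closedBall (0 : Euc n) B).exists_bound_of_continuousOn
    hV.continuous.continuousOn
  obtain ⟨A', hA'⟩ := (isCompact_closedBall (0 : Euc n) B).exists_bound_of_continuousOn
    (contDiff_gradient hV).continuous.continuousOn
  have lip : ∀ {g g' : ℝ → Euc n} {M : ℝ}, (∀ y, HasDerivAt g (g' y) y) → (∀ y, ‖g' y‖ ≤ M) →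
      ∀ x y, ‖g x - g y‖ ≤ M * |x - y| := fun {g g' M} h h' x y => by
    have := Convex.norm_image_sub_le_of_norm_hasDerivWithin_le (s := univ) (f := g)
      (fun x _ => (h x).hasDerivWithinAt) (fun x _ => h' x) convex_univ (mem_univ y) (mem_univ x)
    simpa using this
  set M := |c| * B + |A'| with hM
  have hψ'B : ∀ y, ‖-(c • ψ y) + gradient V (φ y)‖ ≤ M := fun y => by
    refine (norm_add_le _ _).trans ?_
    rw [norm_neg, norm_smul, Real.norm_eq_abs]
    exact add_le_add (mul_le_mul_of_nonneg_left (hψB y) (abs_nonneg c))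
      ((hA' _ (by simpa using hφB y)).trans (le_abs_self _))
  have hM0 : 0 ≤ M := by positivity
  have hφl := lip hφ hψB
  have hψl := lip hψ hψ'B
  have hψ'l : ∀ x y, ‖(-(c • ψ x) + gradient V (φ x)) - (-(c • ψ y) + gradient V (φ y))‖ ≤
      (|c| * M + C * B) * |x - y| := fun x y => by
    have e : (-(c • ψ x) + gradient V (φ x)) - (-(c • ψ y) + gradient V (φ y)) =
        -(c • (ψ x - ψ y)) + (gradient V (φ x) - gradient V (φ y)) := by
      rw [smul_sub]; abel
    rw [e]
    refine (norm_add_le _ _).trans ?_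
    rw [norm_neg, norm_smul, Real.norm_eq_abs]
    have h1 := mul_le_mul_of_nonneg_left (hψl x y) (abs_nonneg c)
    have h2 := (hClip _ _ (hφB x) (hφB y)).trans (mul_le_mul_of_nonneg_left (hφl x y) hC0)
    linarith
  have hH : ∀ y, HasDerivAt (fun y => -c⁻¹ * (‖ψ y‖ ^ 2 / 2 - V (φ y))) (‖ψ y‖ ^ 2) y := fun y => by
    have h1 := (hψ y).norm_sq.div_const 2
    have h2 := hasDerivAt_comp_potential hV (hφ y)
    refine ((h1.sub h2).const_mul (-c⁻¹)).congr_deriv ?_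
    rw [inner_add_right, inner_neg_right, real_inner_smul_right, real_inner_self_eq_norm_sq,
      real_inner_comm]
    field_simp
    ring
  have hmono : Monotone (fun y => -c⁻¹ * (‖ψ y‖ ^ 2 / 2 - V (φ y))) :=
    monotone_of_deriv_nonneg (fun y => (hH y).differentiableAt)
      (fun y => by rw [(hH y).deriv]; positivity)
  have hbdd : BddAbove (range (fun y => -c⁻¹ * (‖ψ y‖ ^ 2 / 2 - V (φ y)))) := by
    refine ⟨|c⁻¹| * (B ^ 2 / 2 + A), ?_⟩
    rintro _ ⟨y, rfl⟩
    refine (le_abs_self _).trans ?_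
    simp only [abs_mul, abs_neg]
    refine mul_le_mul_of_nonneg_left ?_ (abs_nonneg _)
    refine (abs_sub _ _).trans (add_le_add ?_ (hA _ (by simpa using hφB y)))
    rw [abs_of_nonneg (by positivity)]
    have := pow_le_pow_left₀ (norm_nonneg _) (hψB y) 2
    linarith
  have hlim := tendsto_atTop_ciSup hmono hbdd
  have hsq : Tendsto (fun y => ‖ψ y‖ ^ 2) atTop (𝓝 0) := by
    refine tendsto_deriv_zero (K := 2 * B * M) (by positivity) hH (fun x y => ?_) hlim
    rw [Real.norm_eq_abs, sq_sub_sq, abs_mul]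
    have h1 := (abs_norm_sub_norm_le (ψ x) (ψ y)).trans (hψl x y)
    have h2 : |‖ψ x‖ + ‖ψ y‖| ≤ 2 * B := by
      rw [abs_of_nonneg (by positivity)]; linarith [hψB x, hψB y]
    calc _ ≤ 2 * B * (M * |x - y|) := mul_le_mul h2 h1 (abs_nonneg _) (by positivity)
      _ = _ := by ring
  have hψ0 : Tendsto ψ atTop (𝓝 0) := by
    rw [tendsto_zero_iff_norm_tendsto_zero]
    simpa [Real.sqrt_sq] using hsq.sqrt
  have hψ'0 := tendsto_deriv_zero (by positivity) hψ hψ'l hψ0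
  have := hψ'0.add (hψ0.const_smul c)
  simpa using this

lemma eventually_gradient_ne_zero (hV : ContDiff ℝ 2 V) (hnd : HNonDeg V) (x : Euc n)
    (hx : gradient V x = 0) : ∀ᶠ y in 𝓝[≠] x, gradient V y ≠ 0 := by
  refine (hasFDerivAt_gradient hV x).eventually_ne ?_
  obtain ⟨K, -, hK⟩ := LinearMap.exists_antilipschitzWith (hess V x).toLinearMap
    (LinearMap.ker_eq_bot'.2 fun v hv => hnd x hx v hv)
  exact ⟨K, hK⟩

/-- A bounded profile that stays close to the origin on the right is a front. -/
lemma phiInv_nonempty_of_bounded_profile (hV : ContDiff ℝ 2 V) (D : EscData n V)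
    (hnd : HNonDeg V) (hbist : HOnlyBist V) (h0 : (0 : Euc n) ∈ MinSet V) {c B : ℝ} (hc : 0 < c)
    {φ ψ : ℝ → Euc n} (hφ : ∀ y, HasDerivAt φ (ψ y) y)
    (hψ : ∀ y, HasDerivAt ψ (-(c • ψ y) + gradient V (φ y)) y)
    (hφB : ∀ y, ‖φ y‖ ≤ B) (hψB : ∀ y, ‖ψ y‖ ≤ B)
    (hesc : ∀ y > 0, ‖φ y‖ ≤ D.dEsc) {y₀ : ℝ} (hy₀ : φ y₀ ≠ 0) :
    (PhiInv V c 0).Nonempty := by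
  have hl := D.lmin_pos
  have hcont : Continuous φ := continuous_iff_continuousAt.2 fun y => (hφ y).continuousAt
  have hgr := tendsto_of_bounded_profile hV hc.ne' hφ hψ hφB hψB
  have htop : Tendsto φ atTop (𝓝 0) := by
    rw [tendsto_zero_iff_norm_tendsto_zero]
    have h1 : Tendsto (fun y => 2 / D.lmin * ‖gradient V (φ y)‖) atTop (𝓝 0) := by
      simpa using hgr.norm.const_mul (2 / D.lmin)
    refine squeeze_zero' (Eventually.of_forall fun _ => norm_nonneg _) ?_ h1
    filter_upwards [eventually_gt_atTop 0] with y hy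
    have h2 := inner_gradient_ge hV h0.1 (D.esc_lower 0 h0) (x := φ y) (by simpa using hesc y hy)
    rw [sub_zero] at h2
    have h3 := h2.trans (real_inner_le_norm _ _)
    rcases eq_or_lt_of_le (norm_nonneg (φ y)) with h | h
    · rw [← h]; positivity
    · have h4 : D.lmin / 2 * ‖φ y‖ ≤ ‖gradient V (φ y)‖ := by nlinarith
      rw [div_mul_eq_mul_div, le_div_iff₀ hl]
      linarith
  have hgr' : Tendsto (fun y => gradient V (φ (-y))) atTop (𝓝 0) := by
    refine tendsto_of_bounded_profile (c := -c) (ψ := fun y => -ψ (-y)) (B := B) hV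
      (neg_ne_zero.2 hc.ne') (fun y => ?_) (fun y => ?_) (fun y => hφB _) (fun y => by simpa using hψB _)
    · exact ((hφ (-y)).scomp y (hasDerivAt_neg y)).congr_deriv (by simp)
    · have := ((hψ (-y)).scomp y (hasDerivAt_neg y)).neg
      refine this.congr_deriv ?_
      simp [add_comm]
  obtain ⟨um, hum, hlim⟩ := exists_tendsto_of_isolated_zeros
    (contDiff_gradient hV).continuous (eventually_gradient_ne_zero hV hnd)
    (hcont.comp continuous_neg) (fun y => hφB _) hgr'
  have hbot : Tendsto φ atBot (𝓝 um) := by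
    have := hlim.comp tendsto_neg_atBot_atTop
    simpa [Function.comp_def] using this
  have hd : deriv φ = ψ := funext fun y => (hφ y).deriv
  have hmem : φ ∈ Phi V c um 0 := by
    refine ⟨?_, fun ξ => (hφ ξ).differentiableAt, fun ξ => ?_, fun ξ => ?_, hbot, htop⟩
    · by_contra hcon
      push Not at hcon
      have : φ = fun _ => φ y₀ := funext fun ξ => hcon ξ y₀
      rw [this] at htop
      exact hy₀ (tendsto_nhds_unique tendsto_const_nhds htop)
    · rw [hd]; exact (hψ ξ).differentiableAt
    · rw [hd, (hψ ξ).deriv]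
  exact ⟨φ, mem_iUnion₂.2 ⟨um, hbist 0 h0 um hum c hc ⟨φ, hmem⟩, hmem⟩⟩

end Front

section Regularity

variable {d : ℕ} {V : Euc n → ℝ} {u : ℝ → ℝ → Euc n} {C : ℝ}

/-- The curvature term `((d-1)/r) u_r`. -/
def curv (d : ℕ) (u : ℝ → ℝ → Euc n) (r t : ℝ) : Euc n := (((d : ℝ) - 1) / r) • ur u r t

/-- The bound on a radial solution and its derivatives. -/
def SolBound (u : ℝ → ℝ → Euc n) (C : ℝ) : Prop :=
  ∀ r t : ℝ, 0 ≤ r → 0 < t → ‖u r t‖ + ‖ur u r t‖ + ‖urr u r t‖ + ‖ut u r t‖ ≤ C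

namespace SolBound

variable {r t : ℝ}

lemma nonneg (hC : SolBound u C) : 0 ≤ C :=
  le_trans (by positivity) (hC 0 1 le_rfl one_pos)

lemma norm_u (hC : SolBound u C) (hr : 0 ≤ r) (ht : 0 < t) : ‖u r t‖ ≤ C := by
  have := hC r t hr ht
  linarith [norm_nonneg (u r t), norm_nonneg (ur u r t), norm_nonneg (urr u r t),
    norm_nonneg (ut u r t)]

lemma norm_ur (hC : SolBound u C) (hr : 0 ≤ r) (ht : 0 < t) : ‖ur u r t‖ ≤ C := by
  have := hC r t hr ht
  linarith [norm_nonneg (u r t), norm_nonneg (ur u r t), norm_nonneg (urr u r t),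
    norm_nonneg (ut u r t)]

lemma norm_urr (hC : SolBound u C) (hr : 0 ≤ r) (ht : 0 < t) : ‖urr u r t‖ ≤ C := by
  have := hC r t hr ht
  linarith [norm_nonneg (u r t), norm_nonneg (ur u r t), norm_nonneg (urr u r t),
    norm_nonneg (ut u r t)]

lemma norm_ut (hC : SolBound u C) (hr : 0 ≤ r) (ht : 0 < t) : ‖ut u r t‖ ≤ C := by
  have := hC r t hr ht
  linarith [norm_nonneg (u r t), norm_nonneg (ur u r t), norm_nonneg (urr u r t),
    norm_nonneg (ut u r t)]

end SolBound

namespace IsRadialSolution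

variable {r t : ℝ}

lemma hasDerivAt_r (hu : IsRadialSolution d V u) (ht : 0 < t) (r : ℝ) :
    HasDerivAt (fun s => u s t) (ur u r t) r := (hu.diff_r t ht r).hasDerivAt

lemma hasDerivAt_rr (hu : IsRadialSolution d V u) (ht : 0 < t) (r : ℝ) :
    HasDerivAt (fun s => ur u s t) (urr u r t) r := (hu.diff_rr t ht r).hasDerivAt

lemma hasDerivAt_t (hu : IsRadialSolution d V u) (ht : 0 < t) (r : ℝ) :
    HasDerivAt (fun s => u r s) (ut u r t) t := (hu.diff_t t ht r).hasDerivAt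

lemma continuous_u (hu : IsRadialSolution d V u) (ht : 0 < t) : Continuous fun r => u r t :=
  continuous_iff_continuousAt.2 fun r => (hu.hasDerivAt_r ht r).continuousAt

lemma continuous_ur (hu : IsRadialSolution d V u) (ht : 0 < t) : Continuous fun r => ur u r t :=
  continuous_iff_continuousAt.2 fun r => (hu.hasDerivAt_rr ht r).continuousAt

lemma norm_u_sub_le (hu : IsRadialSolution d V u) (hC : SolBound u C) (hr : 0 ≤ r) {t t' : ℝ}
    (ht : 0 < t) (htt : t ≤ t') : ‖u r t' - u r t‖ ≤ C * (t' - t) :=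
  norm_sub_le_of_deriv_le htt (fun _ hx => hu.hasDerivAt_t (ht.trans_le hx.1) r)
    (fun _ hx => hC.norm_ut hr (ht.trans_le hx.1))

lemma norm_u_sub_le_abs (hu : IsRadialSolution d V u) (hC : SolBound u C) (hr : 0 ≤ r) {t t' : ℝ}
    (ht : 0 < t) (ht' : 0 < t') : ‖u r t' - u r t‖ ≤ C * |t' - t| := by
  rcases le_total t t' with h | h
  · rw [abs_of_nonneg (sub_nonneg.2 h)]; exact hu.norm_u_sub_le hC hr ht h
  · rw [abs_sub_comm, abs_of_nonneg (sub_nonneg.2 h), norm_sub_rev]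
    exact hu.norm_u_sub_le hC hr ht' h

lemma norm_u_sub_le_r (hu : IsRadialSolution d V u) (hC : SolBound u C) (ht : 0 < t) {r r' : ℝ}
    (hr : 0 ≤ r) (hrr : r ≤ r') : ‖u r' t - u r t‖ ≤ C * (r' - r) :=
  norm_sub_le_of_deriv_le hrr (fun x _ => hu.hasDerivAt_r ht x)
    (fun _ hx => hC.norm_ur (hr.trans hx.1) ht)

lemma norm_ur_sub_le_r (hu : IsRadialSolution d V u) (hC : SolBound u C) (ht : 0 < t) {r r' : ℝ}
    (hr : 0 ≤ r) (hrr : r ≤ r') : ‖ur u r' t - ur u r t‖ ≤ C * (r' - r) :=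
  norm_sub_le_of_deriv_le hrr (fun x _ => hu.hasDerivAt_rr ht x)
    (fun _ hx => hC.norm_urr (hr.trans hx.1) ht)

lemma norm_taylor_le (hu : IsRadialSolution d V u) (hC : SolBound u C) (ht : 0 < t) {r r' : ℝ}
    (hr : 0 ≤ r) (hrr : r ≤ r') :
    ‖u r' t - u r t - (r' - r) • ur u r t‖ ≤ C * (r' - r) ^ 2 := by
  have hC0 := hC.nonneg
  rw [sq, ← mul_assoc]
  refine norm_sub_sub_smul_le hrr (fun x _ => hu.hasDerivAt_r ht x) (fun x hx => ?_)
  exact (hu.norm_ur_sub_le_r hC ht hr hx.1).trans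
    (mul_le_mul_of_nonneg_left (by linarith [hx.2]) hC0)

lemma norm_ur_le (hu : IsRadialSolution d V u) (hC : SolBound u C) (ht : 0 < t) (hr : 0 ≤ r) :
    ‖ur u r t‖ ≤ C * r := by
  simpa [hu.neumann t ht] using hu.norm_ur_sub_le_r hC ht le_rfl hr

lemma norm_ur_time_sub_le (hu : IsRadialSolution d V u) (hC : SolBound u C) (hr : 0 ≤ r)
    {t t' h : ℝ} (ht : 0 < t) (ht' : 0 < t') (hh : 0 < h) :
    ‖ur u r t' - ur u r t‖ ≤ 2 * C * |t' - t| / h + 2 * C * h := by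
  have h1 := hu.norm_taylor_le hC ht hr (by linarith : r ≤ r + h)
  have h2 := hu.norm_taylor_le hC ht' hr (by linarith : r ≤ r + h)
  have h3 := hu.norm_u_sub_le_abs hC hr ht ht'
  have h4 := hu.norm_u_sub_le_abs hC (by linarith : 0 ≤ r + h) ht ht'
  rw [add_sub_cancel_left] at h1 h2
  have e : h • (ur u r t' - ur u r t) = (u (r + h) t' - u (r + h) t) - (u r t' - u r t)
      - (u (r + h) t' - u r t' - h • ur u r t') + (u (r + h) t - u r t - h • ur u r t) := by
    rw [smul_sub]; abel
  have h5 : h * ‖ur u r t' - ur u r t‖ ≤ 2 * C * |t' - t| + 2 * C * h ^ 2 := by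
    have : h * ‖ur u r t' - ur u r t‖ = ‖h • (ur u r t' - ur u r t)‖ := by
      rw [norm_smul, Real.norm_of_nonneg hh.le]
    rw [this, e]
    refine (norm_add_le _ _).trans ?_
    have h6 := norm_sub_le ((u (r + h) t' - u (r + h) t) - (u r t' - u r t))
      (u (r + h) t' - u r t' - h • ur u r t')
    have h7 := norm_sub_le (u (r + h) t' - u (r + h) t) (u r t' - u r t)
    linarith
  rw [← mul_le_mul_iff_right₀ hh]
  refine h5.trans (le_of_eq ?_)
  field_simp

lemma continuousAt_ur_time (hu : IsRadialSolution d V u) (hC : SolBound u C) (hr : 0 ≤ r)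
    (ht : 0 < t) : ContinuousAt (fun s => ur u r s) t := by
  have hC0 := hC.nonneg
  rw [Metric.continuousAt_iff]
  intro ε hε
  set h := ε / (4 * (C + 1)) with hh
  have hh0 : 0 < h := by positivity
  have h1 : 2 * C * h < ε / 2 := by
    have : 2 * (C + 1) * h = ε / 2 := by rw [hh]; field_simp; ring
    nlinarith
  refine ⟨min t (ε * h / (4 * (C + 1))), by positivity, fun {s} hs => ?_⟩
  rw [Real.dist_eq] at hs
  have hs1 := hs.trans_le (min_le_left _ _)
  have hs2 := hs.trans_le (min_le_right _ _)
  have hs0 : 0 < s := by linarith [(abs_lt.1 hs1).1]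
  rw [dist_eq_norm]
  refine (hu.norm_ur_time_sub_le hC hr ht hs0 hh0).trans_lt ?_
  have h2 : 2 * C * |s - t| / h ≤ ε / 2 := by
    rw [div_le_iff₀ hh0]
    have : (2 * (C + 1)) * (ε * h / (4 * (C + 1))) = ε / 2 * h := by field_simp; ring
    nlinarith [abs_nonneg (s - t)]
  linarith

lemma ut_eq (hu : IsRadialSolution d V u) (hr : 0 < r) (ht : 0 < t) :
    ut u r t = -gradient V (u r t) + curv d u r t + urr u r t := hu.pde r hr t ht

lemma continuousAt_curv_time (hu : IsRadialSolution d V u) (hC : SolBound u C) (hr : 0 ≤ r)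
    (ht : 0 < t) : ContinuousAt (fun s => curv d u r s) t := by
  unfold curv
  exact (hu.continuousAt_ur_time hC hr ht).const_smul (((d : ℝ) - 1) / r)

lemma continuousAt_ut_time (hu : IsRadialSolution d V u) (r : ℝ)
    (ht : 0 < t) : ContinuousAt (fun s => ut u r s) t :=
  (hu.cont_t r).continuousAt (Ioi_mem_nhds ht)

lemma continuousAt_urr_time (hV : ContDiff ℝ 2 V) (hu : IsRadialSolution d V u)
    (hC : SolBound u C) (hr : 0 < r) (ht : 0 < t) : ContinuousAt (fun s => urr u r s) t := by
  have h : ContinuousAt (fun s => ut u r s + gradient V (u r s) - curv d u r s) t :=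
    ((hu.continuousAt_ut_time r ht).add
      (ContinuousAt.comp (g := gradient V) (contDiff_gradient hV).continuous.continuousAt
        (hu.hasDerivAt_t ht r).continuousAt)).sub (hu.continuousAt_curv_time hC hr.le ht)
  refine h.congr ?_
  filter_upwards [Ioi_mem_nhds ht] with s hs
  rw [hu.ut_eq hr hs]
  abel

lemma continuousOn_curv (hu : IsRadialSolution d V u) (ht : 0 < t) :
    ContinuousOn (fun r => curv d u r t) (Ioi 0) :=
  (continuousOn_const.div continuousOn_id (fun _ hx => (mem_Ioi.1 hx).ne')).smul
    (hu.continuous_ur ht).continuousOn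

lemma continuousOn_ut (hV : ContDiff ℝ 2 V) (hu : IsRadialSolution d V u) (ht : 0 < t) :
    ContinuousOn (fun r => ut u r t) (Ioi 0) := by
  have h : ContinuousOn (fun r => -gradient V (u r t) + curv d u r t + urr u r t) (Ioi 0) :=
    (((contDiff_gradient hV).continuous.comp (hu.continuous_u ht)).neg.continuousOn.add
      (hu.continuousOn_curv ht)).add (hu.cont_rr t ht).continuousOn
  exact h.congr fun r hr => hu.ut_eq hr ht

lemma norm_curv_le (hd : 1 ≤ d) (hu : IsRadialSolution d V u) (hC : SolBound u C) (ht : 0 < t)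
    (hr : 0 < r) : ‖curv d u r t‖ ≤ d * C := by
  have hC0 := hC.nonneg
  have hd' : (1 : ℝ) ≤ d := by exact_mod_cast hd
  rw [curv, norm_smul, Real.norm_of_nonneg (div_nonneg (by linarith) hr.le), div_mul_eq_mul_div,
    div_le_iff₀ hr]
  have h1 := hu.norm_ur_le hC ht hr.le
  have : 0 ≤ C * r := by positivity
  nlinarith [norm_nonneg (ur u r t)]

lemma _root_.SolBound.norm_curv_le_div (hd : 1 ≤ d) (hC : SolBound u C) (ht : 0 < t)
    (hr : 0 < r) : ‖curv d u r t‖ ≤ d * C / r := by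
  have hC0 := hC.nonneg
  have hd' : (1 : ℝ) ≤ d := by exact_mod_cast hd
  rw [curv, norm_smul, Real.norm_of_nonneg (div_nonneg (by linarith) hr.le), div_mul_eq_mul_div]
  have h1 := hC.norm_ur hr.le ht
  gcongr
  linarith

end IsRadialSolution

end Regularity

section ExpTails

variable {κ ρ : ℝ}

lemma integrableOn_exp_abs_Iic (hκ : 0 < κ) (ρ a : ℝ) (ha : a ≤ ρ) :
    IntegrableOn (fun r => Real.exp (-κ * |r - ρ|)) (Iic a) ∧
      ∫ r in Iic a, Real.exp (-κ * |r - ρ|) = Real.exp (-κ * (ρ - a)) / κ := by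
  have e : EqOn (fun r => Real.exp (-κ * |r - ρ|))
      (fun r => Real.exp (-κ * ρ) * Real.exp (κ * r)) (Iic a) := fun r hr => by
    have hr' : r ≤ ρ := (mem_Iic.1 hr).trans ha
    simp only [abs_of_nonpos (sub_nonpos.2 hr'), ← Real.exp_add]
    ring_nf
  constructor
  · exact IntegrableOn.congr_fun ((integrableOn_exp_mul_Iic hκ a).const_mul _)
      (fun r hr => (e hr).symm) measurableSet_Iic
  · rw [setIntegral_congr_fun measurableSet_Iic e, integral_const_mul, integral_exp_mul_Iic hκ,
      ← mul_div_assoc, ← Real.exp_add]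
    ring_nf

lemma integrableOn_exp_abs_Ioi (hκ : 0 < κ) (ρ a : ℝ) (ha : ρ ≤ a) :
    IntegrableOn (fun r => Real.exp (-κ * |r - ρ|)) (Ioi a) ∧
      ∫ r in Ioi a, Real.exp (-κ * |r - ρ|) = Real.exp (-κ * (a - ρ)) / κ := by
  have hκ' : -κ < 0 := by linarith
  have e : EqOn (fun r => Real.exp (-κ * |r - ρ|))
      (fun r => Real.exp (κ * ρ) * Real.exp (-κ * r)) (Ioi a) := fun r hr => by
    have hr' : ρ ≤ r := ha.trans (mem_Ioi.1 hr).le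
    simp only [abs_of_nonneg (sub_nonneg.2 hr'), ← Real.exp_add]
    ring_nf
  constructor
  · exact IntegrableOn.congr_fun ((integrableOn_exp_mul_Ioi hκ' a).const_mul _)
      (fun r hr => (e hr).symm) measurableSet_Ioi
  · rw [setIntegral_congr_fun measurableSet_Ioi e, integral_const_mul, integral_exp_mul_Ioi hκ',
      neg_div_neg_eq, ← mul_div_assoc, ← Real.exp_add]
    ring_nf

lemma integrable_exp_abs (hκ : 0 < κ) (ρ : ℝ) :
    Integrable (fun r => Real.exp (-κ * |r - ρ|)) := by
  rw [← integrableOn_univ, ← Iic_union_Ioi (a := ρ)]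
  exact (integrableOn_exp_abs_Iic hκ ρ ρ le_rfl).1.union (integrableOn_exp_abs_Ioi hκ ρ ρ le_rfl).1

lemma setIntegral_exp_abs_le (hκ : 0 < κ) {ℓ : ℝ} (hℓ : 0 ≤ ℓ) {A : Set ℝ}
    (hA : ∀ r ∈ A, ℓ ≤ |r - ρ|) :
    ∫ r in A, Real.exp (-κ * |r - ρ|) ≤ 2 / κ * Real.exp (-κ * ℓ) := by
  have h1 := integrableOn_exp_abs_Iic hκ ρ (ρ - ℓ) (by linarith)
  have h2 := integrableOn_exp_abs_Ioi hκ ρ (ρ + ℓ) (by linarith)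
  have hi := integrable_exp_abs hκ ρ
  have hnn : ∀ r, 0 ≤ Real.exp (-κ * |r - ρ|) := fun r => (Real.exp_pos _).le
  have hsub : A ⊆ Iic (ρ - ℓ) ∪ Ici (ρ + ℓ) := fun r hr => by
    rcases le_abs.1 (hA r hr) with h | h
    · right; simp only [mem_Ici]; linarith
    · left; simp only [mem_Iic]; linarith
  calc ∫ r in A, Real.exp (-κ * |r - ρ|)
      ≤ ∫ r in Iic (ρ - ℓ) ∪ Ici (ρ + ℓ), Real.exp (-κ * |r - ρ|) :=
        setIntegral_mono_set hi.integrableOn (Eventually.of_forall hnn)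
          (Eventually.of_forall hsub)
    _ ≤ (∫ r in Iic (ρ - ℓ), Real.exp (-κ * |r - ρ|)) +
          ∫ r in Ici (ρ + ℓ), Real.exp (-κ * |r - ρ|) := by
        rw [← integral_indicator measurableSet_Iic, ← integral_indicator measurableSet_Ici,
          ← integral_indicator (measurableSet_Iic.union measurableSet_Ici),
          ← integral_add (hi.indicator measurableSet_Iic) (hi.indicator measurableSet_Ici)]
        refine integral_mono (hi.indicator (measurableSet_Iic.union measurableSet_Ici))
          ((hi.indicator measurableSet_Iic).add (hi.indicator measurableSet_Ici)) fun r => ?_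
        by_cases ha : r ∈ Iic (ρ - ℓ) <;> by_cases hb : r ∈ Ici (ρ + ℓ) <;>
          simp only [indicator, mem_union, ha, hb, if_true, if_false, or_true, true_or, or_self] <;>
          linarith [hnn r]
    _ = _ := by
        rw [integral_Ici_eq_integral_Ioi, h1.2, h2.2]
        ring_nf

end ExpTails

section Firewall

variable {d : ℕ} {V : Euc n → ℝ} {D : EscData n V} {u : ℝ → ℝ → Euc n} {C ν K : ℝ}

/-- The standing assumptions about the solution and the firewall inequality. -/
structure FireSetting (d : ℕ) (V : Euc n → ℝ) (D : EscData n V) (u : ℝ → ℝ → Euc n)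
    (C ν K : ℝ) : Prop where
  two_le : 2 ≤ d
  smooth : ContDiff ℝ 2 V
  coerc : HCoerc V
  zero_mem : (0 : Euc n) ∈ MinSet V
  map_zero : V 0 = 0
  sol : IsRadialSolution d V u
  bound : SolBound u C
  ν_pos : 0 < ν
  K_pos : 0 < K
  fire : FireIneq V d D.lmin D.dEsc u ν K

lemma kappa0_pos (D : EscData n V) : 0 < kappa0 D.lmin := by
  have := D.lmin_pos
  unfold kappa0; positivity

lemma rsc_pos (hd : 2 ≤ d) (l : ℝ) : 0 < rsc d l := by
  have : (2 : ℝ) ≤ d := by exact_mod_cast hd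
  exact lt_max_of_lt_left (by linarith)

lemma Tpsi_nonneg (hd : 2 ≤ d) {l ρ r : ℝ} (hr : 0 ≤ r) : 0 ≤ Tpsi d l ρ r := by
  have := rsc_pos hd l
  unfold Tpsi
  split_ifs <;> positivity

lemma Tpsi_le (hd : 2 ≤ d) {l ρ r : ℝ} (hr : 0 ≤ r) :
    Tpsi d l ρ r ≤ Real.exp (-(kappa0 l) * |r - ρ|) := by
  have := rsc_pos hd l
  unfold Tpsi
  split_ifs with h
  · exact mul_le_of_le_one_right (Real.exp_pos _).le
      (pow_le_one₀ (by positivity) ((div_le_one this).2 h))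
  · exact le_rfl

lemma Tpsi_eq {l ρ r : ℝ} (hr : rsc d l < r) :
    Tpsi d l ρ r = Real.exp (-(kappa0 l) * |r - ρ|) := by
  unfold Tpsi
  rw [if_neg (not_le.2 hr)]

lemma measurable_Tpsi (l ρ : ℝ) : Measurable (Tpsi d l ρ) := by
  unfold Tpsi
  refine Measurable.ite measurableSet_Iic ?_ ?_ <;> fun_prop

end Firewall

namespace FireSetting

variable {d : ℕ} {V : Euc n → ℝ} {D : EscData n V} {u : ℝ → ℝ → Euc n} {C ν K : ℝ}

/-- The integrand of the firewall functional, without its weight. -/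
def density (V : Euc n → ℝ) (u : ℝ → ℝ → Euc n) (r t : ℝ) : ℝ :=
  wV V * (‖ur u r t‖ ^ 2 / 2 + V (u r t)) + ‖u r t‖ ^ 2 / 2

/-- The coercivity constant of the firewall density. -/
def coef (V : Euc n → ℝ) : ℝ := min (wV V / 2) (1 / 4)

lemma coef_pos : 0 < coef V := lt_min (by have := wV_pos (V := V); positivity) (by norm_num)

lemma density_ge (S : FireSetting d V D u C ν K) (r t : ℝ) :
    coef V * (‖ur u r t‖ ^ 2 + ‖u r t‖ ^ 2) ≤ density V u r t :=
  firewall_integrand_ge S.smooth S.coerc D S.zero_mem S.map_zero _ _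

lemma density_nonneg (S : FireSetting d V D u C ν K) (r t : ℝ) : 0 ≤ density V u r t :=
  le_trans (by have := coef_pos (V := V); positivity) (S.density_ge r t)

lemma exists_density_le (S : FireSetting d V D u C ν K) :
    ∃ A : ℝ, 0 ≤ A ∧ ∀ r t : ℝ, 0 ≤ r → 0 < t →
      density V u r t ≤ A * (‖u r t‖ ^ 2 + ‖ur u r t‖ ^ 2) := by
  obtain ⟨B, hB0, -, -, hB⟩ := exists_quadratic_bound S.smooth S.zero_mem.1 S.map_zero C
  have hw := wV_pos (V := V)
  refine ⟨wV V * (1 + B) + 1, by positivity, fun r t hr ht => ?_⟩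
  have h1 := (le_abs_self _).trans (hB _ (S.bound.norm_u hr ht))
  have h2 := mul_le_mul_of_nonneg_left h1 hw.le
  unfold density
  have h3 : 0 ≤ wV V * B * ‖ur u r t‖ ^ 2 := by positivity
  have h4 : 0 ≤ wV V * ‖ur u r t‖ ^ 2 := by positivity
  have h5 : 0 ≤ wV V * ‖u r t‖ ^ 2 := by positivity
  have h6 := sq_nonneg ‖ur u r t‖
  have h7 := sq_nonneg ‖u r t‖
  nlinarith

lemma continuous_density (S : FireSetting d V D u C ν K) {t : ℝ} (ht : 0 < t) :
    Continuous fun r => density V u r t := by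
  have h1 := S.sol.continuous_u ht
  have h2 := S.sol.continuous_ur ht
  have h3 := S.smooth.continuous
  unfold density
  fun_prop

lemma norm_sq_add_le (S : FireSetting d V D u C ν K) {r t : ℝ} (hr : 0 ≤ r) (ht : 0 < t) :
    ‖u r t‖ ^ 2 + ‖ur u r t‖ ^ 2 ≤ 2 * C ^ 2 := by
  have h1 := pow_le_pow_left₀ (norm_nonneg _) (S.bound.norm_u hr ht) 2
  have h2 := pow_le_pow_left₀ (norm_nonneg _) (S.bound.norm_ur hr ht) 2
  linarith

lemma integrableOn_Tpsi_mul (S : FireSetting d V D u C ν K) {ρ : ℝ} {f : ℝ → ℝ} {M : ℝ}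
    (hf : ContinuousOn f (Ioi 0)) (hM : ∀ r, 0 < r → |f r| ≤ M) :
    IntegrableOn (fun r => Tpsi d D.lmin ρ r * f r) (Ioi 0) := by
  refine Integrable.mono' (((integrable_exp_abs (kappa0_pos D) ρ).integrableOn (s := Ioi 0)).mul_const M)
    ((measurable_Tpsi _ _).aestronglyMeasurable.mul (hf.aestronglyMeasurable measurableSet_Ioi)) ?_
  filter_upwards [ae_restrict_mem measurableSet_Ioi] with r hr
  rw [Real.norm_eq_abs, abs_mul, abs_of_nonneg (Tpsi_nonneg S.two_le (mem_Ioi.1 hr).le)]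
  exact mul_le_mul (Tpsi_le S.two_le (mem_Ioi.1 hr).le) (hM r hr) (abs_nonneg _) (Real.exp_pos _).le

lemma integrableOn_density (S : FireSetting d V D u C ν K) {ρ t : ℝ} (ht : 0 < t) :
    IntegrableOn (fun r => Tpsi d D.lmin ρ r * density V u r t) (Ioi 0) := by
  obtain ⟨A, hA0, hA⟩ := S.exists_density_le
  refine S.integrableOn_Tpsi_mul (M := A * (2 * C ^ 2)) (S.continuous_density ht).continuousOn
    fun r hr => ?_
  rw [abs_of_nonneg (S.density_nonneg r t)]
  exact (hA r t hr.le ht).trans (mul_le_mul_of_nonneg_left (S.norm_sq_add_le hr.le ht) hA0)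

lemma F0_nonneg (S : FireSetting d V D u C ν K) (ρ t : ℝ) : 0 ≤ F0 V d D.lmin u ρ t :=
  setIntegral_nonneg measurableSet_Ioi fun r hr =>
    mul_nonneg (Tpsi_nonneg S.two_le (mem_Ioi.1 hr).le) (S.density_nonneg r t)

/-- The firewall controls the solution pointwise. -/
lemma norm_sq_le_F0 (S : FireSetting d V D u C ν K) {ρ t : ℝ} (hρ : rsc d D.lmin ≤ ρ)
    (ht : 0 < t) :
    coef V * ‖u ρ t‖ ^ 2 ≤ (kappa0 D.lmin + 1) * F0 V d D.lmin u ρ t := by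
  have hκ := kappa0_pos D
  set κ := kappa0 D.lmin with hκd
  have hρ0 : 0 < ρ := (rsc_pos S.two_le _).trans_le hρ
  have hm := coef_pos (V := V)
  set g : ℝ → ℝ := fun r => Real.exp (-κ * (r - ρ)) * ‖u r t‖ ^ 2 with hg
  set g' : ℝ → ℝ := fun r => (Real.exp (-κ * (r - ρ)) * -κ) * ‖u r t‖ ^ 2 +
    Real.exp (-κ * (r - ρ)) * (2 * ⟪u r t, ur u r t⟫) with hg'
  have hder : ∀ r ∈ Ici ρ, HasDerivAt g (g' r) r := fun r _ => by
    have h1 : HasDerivAt (fun r => Real.exp (-κ * (r - ρ))) (Real.exp (-κ * (r - ρ)) * -κ) r := by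
      have : HasDerivAt (fun r => -κ * (r - ρ)) (-κ) r := by
        simpa using ((hasDerivAt_id r).sub_const ρ).const_mul (-κ)
      exact this.exp
    exact h1.mul (S.sol.hasDerivAt_r ht r).norm_sq
  have hT : ∀ r ∈ Ioi ρ, Tpsi d D.lmin ρ r = Real.exp (-κ * (r - ρ)) := fun r hr => by
    rw [Tpsi_eq (hρ.trans_lt hr), abs_of_nonneg (sub_nonneg.2 (mem_Ioi.1 hr).le)]
  have hb : ∀ r ∈ Ioi ρ, |g' r| ≤ (κ + 1) / coef V * (Tpsi d D.lmin ρ r * density V u r t) :=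
    fun r hr => by
    rw [hT r hr]
    have h1 := S.density_ge r t
    have h2 := abs_real_inner_le_norm (u r t) (ur u r t)
    have h3 : |g' r| ≤ Real.exp (-κ * (r - ρ)) * ((κ + 1) * (‖ur u r t‖ ^ 2 + ‖u r t‖ ^ 2)) := by
      have e : g' r = Real.exp (-κ * (r - ρ)) *
          (-κ * ‖u r t‖ ^ 2 + 2 * ⟪u r t, ur u r t⟫) := by simp only [hg']; ring
      rw [e, abs_mul, abs_of_pos (Real.exp_pos _)]
      refine mul_le_mul_of_nonneg_left ?_ (Real.exp_pos _).le
      have h4 := abs_le.1 h2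
      have h5 := sq_nonneg (‖u r t‖ - ‖ur u r t‖)
      have h6 : 0 ≤ κ * ‖ur u r t‖ ^ 2 := by positivity
      have h7 : 0 ≤ κ * ‖u r t‖ ^ 2 := by positivity
      rw [abs_le]
      constructor <;> nlinarith
    refine h3.trans ?_
    have h4 : (κ + 1) * (‖ur u r t‖ ^ 2 + ‖u r t‖ ^ 2) ≤ (κ + 1) / coef V * density V u r t := by
      rw [div_mul_eq_mul_div, le_div_iff₀ hm]
      nlinarith
    calc _ ≤ Real.exp (-κ * (r - ρ)) * ((κ + 1) / coef V * density V u r t) :=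
          mul_le_mul_of_nonneg_left h4 (Real.exp_pos _).le
      _ = _ := by ring
  have hsub : Ioi ρ ⊆ Ioi 0 := Ioi_subset_Ioi hρ0.le
  have hInt := ((S.integrableOn_density (ρ := ρ) ht).mono_set hsub).const_mul ((κ + 1) / coef V)
  have hg'c : Continuous g' := by
    have h1 := S.sol.continuous_u ht
    have h2 := S.sol.continuous_ur ht
    simp only [hg']
    fun_prop
  have hg'i : IntegrableOn g' (Ioi ρ) := by
    refine Integrable.mono' hInt hg'c.aestronglyMeasurable ?_
    filter_upwards [ae_restrict_mem measurableSet_Ioi] with r hr using hb r hr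
  have hlim : Tendsto g atTop (𝓝 0) := by
    have h1 : Tendsto (fun r => Real.exp (-κ * (r - ρ)) * C ^ 2) atTop (𝓝 0) := by
      have : Tendsto (fun r => Real.exp (-(κ * (r - ρ)))) atTop (𝓝 0) :=
        Real.tendsto_exp_neg_atTop_nhds_zero.comp
          ((tendsto_atTop_add_const_right _ (-ρ) tendsto_id).const_mul_atTop hκ)
      simpa using this.mul_const (C ^ 2)
    refine squeeze_zero' (Eventually.of_forall fun r => by positivity) ?_ h1
    filter_upwards [eventually_ge_atTop 0] with r hr
    exact mul_le_mul_of_nonneg_left (pow_le_pow_left₀ (norm_nonneg _) (S.bound.norm_u hr ht) 2)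
      (Real.exp_pos _).le
  have hI := integral_Ioi_of_hasDerivAt_of_tendsto' hder hg'i hlim
  have hgρ : g ρ = ‖u ρ t‖ ^ 2 := by simp [hg]
  have h1 : ‖u ρ t‖ ^ 2 ≤ ∫ r in Ioi ρ, (κ + 1) / coef V * (Tpsi d D.lmin ρ r * density V u r t) := by
    rw [← hgρ]
    have : g ρ = ∫ r in Ioi ρ, -g' r := by rw [integral_neg, hI]; ring
    rw [this]
    exact setIntegral_mono_on hg'i.neg hInt measurableSet_Ioi
      fun r hr => (neg_le_abs _).trans (hb r hr)
  rw [integral_const_mul] at h1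
  have h2 : ∫ r in Ioi ρ, Tpsi d D.lmin ρ r * density V u r t ≤ F0 V d D.lmin u ρ t := by
    refine setIntegral_mono_set (S.integrableOn_density ht) ?_ (Eventually.of_forall hsub)
    filter_upwards [ae_restrict_mem measurableSet_Ioi] with r hr
    exact mul_nonneg (Tpsi_nonneg S.two_le (mem_Ioi.1 hr).le) (S.density_nonneg r t)
  have h3 := h1.trans (mul_le_mul_of_nonneg_left h2 (by positivity))
  rw [div_mul_eq_mul_div, le_div_iff₀ hm] at h3
  linarith

lemma deltaEsc_sq : deltaEsc D.dEsc (wV V) (kappa0 D.lmin) ^ 2 =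
    D.dEsc ^ 2 * (coef V / (kappa0 D.lmin + 1)) := by
  have hκ := kappa0_pos D
  have hm := coef_pos (V := V)
  unfold deltaEsc
  rw [mul_pow, Real.sq_sqrt]
  · rfl
  · change 0 ≤ coef V / _
    positivity

lemma norm_le_dEsc (S : FireSetting d V D u C ν K) {ρ t δ : ℝ} (hρ : rsc d D.lmin ≤ ρ)
    (ht : 0 < t) (hδ : δ = deltaEsc D.dEsc (wV V) (kappa0 D.lmin))
    (h : F0 V d D.lmin u ρ t ≤ δ ^ 2) : ‖u ρ t‖ ≤ D.dEsc := by
  have hκ := kappa0_pos D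
  have hm := coef_pos (V := V)
  have h1 := S.norm_sq_le_F0 hρ ht
  have h2 := mul_le_mul_of_nonneg_left h (by positivity : 0 ≤ kappa0 D.lmin + 1)
  rw [hδ, deltaEsc_sq] at h2
  have h3 : (kappa0 D.lmin + 1) * (D.dEsc ^ 2 * (coef V / (kappa0 D.lmin + 1))) =
      coef V * D.dEsc ^ 2 := by field_simp
  rw [h3] at h2
  have h4 := le_of_mul_le_mul_left (h1.trans h2) hm
  exact (sq_le_sq₀ (norm_nonneg _) D.dEsc_pos.le).1 h4

lemma measurableSet_Sigma0 (S : FireSetting d V D u C ν K) {t : ℝ} (ht : 0 < t) :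
    MeasurableSet (Sigma0 u D.dEsc t) :=
  measurableSet_Ici.inter
    (measurableSet_lt measurable_const (S.sol.continuous_u ht).norm.measurable)

lemma setIntegral_Sigma0_le (S : FireSetting d V D u C ν K) {ρ t ℓ : ℝ} (ht : 0 < t) (hℓ : 0 ≤ ℓ)
    (h : ∀ r ∈ Sigma0 u D.dEsc t, ℓ ≤ |r - ρ|) :
    ∫ r in Sigma0 u D.dEsc t, Tpsi d D.lmin ρ r ≤
      2 / kappa0 D.lmin * Real.exp (-(kappa0 D.lmin) * ℓ) := by
  refine le_trans ?_ (setIntegral_exp_abs_le (kappa0_pos D) hℓ h)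
  have hi := (integrable_exp_abs (kappa0_pos D) ρ).integrableOn (s := Sigma0 u D.dEsc t)
  refine setIntegral_mono_on (Integrable.mono' hi (measurable_Tpsi _ _).aestronglyMeasurable ?_) hi
    (S.measurableSet_Sigma0 ht) fun r hr => Tpsi_le S.two_le hr.1
  filter_upwards [ae_restrict_mem (S.measurableSet_Sigma0 ht)] with r hr
  rw [Real.norm_of_nonneg (Tpsi_nonneg S.two_le hr.1)]
  exact Tpsi_le S.two_le hr.1

lemma F0_le_add (S : FireSetting d V D u C ν K) {ρ t t' : ℝ} (hρ : rsc d D.lmin ≤ ρ)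
    (ht : 0 < t) (htt : t ≤ t') :
    F0 V d D.lmin u ρ t' ≤ F0 V d D.lmin u ρ t + 2 * K / kappa0 D.lmin * (t' - t) := by
  have := Convex.image_sub_le_mul_sub_of_deriv_le (convex_Icc t t')
    (f := fun s => F0 V d D.lmin u ρ s) (C := 2 * K / kappa0 D.lmin)
    (fun s hs => (S.fire ρ hρ s (ht.trans_le hs.1)).1.continuousAt.continuousWithinAt)
    (fun s hs => by
      rw [interior_Icc] at hs
      exact (S.fire ρ hρ s (ht.trans hs.1)).1.differentiableWithinAt)
    (fun s hs => by
      rw [interior_Icc] at hs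
      have hs0 := ht.trans hs.1
      refine (S.fire ρ hρ s hs0).2.trans ?_
      have h1 := S.setIntegral_Sigma0_le (ρ := ρ) (ℓ := 0) hs0 le_rfl (fun r _ => abs_nonneg _)
      have h2 := mul_le_mul_of_nonneg_left h1 S.K_pos.le
      have h3 := mul_nonneg S.ν_pos.le (S.F0_nonneg ρ s)
      rw [mul_zero, Real.exp_zero, mul_one] at h2
      have h4 : K * (2 / kappa0 D.lmin) = 2 * K / kappa0 D.lmin := by ring
      linarith)
    t (left_mem_Icc.2 htt) t' (right_mem_Icc.2 htt) htt
  linarith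

lemma F0_decay (S : FireSetting d V D u C ν K) {ρ t t' B : ℝ} (hρ : rsc d D.lmin ≤ ρ)
    (ht : 0 < t) (htt : t ≤ t')
    (h : ∀ s ∈ Icc t t', K * ∫ r in Sigma0 u D.dEsc s, Tpsi d D.lmin ρ r ≤ ν * B) :
    F0 V d D.lmin u ρ t' - B ≤ Real.exp (-ν * (t' - t)) * (F0 V d D.lmin u ρ t - B) := by
  have hd : ∀ s ∈ Icc t t', HasDerivAt
      (fun s => Real.exp (ν * s) * (F0 V d D.lmin u ρ s - B))
      (Real.exp (ν * s) * ν * (F0 V d D.lmin u ρ s - B) +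
        Real.exp (ν * s) * deriv (fun s => F0 V d D.lmin u ρ s) s) s := fun s hs => by
    have h1 : HasDerivAt (fun s => Real.exp (ν * s)) (Real.exp (ν * s) * ν) s := by
      have : HasDerivAt (fun s => ν * s) ν s := by simpa using (hasDerivAt_id s).const_mul ν
      exact this.exp
    exact h1.mul ((S.fire ρ hρ s (ht.trans_le hs.1)).1.hasDerivAt.sub_const B)
  have := Convex.image_sub_le_mul_sub_of_deriv_le (convex_Icc t t')
    (f := fun s => Real.exp (ν * s) * (F0 V d D.lmin u ρ s - B)) (C := 0)
    (fun s hs => (hd s hs).continuousAt.continuousWithinAt)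
    (fun s hs => (hd s (interior_subset hs)).differentiableAt.differentiableWithinAt)
    (fun s hs => by
      have hs' := interior_subset hs
      rw [(hd s hs').deriv]
      have h1 := (S.fire ρ hρ s (ht.trans_le hs'.1)).2
      have h2 := h s hs'
      have h3 := Real.exp_pos (ν * s)
      nlinarith)
    t (left_mem_Icc.2 htt) t' (right_mem_Icc.2 htt) htt
  have e1 : Real.exp (-ν * (t' - t)) = Real.exp (ν * t) * (Real.exp (ν * t'))⁻¹ := by
    rw [← Real.exp_neg, ← Real.exp_add]; ring_nf
  have h3 := Real.exp_pos (ν * t')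
  rw [e1, mul_right_comm, ← div_eq_mul_inv, le_div_iff₀ h3]
  linarith

/-- The firewall is controlled by the local `H¹` norm of the solution. -/
lemma exists_F0_le_local (S : FireSetting d V D u C ν K) :
    ∃ A : ℝ, 0 < A ∧ ∀ ρ t L : ℝ, 0 < t → 0 ≤ L → F0 V d D.lmin u ρ t ≤
      A * (∫ r in Icc (ρ - L) (ρ + L), (‖u r t‖ ^ 2 + ‖ur u r t‖ ^ 2)) +
        A * Real.exp (-(kappa0 D.lmin) * L) := by
  obtain ⟨A, hA0, hA⟩ := S.exists_density_le
  have hκ := kappa0_pos D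
  set κ := kappa0 D.lmin with hκd
  refine ⟨A + A * (2 * C ^ 2) * (2 / κ) + 1, by positivity, fun ρ t L ht hL => ?_⟩
  set I := Icc (ρ - L) (ρ + L) with hI
  set q : ℝ → ℝ := fun r => ‖u r t‖ ^ 2 + ‖ur u r t‖ ^ 2 with hq
  have hqc : Continuous q := by
    have h1 := S.sol.continuous_u ht
    have h2 := S.sol.continuous_ur ht
    simp only [hq]; fun_prop
  have hq0 : ∀ r, 0 ≤ q r := fun r => by positivity
  have hi1 : Integrable (I.indicator fun r => A * q r) :=
    ((hqc.const_mul A).integrableOn_Icc).integrable_indicator measurableSet_Icc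
  have hi2 : Integrable (Iᶜ.indicator fun r => A * (2 * C ^ 2) * Real.exp (-κ * |r - ρ|)) :=
    ((integrable_exp_abs hκ ρ).const_mul _).indicator measurableSet_Icc.compl
  have h1 : F0 V d D.lmin u ρ t ≤ ∫ r in Ioi (0:ℝ), (I.indicator (fun r => A * q r) r +
      Iᶜ.indicator (fun r => A * (2 * C ^ 2) * Real.exp (-κ * |r - ρ|)) r) := by
    refine setIntegral_mono_on (S.integrableOn_density ht) (hi1.add hi2).integrableOn
      measurableSet_Ioi fun r hr => ?_
    have hr0 : 0 ≤ r := (mem_Ioi.1 hr).le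
    have hT0 := Tpsi_nonneg S.two_le (l := D.lmin) (ρ := ρ) hr0
    have hT := Tpsi_le S.two_le (l := D.lmin) (ρ := ρ) hr0
    have hden := hA r t hr0 ht
    by_cases hrI : r ∈ I
    · rw [indicator_of_mem hrI, indicator_of_notMem (by simpa using hrI), add_zero]
      refine le_trans ?_ hden
      have : Tpsi d D.lmin ρ r ≤ 1 := hT.trans (Real.exp_le_one_iff.2 (by
        rw [neg_mul, neg_nonpos]; positivity))
      exact mul_le_of_le_one_left (S.density_nonneg r t) this
    · rw [indicator_of_notMem hrI, indicator_of_mem (by simpa using hrI), zero_add, mul_comm]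
      refine mul_le_mul (hden.trans (mul_le_mul_of_nonneg_left (S.norm_sq_add_le hr0 ht) hA0)) hT
        hT0 (by positivity)
  have h2 : ∫ r in Ioi (0:ℝ), (I.indicator (fun r => A * q r) r +
      Iᶜ.indicator (fun r => A * (2 * C ^ 2) * Real.exp (-κ * |r - ρ|)) r) ≤
      A * (∫ r in I, q r) + A * (2 * C ^ 2) * (2 / κ * Real.exp (-κ * L)) := by
    rw [integral_add hi1.integrableOn hi2.integrableOn]
    refine add_le_add ?_ ?_
    · rw [← integral_const_mul, ← integral_indicator measurableSet_Icc]
      refine setIntegral_le_integral hi1 (Eventually.of_forall fun r => ?_)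
      exact indicator_nonneg (fun r _ => mul_nonneg hA0 (hq0 r)) r
    · refine (setIntegral_le_integral hi2 (Eventually.of_forall fun r => ?_)).trans ?_
      · exact indicator_nonneg (fun r _ => by positivity) r
      · rw [integral_indicator measurableSet_Icc.compl, integral_const_mul]
        refine mul_le_mul_of_nonneg_left (setIntegral_exp_abs_le hκ hL fun r hr => ?_)
          (by positivity)
        by_contra hcon
        push Not at hcon
        rw [abs_lt] at hcon
        exact hr ⟨by linarith, by linarith⟩
  refine h1.trans (h2.trans ?_)
  have h3 : 0 ≤ ∫ r in I, q r := setIntegral_nonneg measurableSet_Icc fun r _ => hq0 r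
  have h4 := (Real.exp_pos (-κ * L)).le
  have h5 : 0 ≤ A * (2 * C ^ 2) * (2 / κ) := by positivity
  nlinarith [mul_nonneg h5 h3, mul_nonneg hA0 h4]

end FireSetting

section Escape

variable {d : ℕ} {V : Euc n → ℝ} {D : EscData n V} {u : ℝ → ℝ → Euc n}
  {C ν K cHom δ L₀ : ℝ} {rHom : ℝ → ℝ}

/-- The standing assumptions about the escape point. -/
structure EscSetting (d : ℕ) (V : Euc n → ℝ) (D : EscData n V) (u : ℝ → ℝ → Euc n)
    (C ν K cHom δ L₀ : ℝ) (rHom : ℝ → ℝ) : Prop extends FireSetting d V D u C ν K where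
  hom : HHomWith u 0 cHom rHom
  deriv_nonneg : ∀ t : ℝ, 0 ≤ deriv rHom t
  δ_eq : δ = deltaEsc D.dEsc (wV V) (kappa0 D.lmin)
  L₀_eq : L₀ = L0c (kappa0 D.lmin) ν K δ
  hull : HullBound V d D.lmin u δ L₀ rHom
  inv : 0 < cEscV u 0 D.dEsc rHom

namespace EscSetting

lemma monotone_rHom (S : EscSetting d V D u C ν K cHom δ L₀ rHom) : Monotone rHom :=
  monotone_of_deriv_nonneg S.hom.2.1 S.deriv_nonneg

lemma exists_rHom_le (S : EscSetting d V D u C ν K cHom δ L₀ rHom) :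
    ∃ T : ℝ, 0 < T ∧ ∀ t s, T ≤ t → 0 ≤ s →
      cHom / 2 * s ≤ rHom (t + s) - rHom t ∧ rHom (t + s) - rHom t ≤ (cHom + 1) * s := by
  have hc := S.hom.1
  have h1 := S.hom.2.2.1.eventually (Ioo_mem_nhds (by linarith : cHom / 2 < cHom)
    (by linarith : cHom < cHom + 1))
  obtain ⟨T, hT⟩ := eventually_atTop.1 h1
  refine ⟨max T 1, by positivity, fun t s ht hs => ?_⟩
  have hle : t ≤ t + s := by linarith
  have hcont : ContinuousOn rHom (Icc t (t + s)) :=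
    fun x _ => (S.hom.2.1 x).continuousAt.continuousWithinAt
  have hdiff : DifferentiableOn ℝ rHom (interior (Icc t (t + s))) :=
    fun x _ => (S.hom.2.1 x).differentiableWithinAt
  have hmem : ∀ x ∈ interior (Icc t (t + s)), T ≤ x := fun x hx =>
    (le_max_left _ _).trans (ht.trans (interior_subset hx).1)
  have h2 := Convex.mul_sub_le_image_sub_of_le_deriv (convex_Icc t (t + s)) hcont hdiff
    (fun x hx => (hT x (hmem x hx)).1.le) t (left_mem_Icc.2 hle) _ (right_mem_Icc.2 hle) hle
  have h3 := Convex.image_sub_le_mul_sub_of_deriv_le (convex_Icc t (t + s)) hcont hdiff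
    (fun x hx => (hT x (hmem x hx)).2.le) t (left_mem_Icc.2 hle) _ (right_mem_Icc.2 hle) hle
  rw [add_sub_cancel_left] at h2 h3
  exact ⟨h2, h3⟩

lemma δ_sq_pos (S : EscSetting d V D u C ν K cHom δ L₀ rHom) : 0 < δ ^ 2 := by
  have h1 := kappa0_pos D
  have h2 := FireSetting.coef_pos (V := V)
  have h3 := D.dEsc_pos
  rw [S.δ_eq, FireSetting.deltaEsc_sq]
  positivity

/-- The firewall is small close to `rHom`. -/
lemma F0_small (S : EscSetting d V D u C ν K cHom δ L₀ rHom) {L ε : ℝ} (hL : 0 ≤ L) (hε : 0 < ε) :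
    ∃ T : ℝ, 0 < T ∧ ∀ t r, T ≤ t → |r - rHom t| ≤ L → F0 V d D.lmin u r t ≤ ε := by
  obtain ⟨A, hA0, hA⟩ := S.exists_F0_le_local
  have hκ := kappa0_pos D
  have h1 : Tendsto (fun M : ℝ => A * Real.exp (-(kappa0 D.lmin * M))) atTop (𝓝 0) := by
    have := (Real.tendsto_exp_neg_atTop_nhds_zero.comp (tendsto_id.const_mul_atTop hκ)).const_mul A
    simpa using this
  obtain ⟨M, hM, hM0⟩ := ((h1.eventually (ge_mem_nhds (half_pos hε))).and
    (eventually_gt_atTop 0)).exists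
  have h2 := S.hom.2.2.2 (L + M) (by positivity)
  obtain ⟨T, hT⟩ := eventually_atTop.1
    (h2.eventually (ge_mem_nhds (by positivity : 0 < ε / 2 / A)))
  refine ⟨max T 1, by positivity, fun t r ht hr => ?_⟩
  have ht0 : 0 < t := lt_of_lt_of_le (by positivity) ht
  have h3 := hT t ((le_max_left _ _).trans ht)
  set q : ℝ → ℝ := fun r => ‖u r t‖ ^ 2 + ‖ur u r t‖ ^ 2 with hq
  have hqc : Continuous q := by
    have h1 := S.sol.continuous_u ht0
    have h2 := S.sol.continuous_ur ht0
    simp only [hq]; fun_prop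
  have h4 : ∫ x in Icc (r - M) (r + M), q x ≤ ε / 2 / A := by
    refine le_trans ?_ h3
    have e : ∫ x in (-(L + M))..(L + M), (‖u (rHom t + x) t - 0‖ ^ 2 + ‖ur u (rHom t + x) t‖ ^ 2) =
        ∫ x in Icc (rHom t - (L + M)) (rHom t + (L + M)), q x := by
      have := intervalIntegral.integral_comp_add_left (a := -(L + M)) (b := L + M) q (rHom t)
      simp only [sub_zero]
      rw [this, intervalIntegral.integral_of_le (by linarith), integral_Icc_eq_integral_Ioc]
      rfl
    rw [e]
    have := abs_le.1 hr
    refine setIntegral_mono_set hqc.integrableOn_Icc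
      (Eventually.of_forall fun x => by positivity)
      (Eventually.of_forall (Icc_subset_Icc (by linarith) (by linarith)))
  have h5 := hA r t M ht0 hM0.le
  have h6 := mul_le_mul_of_nonneg_left h4 hA0.le
  have h7 : A * (ε / 2 / A) = ε / 2 := by field_simp
  rw [neg_mul] at h5
  linarith

lemma L₀_pos (S : EscSetting d V D u C ν K cHom δ L₀ rHom) : 0 < L₀ := by
  by_contra hcon
  push Not at hcon
  have hκ := kappa0_pos D
  have hδ := S.δ_sq_pos
  have hν := S.ν_pos
  have hK := S.K_pos
  set κ := kappa0 D.lmin with hκd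
  have h1 : 16 * K ≤ ν * δ ^ 2 * κ := by
    rw [S.L₀_eq, L0c, ← hκd] at hcon
    have h2 : Real.log (16 * K / (ν * δ ^ 2 * κ)) ≤ 0 := by
      by_contra h
      push Not at h
      have : 0 < κ⁻¹ * Real.log (16 * K / (ν * δ ^ 2 * κ)) := by positivity
      linarith
    rw [Real.log_nonpos_iff (by positivity), div_le_one (by positivity)] at h2
    exact h2
  obtain ⟨A, hA0, hA⟩ := S.exists_F0_le_local
  have hA1 : ∀ ρ, F0 V d D.lmin u ρ 1 ≤ A := fun ρ => by
    simpa using hA ρ 1 0 one_pos le_rfl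
  have h2 : ∀ ρ t, rsc d D.lmin ≤ ρ → 1 ≤ t →
      F0 V d D.lmin u ρ t - δ ^ 2 / 8 ≤ Real.exp (-ν * (t - 1)) * A := fun ρ t hρ ht => by
    refine (S.F0_decay hρ one_pos ht fun s hs => ?_).trans ?_
    · have h3 := S.setIntegral_Sigma0_le (ρ := ρ) (ℓ := 0) (one_pos.trans_le hs.1) le_rfl
        (fun r _ => abs_nonneg _)
      rw [mul_zero, Real.exp_zero, mul_one] at h3
      refine (mul_le_mul_of_nonneg_left h3 hK.le).trans ?_
      rw [mul_div_assoc', div_le_iff₀ hκ]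
      linarith
    · refine mul_le_mul_of_nonneg_left ?_ (Real.exp_pos _).le
      linarith [hA1 ρ]
  have h3 : Tendsto (fun t : ℝ => Real.exp (-ν * (t - 1)) * A) atTop (𝓝 0) := by
    have := (Real.tendsto_exp_neg_atTop_nhds_zero.comp
      ((tendsto_atTop_add_const_right _ (-1) tendsto_id).const_mul_atTop hν)).mul_const A
    simpa [Function.comp_def, sub_eq_add_neg] using this
  have h4 : ∀ᶠ t in atTop, rEscF u 0 D.dEsc rHom t ≤ rsc d D.lmin := by
    filter_upwards [h3.eventually (ge_mem_nhds (by positivity : 0 < δ ^ 2 / 8)),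
      eventually_ge_atTop 1] with t ht ht1
    refine Real.sSup_le (fun r hr => ?_) (rsc_pos S.two_le _).le
    by_contra hlt
    push Not at hlt
    have h5 := h2 r t hlt.le ht1
    have h6 := S.norm_sq_le_F0 hlt.le (one_pos.trans_le ht1)
    have h7 : F0 V d D.lmin u r t ≤ δ ^ 2 / 4 := by linarith
    have h8 := hr.2
    rw [sub_zero] at h8
    have hm := FireSetting.coef_pos (V := V)
    have h9 := mul_le_mul_of_nonneg_left h7 (by positivity : 0 ≤ kappa0 D.lmin + 1)
    rw [S.δ_eq, FireSetting.deltaEsc_sq] at h9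
    have hκ1 : kappa0 D.lmin + 1 ≠ 0 := by positivity
    have h10 : (kappa0 D.lmin + 1) * (D.dEsc ^ 2 * (FireSetting.coef V / (kappa0 D.lmin + 1)) / 4) =
      FireSetting.coef V * D.dEsc ^ 2 / 4 := by field_simp
    rw [h10] at h9
    rw [h8] at h6
    have := D.dEsc_pos
    have : 0 < FireSetting.coef V * D.dEsc ^ 2 := by positivity
    linarith
  have h5 : cEscV u 0 D.dEsc rHom ≤ 0 := by
    have h6 : Tendsto (fun t : ℝ => rsc d D.lmin / t) atTop (𝓝 0) :=
      tendsto_const_nhds.div_atTop tendsto_id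
    rw [← h6.limsup_eq]
    refine limsup_le_limsup ?_ ?_ h6.isBoundedUnder_le
    · filter_upwards [h4, eventually_gt_atTop 0] with t ht ht0
      gcongr
    · refine IsBoundedUnder.isCoboundedUnder_le ⟨0, ?_⟩
      rw [eventually_map]
      filter_upwards [eventually_gt_atTop 0] with t ht0
      exact div_nonneg (Real.sSup_nonneg fun r hr => hr.1.1) ht0.le
  exact absurd S.inv (not_lt.2 h5)

lemma exp_L₀ (S : EscSetting d V D u C ν K cHom δ L₀ rHom) :
    K * (2 / kappa0 D.lmin * Real.exp (-(kappa0 D.lmin) * L₀)) = ν * (δ ^ 2 / 8) := by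
  have hκ := kappa0_pos D
  have hδ := S.δ_sq_pos
  have hν := S.ν_pos
  have hK := S.K_pos
  have : -(kappa0 D.lmin) * L₀ = Real.log (ν * δ ^ 2 * kappa0 D.lmin / (16 * K)) := by
    rw [S.L₀_eq, L0c, neg_mul, mul_inv_cancel_left₀ hκ.ne', ← Real.log_inv, inv_div]
  rw [this, Real.exp_log (by positivity)]
  field_simp
  ring

end EscSetting

/-- The finite part of the no-escape hull. -/
def hullReal (δ L₀ x : ℝ) : ℝ := δ ^ 2 / 2 - δ ^ 2 / (4 * L₀) * min x L₀

lemma hull_eq_of_nonneg (hL : 0 < L₀) {x : ℝ} (hx : 0 ≤ x) :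
    hull δ L₀ x = ((hullReal δ L₀ x : ℝ) : EReal) := by
  unfold hull hullReal
  rw [if_neg (not_lt.2 hx)]
  split_ifs with h
  · rw [min_eq_left h]
    congr 1
    field_simp
    ring
  · rw [min_eq_right (not_le.1 h).le]
    congr 1
    field_simp
    norm_num

lemma hull_eq_of_neg {x : ℝ} (hx : x < 0) : hull δ L₀ x = ⊤ := by
  unfold hull
  rw [if_pos hx]

lemma hullReal_ge (hL : 0 < L₀) (x : ℝ) : δ ^ 2 / 4 ≤ hullReal δ L₀ x := by
  have h1 : δ ^ 2 / (4 * L₀) * min x L₀ ≤ δ ^ 2 / (4 * L₀) * L₀ :=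
    mul_le_mul_of_nonneg_left (min_le_right _ _) (by positivity)
  have h2 : δ ^ 2 / (4 * L₀) * L₀ = δ ^ 2 / 4 := by field_simp
  unfold hullReal
  linarith

lemma hullReal_le (hL : 0 < L₀) {x : ℝ} (hx : 0 ≤ x) : hullReal δ L₀ x ≤ δ ^ 2 / 2 := by
  have h1 : 0 ≤ δ ^ 2 / (4 * L₀) * min x L₀ := mul_nonneg (by positivity) (le_min hx hL.le)
  unfold hullReal
  linarith

lemma hullReal_eq (hL : 0 < L₀) {x : ℝ} (hx : L₀ ≤ x) : hullReal δ L₀ x = δ ^ 2 / 4 := by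
  unfold hullReal
  rw [min_eq_right hx]
  field_simp
  norm_num

lemma mem_rescSet_iff (hL : 0 < L₀) {t rl : ℝ} : rl ∈ rescSet V d D.lmin u δ L₀ rHom t ↔
    rl ∈ Icc (rsc d D.lmin) (rHom t) ∧ ∀ r, rl ≤ r → r ≤ rHom t →
      F0 V d D.lmin u r t ≤ max (hullReal δ L₀ (r - rl)) (hullReal δ L₀ (rHom t - r)) := by
  unfold rescSet
  rw [Set.mem_ofPred_eq]
  refine and_congr_right fun hrl => ⟨fun h r hr1 hr2 => ?_, fun h r hr => ?_⟩
  · have h1 := h r (hrl.1.trans hr1)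
    rw [hull_eq_of_nonneg hL (sub_nonneg.2 hr1), hull_eq_of_nonneg hL (sub_nonneg.2 hr2),
      ← EReal.coe_strictMono.monotone.map_max, EReal.coe_le_coe_iff] at h1
    exact h1
  · by_cases h1 : rl ≤ r
    · by_cases h2 : r ≤ rHom t
      · rw [hull_eq_of_nonneg hL (sub_nonneg.2 h1), hull_eq_of_nonneg hL (sub_nonneg.2 h2),
          ← EReal.coe_strictMono.monotone.map_max, EReal.coe_le_coe_iff]
        exact h r h1 h2
      · rw [hull_eq_of_neg (by linarith : rHom t - r < 0)]; simp
    · rw [hull_eq_of_neg (by linarith : r - rl < 0)]; simp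

end Escape

section EscapePoint

variable {d : ℕ} {V : Euc n → ℝ} {D : EscData n V} {u : ℝ → ℝ → Euc n}
  {C ν K cHom δ L₀ : ℝ} {rHom : ℝ → ℝ}

local notation "fEsc" => rescF V d D.lmin u δ L₀ rHom

namespace EscSetting

lemma mem_rescSet (S : EscSetting d V D u C ν K cHom δ L₀ rHom) {t : ℝ} (ht : 0 ≤ t) :
    rHom t - 1 ∈ rescSet V d D.lmin u δ L₀ rHom t :=
  ⟨⟨(S.hull t ht).1, by linarith⟩, (S.hull t ht).2⟩

lemma bddBelow_rescSet (t : ℝ) : BddBelow (rescSet V d D.lmin u δ L₀ rHom t) :=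
  ⟨rsc d D.lmin, fun _ h => h.1.1⟩

lemma rsc_le_esc (S : EscSetting d V D u C ν K cHom δ L₀ rHom) {t : ℝ} (ht : 0 ≤ t) :
    rsc d D.lmin ≤ fEsc t :=
  le_csInf ⟨_, S.mem_rescSet ht⟩ fun _ h => h.1.1

lemma esc_nonneg (S : EscSetting d V D u C ν K cHom δ L₀ rHom) {t : ℝ} (ht : 0 ≤ t) :
    0 ≤ fEsc t :=
  (rsc_pos S.two_le _).le.trans (S.rsc_le_esc ht)

lemma esc_le (S : EscSetting d V D u C ν K cHom δ L₀ rHom) {t : ℝ} (ht : 0 ≤ t) :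
    fEsc t ≤ rHom t - 1 :=
  csInf_le (bddBelow_rescSet t) (S.mem_rescSet ht)

/-- The firewall is small between the escape point and `rHom`. -/
lemma F0_le_of_esc_lt (S : EscSetting d V D u C ν K cHom δ L₀ rHom) {t r : ℝ} (ht : 0 ≤ t)
    (hr : fEsc t < r) (hr' : r ≤ rHom t) : F0 V d D.lmin u r t ≤ δ ^ 2 / 2 := by
  obtain ⟨rl, hrl, hlt⟩ := exists_lt_of_csInf_lt ⟨_, S.mem_rescSet ht⟩ hr
  have h1 := ((mem_rescSet_iff S.L₀_pos).1 hrl).2 r hlt.le hr'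
  exact h1.trans (max_le (hullReal_le S.L₀_pos (by linarith)) (hullReal_le S.L₀_pos (by linarith)))

lemma cNoEsc_pos (S : EscSetting d V D u C ν K cHom δ L₀ rHom) :
    0 < cNoEsc (kappa0 D.lmin) K L₀ δ := by
  have := S.δ_sq_pos
  have := S.L₀_pos
  have := S.K_pos
  have := kappa0_pos D
  unfold cNoEsc
  positivity

lemma mem_rescSet_step (S : EscSetting d V D u C ν K cHom δ L₀ rHom) :
    ∃ T τ : ℝ, 0 < T ∧ 0 < τ ∧ ∀ t s rl, T ≤ t → 0 ≤ s → s ≤ τ →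
      rl ∈ rescSet V d D.lmin u δ L₀ rHom t →
      rl + cNoEsc (kappa0 D.lmin) K L₀ δ * s ≤ rHom (t + s) →
      rl + cNoEsc (kappa0 D.lmin) K L₀ δ * s ∈ rescSet V d D.lmin u δ L₀ rHom (t + s) := by
  have hδ := S.δ_sq_pos
  have hL := S.L₀_pos
  have hK := S.K_pos
  have hκ := kappa0_pos D
  have hc := S.hom.1
  have hcno := S.cNoEsc_pos
  have hcno' : δ ^ 2 / (4 * L₀) * cNoEsc (kappa0 D.lmin) K L₀ δ = 2 * K / kappa0 D.lmin := by
    have : δ ≠ 0 := by rintro rfl; simp at hδ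
    unfold cNoEsc
    field_simp
    norm_num
  set cno := cNoEsc (kappa0 D.lmin) K L₀ δ
  set κ := kappa0 D.lmin with hκd
  obtain ⟨T₁, hT₁, hhom⟩ := S.exists_rHom_le
  obtain ⟨T₂, hT₂, hsmall⟩ := S.F0_small (L := L₀ + 1) (ε := δ ^ 2 / 8) (by positivity)
    (by positivity)
  refine ⟨max T₁ T₂, min (δ ^ 2 * κ / (4 * K)) (1 / (cHom + 1)), lt_max_of_lt_left hT₁,
    by positivity, fun t s rl ht hs hsτ hrl hle => ?_⟩
  have ht0 : 0 < t := hT₁.trans_le ((le_max_left _ _).trans ht)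
  have hs1 : 2 * K / κ * s ≤ δ ^ 2 / 2 := by
    have h1 : 2 * K / κ * s ≤ 2 * K / κ * (δ ^ 2 * κ / (4 * K)) :=
      mul_le_mul_of_nonneg_left (hsτ.trans (min_le_left _ _)) (by positivity)
    have h2 : 2 * K / κ * (δ ^ 2 * κ / (4 * K)) = δ ^ 2 / 2 := by field_simp; ring
    linarith
  have hs2 : rHom (t + s) ≤ rHom t + 1 := by
    have h1 := (hhom t s ((le_max_left _ _).trans ht) hs).2
    have h2 : (cHom + 1) * s ≤ (cHom + 1) * (1 / (cHom + 1)) :=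
      mul_le_mul_of_nonneg_left (hsτ.trans (min_le_right _ _)) (by positivity)
    have h3 : (cHom + 1) * (1 / (cHom + 1)) = 1 := by field_simp
    linarith
  have hcs : 0 ≤ cno * s := by positivity
  rw [mem_rescSet_iff hL] at hrl ⊢
  refine ⟨⟨by linarith [hrl.1.1], hle⟩, fun r hr hr' => ?_⟩
  have hge := hullReal_ge (δ := δ) hL (r - (rl + cno * s))
  have hrsc : rsc d D.lmin ≤ r := by linarith [hrl.1.1]
  refine le_max_of_le_left ?_
  by_cases hfar : rHom (t + s) - (L₀ + 1) ≤ r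
  · have h1 := hsmall (t + s) r (by linarith [le_max_right T₁ T₂])
      (abs_le.2 ⟨by linarith, by linarith⟩)
    linarith
  push Not at hfar
  have h1 := hrl.2 r (by linarith) (by linarith)
  rw [hullReal_eq hL (by linarith : L₀ ≤ rHom t - r), max_eq_left (hullReal_ge hL _)] at h1
  by_cases hnear : L₀ ≤ r - rl
  · rw [hullReal_eq hL hnear] at h1
    have h2 := S.F0_decay (B := δ ^ 2 / 8) hrsc ht0 (by linarith : t ≤ t + s) fun s' hs' => by
      rw [← S.exp_L₀]
      refine mul_le_mul_of_nonneg_left (S.setIntegral_Sigma0_le (ht0.trans_le hs'.1) hL.le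
        fun x hx => ?_) hK.le
      by_contra hlt
      push Not at hlt
      have h3 := abs_lt.1 hlt
      have h4 := (hrl.2 x (by linarith) (by linarith)).trans
        (max_le (hullReal_le hL (by linarith)) (hullReal_le hL (by linarith)))
      have h5 := S.F0_le_add (by linarith [hrl.1.1] : rsc d D.lmin ≤ x) ht0 hs'.1
      have h6 : 2 * K / κ * (s' - t) ≤ 2 * K / κ * s :=
        mul_le_mul_of_nonneg_left (by linarith [hs'.2]) (by positivity)
      have h7 := S.norm_le_dEsc (by linarith [hrl.1.1] : rsc d D.lmin ≤ x)
        (ht0.trans_le hs'.1) S.δ_eq (by linarith)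
      exact absurd hx.2 (not_lt.2 h7)
    have h3 : Real.exp (-ν * (t + s - t)) ≤ 1 := by
      rw [Real.exp_le_one_iff, neg_mul]
      have := mul_nonneg S.ν_pos.le hs
      rw [add_sub_cancel_left]
      linarith
    have h4 : Real.exp (-ν * (t + s - t)) * (F0 V d D.lmin u r t - δ ^ 2 / 8) ≤
        Real.exp (-ν * (t + s - t)) * (δ ^ 2 / 8) :=
      mul_le_mul_of_nonneg_left (by linarith) (Real.exp_pos _).le
    have h5 : Real.exp (-ν * (t + s - t)) * (δ ^ 2 / 8) ≤ 1 * (δ ^ 2 / 8) :=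
      mul_le_mul_of_nonneg_right h3 (by positivity)
    linarith
  · push Not at hnear
    have h2 := S.F0_le_add hrsc ht0 (by linarith : t ≤ t + s)
    rw [add_sub_cancel_left] at h2
    unfold hullReal at h1 ⊢
    rw [min_eq_left (by linarith)] at h1 ⊢
    have h3 : δ ^ 2 / (4 * L₀) * (r - (rl + cno * s)) =
        δ ^ 2 / (4 * L₀) * (r - rl) - (δ ^ 2 / (4 * L₀) * cno) * s := by ring
    rw [h3, hcno']
    linarith

/-- The escape point moves to the right at most at the no-escape speed. -/
lemma exists_esc_growth (S : EscSetting d V D u C ν K cHom δ L₀ rHom) :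
    ∃ C₁ : ℝ, 0 ≤ C₁ ∧ ∀ t s, 0 ≤ t → 0 ≤ s →
      fEsc (t + s) ≤ fEsc t + cNoEsc (kappa0 D.lmin) K L₀ δ * s + C₁ := by
  obtain ⟨T, τ, hT, hτ, hstep⟩ := S.mem_rescSet_step
  have hcno := S.cNoEsc_pos
  set cno := cNoEsc (kappa0 D.lmin) K L₀ δ
  have hshort : ∀ t s, T ≤ t → 0 ≤ s → s ≤ τ → fEsc (t + s) ≤ fEsc t + cno * s := by
    intro t s ht hs hsτ
    have ht0 : 0 ≤ t := hT.le.trans ht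
    rw [← sub_le_iff_le_add]
    refine le_csInf ⟨_, S.mem_rescSet ht0⟩ fun rl hrl => ?_
    rw [sub_le_iff_le_add]
    by_cases h : rl + cno * s ≤ rHom (t + s)
    · exact csInf_le (bddBelow_rescSet _) (hstep t s rl ht hs hsτ hrl h)
    · linarith [S.esc_le (t := t + s) (by linarith)]
  have hlong : ∀ N : ℕ, ∀ t s, T ≤ t → 0 ≤ s → s ≤ N * τ → fEsc (t + s) ≤ fEsc t + cno * s := by
    intro N
    induction N with
    | zero =>
      intro t s ht hs hs'
      have : s = 0 := le_antisymm (by simpa using hs') hs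
      simp [this]
    | succ N ih =>
      intro t s ht hs hs'
      by_cases h : s ≤ τ
      · exact hshort t s ht hs h
      push Not at h
      push_cast at hs'
      have h1 := ih t (s - τ) ht (by linarith) (by linarith)
      have h2 := hshort (t + (s - τ)) τ (by linarith) hτ.le le_rfl
      have e : t + (s - τ) + τ = t + s := by ring
      rw [e] at h2
      linarith
  have hgrow : ∀ t s, T ≤ t → 0 ≤ s → fEsc (t + s) ≤ fEsc t + cno * s := by
    intro t s ht hs
    obtain ⟨N, hN⟩ := exists_nat_ge (s / τ)
    exact hlong N t s ht hs ((div_le_iff₀ hτ).1 hN)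
  have hr : 0 ≤ rHom T := by linarith [S.esc_le hT.le, S.esc_nonneg hT.le]
  refine ⟨rHom T, hr, fun t s ht hs => ?_⟩
  have hf := S.esc_nonneg ht
  by_cases h1 : T ≤ t
  · linarith [hgrow t s h1 hs]
  push Not at h1
  by_cases h2 : T ≤ t + s
  · have h3 := hgrow T (t + s - T) le_rfl (by linarith)
    rw [add_sub_cancel] at h3
    have h4 : cno * (t + s - T) ≤ cno * s := mul_le_mul_of_nonneg_left (by linarith) hcno.le
    linarith [S.esc_le hT.le]
  · have h3 := S.monotone_rHom (by linarith : t + s ≤ T)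
    have h4 : 0 ≤ cno * s := by positivity
    linarith [S.esc_le (t := t + s) (by linarith)]

/-- The firewall is not small close to the escape point. -/
lemma exists_F0_gt (S : EscSetting d V D u C ν K cHom δ L₀ rHom) {t : ℝ} (ht : 0 ≤ t)
    (hf : rsc d D.lmin < fEsc t) :
    ∃ r, rsc d D.lmin ≤ r ∧ |r - fEsc t| ≤ L₀ + 1 ∧ δ ^ 2 / 4 < F0 V d D.lmin u r t := by
  have hL := S.L₀_pos
  have hle := S.esc_le ht
  set rl := max (rsc d D.lmin) (fEsc t - 1) with hrl
  have hlt : rl < fEsc t := max_lt hf (by linarith)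
  have hnot : rl ∉ rescSet V d D.lmin u δ L₀ rHom t := fun h =>
    absurd (csInf_le (bddBelow_rescSet t) h) (not_le.2 hlt)
  rw [mem_rescSet_iff hL] at hnot
  push Not at hnot
  obtain ⟨r, hr1, hr2, hr3⟩ := hnot ⟨le_max_left _ _, by linarith⟩
  have hr4 := max_lt_iff.1 hr3
  have hge := hullReal_ge (δ := δ) hL (r - rl)
  refine ⟨r, (le_max_left _ _).trans hr1, abs_le.2 ⟨?_, ?_⟩, by linarith [hr4.1]⟩
  · linarith [le_max_right (rsc d D.lmin) (fEsc t - 1)]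
  · by_contra hcon
    push Not at hcon
    obtain ⟨rl', hrl', hlt'⟩ := exists_lt_of_csInf_lt ⟨_, S.mem_rescSet ht⟩
      (show fEsc t < fEsc t + 1 by linarith)
    have h1 := ((mem_rescSet_iff hL).1 hrl').2 r (by linarith) hr2
    rw [hullReal_eq hL (by linarith : L₀ ≤ r - rl')] at h1
    have : max (δ ^ 2 / 4) (hullReal δ L₀ (rHom t - r)) < F0 V d D.lmin u r t :=
      max_lt (by linarith [hr4.1]) hr4.2
    linarith

lemma exists_le_rHom_sub_esc (S : EscSetting d V D u C ν K cHom δ L₀ rHom) (L : ℝ) :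
    ∃ T : ℝ, 0 < T ∧ ∀ t, T ≤ t → rsc d D.lmin < fEsc t → L ≤ rHom t - fEsc t := by
  have hL := S.L₀_pos
  have hδ := S.δ_sq_pos
  obtain ⟨T, hT, h⟩ := S.F0_small (L := |L| + L₀ + 1) (ε := δ ^ 2 / 8) (by positivity)
    (by positivity)
  refine ⟨T, hT, fun t ht hf => ?_⟩
  obtain ⟨r, -, hr, hF⟩ := S.exists_F0_gt (hT.le.trans ht) hf
  by_contra hcon
  push Not at hcon
  have h1 := S.esc_le (hT.le.trans ht)
  have h2 := abs_le.1 hr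
  have h3 := h t r ht (abs_le.2 ⟨by linarith [le_abs_self L], by linarith [abs_nonneg L]⟩)
  linarith

/-- The solution is not small close to the escape point. -/
lemma exists_norm_ge (S : EscSetting d V D u C ν K cHom δ L₀ rHom) :
    ∃ L ε : ℝ, rsc d D.lmin < L ∧ 0 < ε ∧ ∀ t, 0 < t → L ≤ fEsc t →
      ∃ r, 0 ≤ r ∧ |r - fEsc t| ≤ L ∧ ε ≤ ‖u r t‖ := by
  have hL := S.L₀_pos
  have hδ := S.δ_sq_pos
  have hκ := kappa0_pos D
  have hC := S.bound.nonneg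
  have hrs := rsc_pos S.two_le D.lmin
  obtain ⟨A, hA0, hA⟩ := S.exists_F0_le_local
  have h1 : Tendsto (fun M : ℝ => A * Real.exp (-(kappa0 D.lmin * M))) atTop (𝓝 0) := by
    have := (Real.tendsto_exp_neg_atTop_nhds_zero.comp (tendsto_id.const_mul_atTop hκ)).const_mul A
    simpa using this
  obtain ⟨M, hM, hM0⟩ := ((h1.eventually (ge_mem_nhds (by positivity : 0 < δ ^ 2 / 8))).and
    (eventually_gt_atTop 0)).exists
  obtain ⟨h, h0, hh1, hh⟩ : ∃ h : ℝ, 0 < h ∧ h ≤ 1 ∧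
      A * (2 * M * (h * (1 + (2 + C) ^ 2))) ≤ δ ^ 2 / 8 := by
    refine ⟨min 1 (δ ^ 2 / 8 / (A * (2 * M * (1 + (2 + C) ^ 2)))), by positivity,
      min_le_left _ _, ?_⟩
    set P := A * (2 * M * (1 + (2 + C) ^ 2)) with hP
    have hP0 : 0 < P := by positivity
    calc _ = P * min 1 (δ ^ 2 / 8 / P) := by rw [hP]; ring
      _ ≤ P * (δ ^ 2 / 8 / P) := mul_le_mul_of_nonneg_left (min_le_right _ _) hP0.le
      _ = _ := by field_simp
  refine ⟨L₀ + 1 + M + 1 + rsc d D.lmin, h ^ 2, by linarith, by positivity, fun t ht hf => ?_⟩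
  by_contra hcon
  push Not at hcon
  obtain ⟨r₁, -, hr₁, hF⟩ := S.exists_F0_gt ht.le (by linarith : rsc d D.lmin < fEsc t)
  have hr₁' := abs_le.1 hr₁
  have hu : ∀ r, r₁ - M ≤ r → r ≤ r₁ + M + 1 → 0 ≤ r ∧ ‖u r t‖ ≤ h ^ 2 := fun r h1 h2 =>
    ⟨by linarith, (hcon r (by linarith) (abs_le.2 ⟨by linarith, by linarith⟩)).le⟩
  have hb : ∀ r ∈ Icc (r₁ - M) (r₁ + M),
      ‖u r t‖ ^ 2 + ‖ur u r t‖ ^ 2 ≤ h * (1 + (2 + C) ^ 2) := by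
    intro r hr
    obtain ⟨hr0, h2⟩ := hu r hr.1 (by linarith [hr.2])
    obtain ⟨-, h3⟩ := hu (r + h) (by linarith [hr.1]) (by linarith [hr.2])
    have h4 := S.sol.norm_taylor_le S.bound ht hr0 (by linarith : r ≤ r + h)
    rw [add_sub_cancel_left] at h4
    have h5 : h * ‖ur u r t‖ ≤ h * ((2 + C) * h) := by
      calc h * ‖ur u r t‖ = ‖h • ur u r t‖ := by rw [norm_smul, Real.norm_of_nonneg h0.le]
        _ = ‖u (r + h) t - u r t - (u (r + h) t - u r t - h • ur u r t)‖ := by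
          congr 1; abel
        _ ≤ ‖u (r + h) t‖ + ‖u r t‖ + ‖u (r + h) t - u r t - h • ur u r t‖ :=
          (norm_sub_le _ _).trans (add_le_add_left (norm_sub_le _ _) _)
        _ ≤ h ^ 2 + h ^ 2 + C * h ^ 2 := by gcongr
        _ = _ := by ring
    have h6 : ‖ur u r t‖ ≤ (2 + C) * h := le_of_mul_le_mul_left h5 h0
    have h7 : ‖ur u r t‖ ^ 2 ≤ ((2 + C) * h) ^ 2 := pow_le_pow_left₀ (norm_nonneg _) h6 2
    have h8 : ‖u r t‖ ^ 2 ≤ (h ^ 2) ^ 2 := pow_le_pow_left₀ (norm_nonneg _) h2 2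
    have h9 : h ^ 2 ≤ h := by nlinarith
    have h10 : (h ^ 2) ^ 2 ≤ h := by nlinarith [sq_nonneg h]
    have h11 : ((2 + C) * h) ^ 2 ≤ (2 + C) ^ 2 * h := by
      rw [mul_pow]; exact mul_le_mul_of_nonneg_left h9 (by positivity)
    linarith
  have hI : ∫ r in Icc (r₁ - M) (r₁ + M), (‖u r t‖ ^ 2 + ‖ur u r t‖ ^ 2) ≤
      2 * M * (h * (1 + (2 + C) ^ 2)) := by
    have hc1 := S.sol.continuous_u ht
    have hc2 := S.sol.continuous_ur ht
    have := setIntegral_mono_on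
      (Continuous.integrableOn_Icc (by fun_prop) : IntegrableOn
        (fun r => ‖u r t‖ ^ 2 + ‖ur u r t‖ ^ 2) (Icc (r₁ - M) (r₁ + M)) volume)
      (integrableOn_const (by simp)) measurableSet_Icc hb
    refine this.trans (le_of_eq ?_)
    rw [setIntegral_const, smul_eq_mul, Measure.real, Real.volume_Icc,
      ENNReal.toReal_ofReal (by linarith)]
    ring
  have h5 := hA r₁ t M ht hM0.le
  have h6 := mul_le_mul_of_nonneg_left hI hA0.le
  rw [neg_mul] at h5
  linarith

end EscSetting

end EscapePoint

section Dissipation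

lemma hasDerivAt_of_taylor {F G : ℝ → Euc n} {A B a : ℝ}
    (hF : ∀ x y, x ≤ y → ‖F y - F x - (y - x) • G x‖ ≤ A * (y - x) ^ 2)
    (hG : ∀ x y, x ≤ y → ‖G y - G x‖ ≤ B * (y - x)) : HasDerivAt F (G a) a := by
  have h : ∀ y, ‖F y - F a - (y - a) • G a‖ ≤ (A + B) * ‖y - a‖ ^ 2 := by
    intro y
    rw [Real.norm_eq_abs, sq_abs]
    rcases le_total a y with hy | hy
    · have h1 := hF a y hy
      have h2 : 0 ≤ B * (y - a) := (norm_nonneg _).trans (hG a y hy)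
      nlinarith
    · have h1 := hF y a hy
      have h2 := hG y a hy
      have e : F y - F a - (y - a) • G a =
          -(F a - F y - (a - y) • G y) + (a - y) • (G a - G y) := by
        rw [smul_sub, sub_smul y a, sub_smul a y, sub_smul a y]; abel
      rw [e]
      refine (norm_add_le _ _).trans ?_
      rw [norm_neg, norm_smul, Real.norm_of_nonneg (sub_nonneg.2 hy)]
      have h3 : (a - y) * ‖G a - G y‖ ≤ (a - y) * (B * (a - y)) :=
        mul_le_mul_of_nonneg_left h2 (sub_nonneg.2 hy)
      nlinarith
  rw [hasDerivAt_iff_isLittleO]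
  refine Asymptotics.IsBigO.trans_isLittleO (g := fun y => ‖y - a‖ ^ 2)
    (Asymptotics.IsBigO.of_bound (A + B) (Eventually.of_forall fun y => ?_)) ?_
  · rw [Real.norm_of_nonneg (by positivity : 0 ≤ ‖y - a‖ ^ 2)]
    exact h y
  · simpa using Asymptotics.isLittleO_pow_sub_sub a (by norm_num : 1 < 2)

lemma exists_tendsto_ultrafilter (U : Ultrafilter ℕ) {x : ℕ → Euc n} {C : ℝ}
    (h : ∀ᶠ k in (U : Filter ℕ), ‖x k‖ ≤ C) : ∃ l, Tendsto x U (𝓝 l) ∧ ‖l‖ ≤ C := by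
  obtain ⟨l, hl, hl'⟩ := (isCompact_closedBall (0 : Euc n) C).ultrafilter_le_nhds (U.map x)
    (by rw [le_principal_iff]
        change x ⁻¹' _ ∈ U
        filter_upwards [h] with k hk
        simpa using hk)
  exact ⟨l, hl', by simpa using hl⟩

variable {d : ℕ} {V : Euc n → ℝ} {D : EscData n V} {u : ℝ → ℝ → Euc n}
  {C ν K cHom δ L₀ : ℝ} {rHom : ℝ → ℝ}

lemma IsRadialSolution.continuousOn_dissip (hV : ContDiff ℝ 2 V) (hu : IsRadialSolution d V u)
    (c : ℝ) {t : ℝ} (ht : 0 < t) :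
    ContinuousOn (fun r => ‖ut u r t + c • ur u r t‖ ^ 2) (Ioi 0) :=
  ((hu.continuousOn_ut hV ht).add ((hu.continuous_ur ht).continuousOn.const_smul c)).norm.pow 2

lemma IsRadialSolution.norm_ur_sub_sub_le (hV : ContDiff ℝ 2 V) (hd : 1 ≤ d)
    (hu : IsRadialSolution d V u) (hC : SolBound u C) {c M t ρ r r' θ : ℝ} (hc : 0 ≤ c)
    (hM : 0 ≤ M)
    (hlip : ∀ x y : Euc n, ‖x‖ ≤ C → ‖y‖ ≤ C → ‖gradient V x - gradient V y‖ ≤ M * ‖x - y‖)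
    (ht : 0 < t) (hρ : 0 < ρ) (hr : ρ ≤ r) (hrr : r ≤ r') (hθ : 0 < θ) :
    ‖ur u r' t - ur u r t - (r' - r) • (-(c • ur u r t) + gradient V (u r t))‖ ≤
      (c * C + M * C) * (r' - r) ^ 2 + (r' - r) * (d * C / ρ) + (r' - r) * θ +
        θ⁻¹ * ∫ x in Icc r r', ‖ut u x t + c • ur u x t‖ ^ 2 := by
  have hC0 := hC.nonneg
  set g := -(c • ur u r t) + gradient V (u r t) with hg
  have hpos : ∀ x ∈ Icc r r', 0 < x := fun x hx => hρ.trans_le (hr.trans hx.1)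
  have h1 : ∫ x in r..r', (urr u x t - g) = ur u r' t - ur u r t - (r' - r) • g := by
    rw [intervalIntegral.integral_sub ((hu.cont_rr t ht).intervalIntegrable _ _)
      (by simp), intervalIntegral.integral_const,
      intervalIntegral.integral_eq_sub_of_hasDerivAt (fun x _ => hu.hasDerivAt_rr ht x)
        ((hu.cont_rr t ht).intervalIntegrable _ _)]
  have hcD : ContinuousOn (fun x => ‖ut u x t + c • ur u x t‖ ^ 2) (Icc r r') :=
    (hu.continuousOn_dissip hV c ht).mono hpos
  have hInt : IntervalIntegrable (fun x => (c * C + M * C) * (r' - r) + d * C / ρ + θ +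
      θ⁻¹ * ‖ut u x t + c • ur u x t‖ ^ 2) volume r r' := by
    refine ContinuousOn.intervalIntegrable ?_
    rw [uIcc_of_le hrr]
    exact continuousOn_const.add (hcD.const_mul θ⁻¹)
  have h2 : ∀ x ∈ Icc r r', ‖urr u x t - g‖ ≤ (c * C + M * C) * (r' - r) + d * C / ρ + θ +
      θ⁻¹ * ‖ut u x t + c • ur u x t‖ ^ 2 := by
    intro x hx
    have hx0 := hpos x hx
    have hr0 : 0 ≤ r := hρ.le.trans hr
    set X := ut u x t + c • ur u x t with hX
    have e : urr u x t - g = -(c • (ur u x t - ur u r t)) +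
        (gradient V (u x t) - gradient V (u r t)) - curv d u x t + X := by
      rw [hX, hu.ut_eq hx0 ht, hg, smul_sub]; abel
    have b1 : ‖c • (ur u x t - ur u r t)‖ ≤ c * (C * (r' - r)) := by
      rw [norm_smul, Real.norm_of_nonneg hc]
      refine mul_le_mul_of_nonneg_left ((hu.norm_ur_sub_le_r hC ht hr0 hx.1).trans ?_) hc
      exact mul_le_mul_of_nonneg_left (by linarith [hx.2]) hC0
    have b2 : ‖gradient V (u x t) - gradient V (u r t)‖ ≤ M * (C * (r' - r)) := by
      refine (hlip _ _ (hC.norm_u hx0.le ht) (hC.norm_u hr0 ht)).trans ?_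
      refine mul_le_mul_of_nonneg_left ((hu.norm_u_sub_le_r hC ht hr0 hx.1).trans ?_) hM
      exact mul_le_mul_of_nonneg_left (by linarith [hx.2]) hC0
    have b3 : ‖curv d u x t‖ ≤ d * C / ρ :=
      (hC.norm_curv_le_div hd ht hx0).trans
        (div_le_div_of_nonneg_left (by positivity) hρ (hr.trans hx.1))
    have b4 : ‖X‖ ≤ θ + θ⁻¹ * ‖X‖ ^ 2 := by
      have h5 : θ * ‖X‖ ≤ θ * (θ + θ⁻¹ * ‖X‖ ^ 2) := by
        rw [mul_add, mul_inv_cancel_left₀ hθ.ne']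
        nlinarith [sq_nonneg (θ - ‖X‖), norm_nonneg X]
      exact le_of_mul_le_mul_left h5 hθ
    rw [e]
    have t1 := norm_add_le (-(c • (ur u x t - ur u r t)) +
        (gradient V (u x t) - gradient V (u r t)) - curv d u x t) X
    have t2 := norm_sub_le (-(c • (ur u x t - ur u r t)) +
        (gradient V (u x t) - gradient V (u r t))) (curv d u x t)
    have t3 := norm_add_le (-(c • (ur u x t - ur u r t)))
        (gradient V (u x t) - gradient V (u r t))
    rw [norm_neg] at t3
    linarith
  rw [← h1]
  refine (intervalIntegral.norm_integral_le_of_norm_le hrr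
    ((ae_restrict_iff' measurableSet_Ioc).1 ((ae_restrict_iff' measurableSet_Ioc).2
      (Eventually.of_forall fun x hx => h2 x ⟨hx.1.le, hx.2⟩))) hInt).trans (le_of_eq ?_)
  rw [intervalIntegral.integral_add (by simp) ((ContinuousOn.intervalIntegrable
      (by rw [uIcc_of_le hrr]; exact hcD)).const_mul _), intervalIntegral.integral_const,
    intervalIntegral.integral_const_mul, intervalIntegral.integral_of_le hrr,
    integral_Icc_eq_integral_Ioc, smul_eq_mul]
  ring

local notation "fEsc" => rescF V d D.lmin u δ L₀ rHom

/-- If no front invading the origin travels at the speed `c`, then the dissipation in a frame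
travelling at the speed `c` is bounded from below close to the escape point. -/
lemma EscSetting.exists_dissip_ge (S : EscSetting d V D u C ν K cHom δ L₀ rHom)
    (hnd : HNonDeg V) (hbist : HOnlyBist V) {c : ℝ} (hc : 0 < c)
    (hempty : ¬ (PhiInv V c 0).Nonempty) :
    ∃ ε L R T η : ℝ, 0 < ε ∧ 0 < L ∧ L < R ∧ 0 < T ∧ 0 < η ∧ η ≤ 1 ∧
      ∀ t, T ≤ t → R ≤ fEsc t → ∀ s ∈ Icc t (t + η),
        ε ≤ ∫ r in Icc (fEsc t - L) (fEsc t + L), ‖ut u r s + c • ur u r s‖ ^ 2 := by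
  have hδ := S.δ_sq_pos
  have hκ := kappa0_pos D
  have hK := S.K_pos
  have hu := S.sol
  have hC := S.bound
  have hC0 := hC.nonneg
  have hd : 1 ≤ d := le_trans (by norm_num) S.two_le
  obtain ⟨L₁, ε₃, hL₁, hε₃, hlarge⟩ := S.exists_norm_ge
  have hrs := rsc_pos S.two_le D.lmin
  obtain ⟨M, hM, hlip⟩ := exists_lipschitz_gradient S.smooth C
  choose Tk hTk hTk' using fun k : ℕ => S.exists_le_rHom_sub_esc (k : ℝ)
  set η := min 1 (min (δ ^ 2 * kappa0 D.lmin / (4 * K)) (ε₃ / (2 * (C + 1)))) with hη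
  have hη0 : 0 < η := by positivity
  have hη1 : 2 * K / kappa0 D.lmin * η ≤ δ ^ 2 / 2 := by
    have h1 : 2 * K / kappa0 D.lmin * η ≤
        2 * K / kappa0 D.lmin * (δ ^ 2 * kappa0 D.lmin / (4 * K)) :=
      mul_le_mul_of_nonneg_left ((min_le_right _ _).trans (min_le_left _ _)) (by positivity)
    have h2 : 2 * K / kappa0 D.lmin * (δ ^ 2 * kappa0 D.lmin / (4 * K)) = δ ^ 2 / 2 := by
      field_simp; ring
    linarith
  have hη2 : C * η ≤ ε₃ / 2 := by
    have h1 : C * η ≤ (C + 1) * (ε₃ / (2 * (C + 1))) :=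
      mul_le_mul (by linarith) ((min_le_right _ _).trans (min_le_right _ _)) hη0.le (by positivity)
    have h2 : (C + 1) * (ε₃ / (2 * (C + 1))) = ε₃ / 2 := by field_simp
    linarith
  by_contra hcon
  have hcon' : ∀ k : ℕ, ∃ t s, Tk k ≤ t ∧ 2 * ((k : ℝ) + 1) + L₁ ≤ fEsc t ∧ s ∈ Icc t (t + η) ∧
      ∫ r in Icc (fEsc t - (k + 1)) (fEsc t + (k + 1)), ‖ut u r s + c • ur u r s‖ ^ 2 ≤
        ((((k : ℝ) + 1) ^ 2)⁻¹) := by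
    intro k
    by_contra h
    push Not at h
    refine hcon ⟨(((k : ℝ) + 1) ^ 2)⁻¹, k + 1, 2 * ((k : ℝ) + 1) + L₁, Tk k, η, by positivity,
      by positivity, by linarith [(Nat.cast_nonneg k : (0 : ℝ) ≤ k)], hTk k, hη0, min_le_left _ _,
      fun t ht hR s hs => (h t s ht hR hs).le⟩
  choose t s ht hR hs hdis using hcon'
  set a : ℕ → ℝ := fun k => fEsc (t k) with ha
  have ht0 : ∀ k, 0 < t k := fun k => (hTk k).trans_le (ht k)
  have hs0 : ∀ k, 0 < s k := fun k => (ht0 k).trans_le (hs k).1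
  have hk0 : ∀ k : ℕ, (0 : ℝ) ≤ k := fun k => Nat.cast_nonneg k
  have hpos : ∀ (k : ℕ) (y : ℝ), |y| ≤ (k : ℝ) + 1 → (k : ℝ) + 1 ≤ a k + y := fun k y hy => by
    have h1 := abs_le.1 hy
    have h2 := hR k
    simp only [ha]
    linarith
  have hpos0 : ∀ (k : ℕ) (y : ℝ), |y| ≤ (k : ℝ) + 1 → 0 ≤ a k + y := fun k y hy => by
    linarith [hpos k y hy, hk0 k]
  set U : Ultrafilter ℕ := hyperfilter ℕ with hU
  have hUtop : (U : Filter ℕ) ≤ atTop := by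
    rw [hU, ← Nat.cofinite_eq_atTop]; exact hyperfilter_le_cofinite
  have hlargek : ∀ y : ℝ, ∀ᶠ k : ℕ in (U : Filter ℕ), |y| ≤ (k : ℝ) := fun y =>
    hUtop ((tendsto_natCast_atTop_atTop (R := ℝ)).eventually (eventually_ge_atTop |y|))
  have hφex : ∀ y, ∃ l, Tendsto (fun k => u (a k + y) (s k)) U (𝓝 l) ∧ ‖l‖ ≤ C := fun y =>
    exists_tendsto_ultrafilter U (by
      filter_upwards [hlargek y] with k hk
      exact hC.norm_u (hpos0 k y (by linarith)) (hs0 k))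
  have hψex : ∀ y, ∃ l, Tendsto (fun k => ur u (a k + y) (s k)) U (𝓝 l) ∧ ‖l‖ ≤ C := fun y =>
    exists_tendsto_ultrafilter U (by
      filter_upwards [hlargek y] with k hk
      exact hC.norm_ur (hpos0 k y (by linarith)) (hs0 k))
  choose φ hφ hφC using hφex
  choose ψ hψ hψC using hψex
  have hgrad : Continuous (gradient V) := (contDiff_gradient S.smooth).continuous
  have hφlip : ∀ x y, x ≤ y → ‖φ y - φ x‖ ≤ C * (y - x) := fun x y hxy => by
    refine le_of_tendsto ((hφ y).sub (hφ x)).norm ?_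
    filter_upwards [hlargek x] with k hk
    have := hu.norm_u_sub_le_r hC (hs0 k) (hpos0 k x (by linarith))
      (by linarith : a k + x ≤ a k + y)
    rwa [add_sub_add_left_eq_sub] at this
  have hψlip : ∀ x y, x ≤ y → ‖ψ y - ψ x‖ ≤ C * (y - x) := fun x y hxy => by
    refine le_of_tendsto ((hψ y).sub (hψ x)).norm ?_
    filter_upwards [hlargek x] with k hk
    have := hu.norm_ur_sub_le_r hC (hs0 k) (hpos0 k x (by linarith))
      (by linarith : a k + x ≤ a k + y)
    rwa [add_sub_add_left_eq_sub] at this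
  have hφd : ∀ y, HasDerivAt φ (ψ y) y := fun y => by
    refine hasDerivAt_of_taylor (A := C) (B := C) (fun x y hxy => ?_) hψlip
    refine le_of_tendsto (((hφ y).sub (hφ x)).sub ((hψ x).const_smul (y - x))).norm ?_
    filter_upwards [hlargek x] with k hk
    have := hu.norm_taylor_le hC (hs0 k) (hpos0 k x (by linarith))
      (by linarith : a k + x ≤ a k + y)
    rwa [add_sub_add_left_eq_sub] at this
  have hψd : ∀ y, HasDerivAt ψ (-(c • ψ y) + gradient V (φ y)) y := fun y => by
    refine hasDerivAt_of_taylor (A := c * C + M * C) (B := c * C + M * C)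
      (G := fun y => -(c • ψ y) + gradient V (φ y)) (fun x y hxy => ?_) (fun x y hxy => ?_)
    · have hlim : Tendsto (fun k : ℕ => (c * C + M * C) * (y - x) ^ 2 +
          ((y - x) * (d * C) + (y - x) + 1) * ((k : ℝ) + 1)⁻¹) U
          (𝓝 ((c * C + M * C) * (y - x) ^ 2)) := by
        have h1 : Tendsto (fun k : ℕ => ((k : ℝ) + 1)⁻¹) U (𝓝 0) :=
          (tendsto_inv_atTop_zero.comp (tendsto_atTop_add_const_right _ 1
            tendsto_natCast_atTop_atTop)).mono_left hUtop
        simpa using (h1.const_mul ((y - x) * (d * C) + (y - x) + 1)).const_add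
          ((c * C + M * C) * (y - x) ^ 2)
      refine le_of_tendsto_of_tendsto (((hψ y).sub (hψ x)).sub
        ((((hψ x).const_smul c).neg.add ((hgrad.tendsto _).comp (hφ x))).const_smul (y - x))).norm
        hlim ?_
      filter_upwards [hlargek x, hlargek y] with k hkx hky
      have hk1 : (0 : ℝ) < k + 1 := by linarith [hk0 k]
      have h2 := hu.norm_ur_sub_sub_le S.smooth hd hC hc.le hM hlip (hs0 k) hk1
        (hpos k x (by linarith)) (by linarith : a k + x ≤ a k + y) (inv_pos.2 hk1)
      rw [add_sub_add_left_eq_sub] at h2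
      refine h2.trans ?_
      have h3 : ∫ r in Icc (a k + x) (a k + y), ‖ut u r (s k) + c • ur u r (s k)‖ ^ 2 ≤
          (((k : ℝ) + 1) ^ 2)⁻¹ := by
        refine le_trans ?_ (hdis k)
        have hx := abs_le.1 hkx
        have hy := abs_le.1 hky
        refine setIntegral_mono_set (ContinuousOn.integrableOn_Icc
          ((hu.continuousOn_dissip S.smooth c (hs0 k)).mono fun r hr => ?_))
          (Eventually.of_forall fun r => by positivity)
          (Eventually.of_forall (Icc_subset_Icc (by simp only [ha]; linarith)
            (by simp only [ha]; linarith)))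
        have := hpos k (-((k : ℝ) + 1)) (by rw [abs_neg, abs_of_pos hk1])
        exact lt_of_lt_of_le hk1 (this.trans hr.1)
      have h4 := mul_le_mul_of_nonneg_left h3 (inv_nonneg.2 (inv_nonneg.2 hk1.le))
      have h5 : (((k : ℝ) + 1)⁻¹)⁻¹ * (((k : ℝ) + 1) ^ 2)⁻¹ = ((k : ℝ) + 1)⁻¹ := by
        field_simp
      rw [h5] at h4
      rw [div_eq_mul_inv]
      linarith
    · have h1 : ‖gradient V (φ y) - gradient V (φ x)‖ ≤ M * (C * (y - x)) :=
        (hlip _ _ (hφC y) (hφC x)).trans (mul_le_mul_of_nonneg_left (hφlip x y hxy) hM)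
      have h2 : ‖c • (ψ y - ψ x)‖ ≤ c * (C * (y - x)) := by
        rw [norm_smul, Real.norm_of_nonneg hc.le]
        exact mul_le_mul_of_nonneg_left (hψlip x y hxy) hc.le
      have e : -(c • ψ y) + gradient V (φ y) - (-(c • ψ x) + gradient V (φ x)) =
          (gradient V (φ y) - gradient V (φ x)) - c • (ψ y - ψ x) := by
        rw [smul_sub]; abel
      rw [e]
      refine (norm_sub_le _ _).trans ?_
      linarith
  have hesc : ∀ y > 0, ‖φ y‖ ≤ D.dEsc := fun y hy => by
    refine le_of_tendsto (hφ y).norm ?_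
    filter_upwards [hlargek y] with k hk
    rw [abs_of_pos hy] at hk
    have hRk := hR k
    have h1 := hTk' k (t k) (ht k) (by linarith [hk0 k])
    have h2 := S.F0_le_of_esc_lt (r := a k + y) (ht0 k).le (by simp only [ha]; linarith)
      (by simp only [ha]; linarith)
    have h3 : rsc d D.lmin ≤ a k + y := by simp only [ha]; linarith [hk0 k]
    have h4 := S.F0_le_add h3 (ht0 k) (hs k).1
    have h5 : 2 * K / kappa0 D.lmin * (s k - t k) ≤ 2 * K / kappa0 D.lmin * η :=
      mul_le_mul_of_nonneg_left (by linarith [(hs k).2]) (by positivity)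
    exact S.norm_le_dEsc h3 (hs0 k) S.δ_eq (by linarith)
  have hex : ∀ k, ∃ y : ℝ, |y| ≤ L₁ ∧ ε₃ / 2 ≤ ‖u (a k + y) (s k)‖ ∧ 0 ≤ a k + y := fun k => by
    obtain ⟨r, hr0, hr1, hr2⟩ := hlarge (t k) (ht0 k) (by linarith [hR k, hk0 k])
    refine ⟨r - a k, hr1, ?_, by simpa using hr0⟩
    rw [add_sub_cancel]
    have h1 := hu.norm_u_sub_le hC hr0 (ht0 k) (hs k).1
    have h2 : C * (s k - t k) ≤ C * η := mul_le_mul_of_nonneg_left (by linarith [(hs k).2]) hC0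
    have h3 := norm_sub_norm_le (u r (t k)) (u r (s k))
    rw [norm_sub_rev] at h3
    linarith
  choose y hy1 hy2 hy3 using hex
  obtain ⟨y₀, -, hy₀⟩ := (isCompact_closedBall (0 : ℝ) L₁).ultrafilter_le_nhds (U.map y)
    (by rw [le_principal_iff]
        change y ⁻¹' _ ∈ U
        filter_upwards with k
        simpa using hy1 k)
  have hy₀' : Tendsto y U (𝓝 y₀) := hy₀
  have hne : φ y₀ ≠ 0 := by
    have h1 : Tendsto (fun k => ‖u (a k + y₀) (s k)‖ + C * |y k - y₀|) U
        (𝓝 (‖φ y₀‖ + C * |y₀ - y₀|)) :=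
      (hφ y₀).norm.add ((hy₀'.sub_const y₀).abs.const_mul C)
    have h2 : ε₃ / 2 ≤ ‖φ y₀‖ + C * |y₀ - y₀| := by
      refine ge_of_tendsto h1 ?_
      filter_upwards [hlargek y₀] with k hk
      have hp := hpos0 k y₀ (by linarith)
      have h3 : ‖u (a k + y k) (s k) - u (a k + y₀) (s k)‖ ≤ C * |y k - y₀| := by
        rcases le_total (y₀) (y k) with h | h
        · have := hu.norm_u_sub_le_r hC (hs0 k) hp (by linarith : a k + y₀ ≤ a k + y k)
          rwa [add_sub_add_left_eq_sub, ← abs_of_nonneg (sub_nonneg.2 h)] at this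
        · have := hu.norm_u_sub_le_r hC (hs0 k) (hy3 k) (by linarith : a k + y k ≤ a k + y₀)
          rwa [add_sub_add_left_eq_sub, ← abs_of_nonneg (sub_nonneg.2 h), abs_sub_comm,
            norm_sub_rev] at this
      have h4 := norm_sub_norm_le (u (a k + y k) (s k)) (u (a k + y₀) (s k))
      linarith [hy2 k]
    rw [sub_self, abs_zero, mul_zero, add_zero] at h2
    exact norm_pos_iff.1 (by linarith)
  exact hempty (phiInv_nonempty_of_bounded_profile S.smooth D hnd hbist S.zero_mem hc hφd hψd hφC
    hψC hesc hne)

end Dissipation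

section EnergyDerivative

variable {d : ℕ} {V : Euc n → ℝ} {u : ℝ → ℝ → Euc n} {C κ M t : ℝ}

lemma exists_potential_bound (hV : ContDiff ℝ 2 V) (R : ℝ) : ∃ B : ℝ, 0 ≤ B ∧
    (∀ x : Euc n, ‖x‖ ≤ R → |V x| ≤ B ∧ ‖gradient V x‖ ≤ B) ∧
    ∀ x y : Euc n, ‖x‖ ≤ R → ‖y‖ ≤ R → |V x - V y| ≤ B * ‖x - y‖ := by
  obtain ⟨B₁, hB₁⟩ := (isCompact_closedBall (0 : Euc n) R).exists_bound_of_continuousOn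
    hV.continuous.continuousOn
  obtain ⟨B₂, hB₂⟩ := (isCompact_closedBall (0 : Euc n) R).exists_bound_of_continuousOn
    (contDiff_gradient hV).continuous.continuousOn
  have hB₂' : ∀ x : Euc n, ‖x‖ ≤ R → ‖gradient V x‖ ≤ max |B₁| |B₂| := fun x hx =>
    (hB₂ x (by simpa using hx)).trans ((le_abs_self _).trans (le_max_right _ _))
  refine ⟨max |B₁| |B₂|, by positivity, fun x hx => ⟨?_, hB₂' x hx⟩, fun x y hx hy => ?_⟩
  · exact (hB₁ x (by simpa using hx)).trans ((le_abs_self _).trans (le_max_left _ _))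
  · have := Convex.norm_image_sub_le_of_norm_hasFDerivWithin_le (s := Metric.closedBall 0 R)
      (C := max |B₁| |B₂|) (fun z _ => (hasGradientAt_of_contDiff hV z).hasFDerivAt.hasFDerivWithinAt)
      (fun z hz => by rw [LinearIsometryEquiv.norm_map]; exact hB₂' z (by simpa using hz)) (convex_closedBall _ _)
      (show y ∈ Metric.closedBall 0 R by simpa) (show x ∈ Metric.closedBall 0 R by simpa)
    simpa using this

lemma integrableOn_of_exp_bound (hκ : 0 < κ) {f : ℝ → ℝ} (hf : ContinuousOn f (Ioi 0))
    (hb : ∀ r > 0, |f r| ≤ M * Real.exp (-κ * r)) : IntegrableOn f (Ioi 0) :=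
  Integrable.mono' ((exp_neg_integrableOn_Ioi 0 hκ).const_mul M)
    (hf.aestronglyMeasurable measurableSet_Ioi)
    ((ae_restrict_iff' measurableSet_Ioi).2 (Eventually.of_forall hb))

/-- Integration over the half line of the derivative of an exponentially decaying function. -/
lemma integral_deriv_of_exp_bound (hκ : 0 < κ) {f f' : ℝ → ℝ} {M' : ℝ}
    (hf : ∀ r, HasDerivAt f (f' r) r) (hf' : Continuous f')
    (hb : ∀ r > 0, |f r| ≤ M * Real.exp (-κ * r))
    (hb' : ∀ r > 0, |f' r| ≤ M' * Real.exp (-κ * r)) : ∫ r in Ioi (0 : ℝ), f' r = -f 0 := by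
  have h0 : Tendsto (fun r : ℝ => M * Real.exp (-κ * r)) atTop (𝓝 0) := by
    have := (Real.tendsto_exp_neg_atTop_nhds_zero.comp (tendsto_id.const_mul_atTop hκ)).const_mul M
    simpa [Function.comp_def] using this
  have hlim : Tendsto f atTop (𝓝 0) :=
    squeeze_zero_norm' ((eventually_gt_atTop 0).mono fun r hr => hb r hr) h0
  have := integral_Ioi_of_hasDerivAt_of_tendsto (a := 0) (hf 0).continuousAt.continuousWithinAt
    (fun r _ => hf r) (integrableOn_of_exp_bound hκ hf'.continuousOn hb') hlim
  simpa using this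

/-- A weight decaying exponentially in space, differentiable in time at time `t`. -/
structure TimeWeight (κ M t : ℝ) (w : ℝ → ℝ → ℝ) (wt : ℝ → ℝ) : Prop where
  cont : ∀ t', Continuous fun r => w r t'
  deriv : ∀ r, HasDerivAt (w r) (wt r) t
  bound : ∀ r, 0 ≤ r → |w r t| ≤ M * Real.exp (-κ * r)
  lip : ∀ᶠ s in 𝓝 t, ∀ r, 0 ≤ r → |w r s - w r t| ≤ M * Real.exp (-κ * r) * |s - t|

/-- The density of the weighted energy. -/
def enDensity (V : Euc n → ℝ) (u : ℝ → ℝ → Euc n) (a b : ℝ → ℝ → ℝ) (r t : ℝ) : ℝ :=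
  a r t * (‖ur u r t‖ ^ 2 / 2 + V (u r t)) + b r t * (‖u r t‖ ^ 2 / 2)

/-- The integrand of the increment of the weighted energy, after integration by parts. -/
def enIncrement (V : Euc n → ℝ) (u : ℝ → ℝ → Euc n) (a b : ℝ → ℝ → ℝ) (ar : ℝ → ℝ)
    (t r t' : ℝ) : ℝ :=
  (a r t' - a r t) * (‖ur u r t'‖ ^ 2 / 2 + V (u r t')) +
    (b r t' - b r t) * (‖u r t'‖ ^ 2 / 2) + a r t * (V (u r t') - V (u r t)) +
    b r t / 2 * (‖u r t'‖ ^ 2 - ‖u r t‖ ^ 2) -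
    1 / 2 * ⟪u r t' - u r t, ar r • (ur u r t' + ur u r t) + a r t • (urr u r t' + urr u r t)⟫

/-- The integrand of the time derivative of the weighted energy. -/
def enDeriv (V : Euc n → ℝ) (u : ℝ → ℝ → Euc n) (a b : ℝ → ℝ → ℝ) (ar at' bt : ℝ → ℝ)
    (t r : ℝ) : ℝ :=
  at' r * (‖ur u r t‖ ^ 2 / 2 + V (u r t)) + bt r * (‖u r t‖ ^ 2 / 2) +
    a r t * ⟪gradient V (u r t), ut u r t⟫ + b r t * ⟪u r t, ut u r t⟫ -
    ⟪ut u r t, ar r • ur u r t + a r t • urr u r t⟫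

lemma abs_enDensity_le (hC : SolBound u C) {B : ℝ} (hB : ∀ x : Euc n, ‖x‖ ≤ C → |V x| ≤ B)
    {a b : ℝ → ℝ → ℝ} {r m : ℝ} (ht : 0 < t) (hr : 0 ≤ r) (ha : |a r t| ≤ m) (hb : |b r t| ≤ m) :
    |enDensity V u a b r t| ≤ m * (C ^ 2 + B) := by
  have h1 := hC.norm_u hr ht
  have h2 := hC.norm_ur hr ht
  have h3 := hB _ h1
  have h4 : ‖u r t‖ ^ 2 ≤ C ^ 2 := pow_le_pow_left₀ (norm_nonneg _) h1 2
  have h5 : ‖ur u r t‖ ^ 2 ≤ C ^ 2 := pow_le_pow_left₀ (norm_nonneg _) h2 2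
  have hm : 0 ≤ m := (abs_nonneg _).trans ha
  unfold enDensity
  refine (abs_add_le _ _).trans ?_
  rw [abs_mul, abs_mul]
  have h6 : |‖ur u r t‖ ^ 2 / 2 + V (u r t)| ≤ C ^ 2 / 2 + B := by
    refine (abs_add_le _ _).trans ?_
    rw [abs_of_nonneg (by positivity : 0 ≤ ‖ur u r t‖ ^ 2 / 2)]
    linarith
  have h7 : |‖u r t‖ ^ 2 / 2| ≤ C ^ 2 / 2 := by
    rw [abs_of_nonneg (by positivity)]; linarith
  calc _ ≤ m * (C ^ 2 / 2 + B) + m * (C ^ 2 / 2) :=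
        add_le_add (mul_le_mul ha h6 (abs_nonneg _) hm) (mul_le_mul hb h7 (abs_nonneg _) hm)
    _ = _ := by ring

lemma continuous_enDensity (hV : ContDiff ℝ 2 V) (hu : IsRadialSolution d V u) (ht : 0 < t)
    {a b : ℝ → ℝ → ℝ} (ha : Continuous fun r => a r t) (hb : Continuous fun r => b r t) :
    Continuous fun r => enDensity V u a b r t := by
  have h1 := hu.continuous_u ht
  have h2 := hu.continuous_ur ht
  have h3 := hV.continuous.comp h1
  unfold enDensity
  exact (ha.mul (((h2.norm.pow 2).div_const 2).add h3)).add (hb.mul ((h1.norm.pow 2).div_const 2))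

lemma continuous_enIncrement (hV : ContDiff ℝ 2 V) (hu : IsRadialSolution d V u) {t' : ℝ}
    (ht : 0 < t) (ht' : 0 < t') {a b : ℝ → ℝ → ℝ} {ar : ℝ → ℝ} (ha : ∀ t, Continuous fun r => a r t)
    (hb : ∀ t, Continuous fun r => b r t) (har : Continuous ar) :
    Continuous fun r => enIncrement V u a b ar t r t' := by
  have h1 := hu.continuous_u ht
  have h2 := hu.continuous_ur ht
  have h3 := hV.continuous.comp h1
  have h1' := hu.continuous_u ht'
  have h2' := hu.continuous_ur ht'
  have h3' := hV.continuous.comp h1'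
  have h4 := hu.cont_rr t ht
  have h4' := hu.cont_rr t' ht'
  unfold enIncrement
  exact (((((ha t').sub (ha t)).mul (((h2'.norm.pow 2).div_const 2).add h3')).add
    (((hb t').sub (hb t)).mul ((h1'.norm.pow 2).div_const 2))).add ((ha t).mul (h3'.sub h3))).add
    (((hb t).div_const 2).mul ((h1'.norm.pow 2).sub (h1.norm.pow 2))) |>.sub
    (continuous_const.mul ((h1'.sub h1).inner ((har.smul (h2'.add h2)).add
      ((ha t).smul (h4'.add h4)))))

lemma abs_enIncrement_le (hu : IsRadialSolution d V u) (hC : SolBound u C)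
    {B : ℝ} (hB : ∀ x : Euc n, ‖x‖ ≤ C → |V x| ≤ B)
    (hBl : ∀ x y : Euc n, ‖x‖ ≤ C → ‖y‖ ≤ C → |V x - V y| ≤ B * ‖x - y‖)
    {a b : ℝ → ℝ → ℝ} {ar : ℝ → ℝ} {r t' m : ℝ} (ht : 0 < t) (ht' : 0 < t') (hr : 0 ≤ r)
    (ha : |a r t| ≤ m) (hb : |b r t| ≤ m) (har : |ar r| ≤ m)
    (hal : |a r t' - a r t| ≤ m * |t' - t|) (hbl : |b r t' - b r t| ≤ m * |t' - t|) :
    |enIncrement V u a b ar t r t'| ≤ m * (4 * C ^ 2 + B + B * C) * |t' - t| := by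
  have hC0 := hC.nonneg
  have h1 := hC.norm_u hr ht
  have h1' := hC.norm_u hr ht'
  have h2 := hC.norm_ur hr ht
  have h2' := hC.norm_ur hr ht'
  have h3 := hC.norm_urr hr ht
  have h3' := hC.norm_urr hr ht'
  have hB0 : 0 ≤ B := (abs_nonneg _).trans (hB _ h1)
  have hm : 0 ≤ m := (abs_nonneg _).trans ha
  have hΔ := hu.norm_u_sub_le_abs hC hr ht ht'
  have h4 : ‖u r t'‖ ^ 2 ≤ C ^ 2 := pow_le_pow_left₀ (norm_nonneg _) h1' 2
  have h5 : ‖ur u r t'‖ ^ 2 ≤ C ^ 2 := pow_le_pow_left₀ (norm_nonneg _) h2' 2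
  set Δ := |t' - t| with hΔd
  have hΔ0 : 0 ≤ Δ := abs_nonneg _
  have e1 : |(a r t' - a r t) * (‖ur u r t'‖ ^ 2 / 2 + V (u r t'))| ≤
      m * Δ * (C ^ 2 / 2 + B) := by
    rw [abs_mul]
    refine mul_le_mul hal ((abs_add_le _ _).trans ?_) (abs_nonneg _) (by positivity)
    rw [abs_of_nonneg (by positivity : 0 ≤ ‖ur u r t'‖ ^ 2 / 2)]
    linarith [hB _ h1']
  have e2 : |(b r t' - b r t) * (‖u r t'‖ ^ 2 / 2)| ≤ m * Δ * (C ^ 2 / 2) := by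
    rw [abs_mul]
    refine mul_le_mul hbl ?_ (abs_nonneg _) (by positivity)
    rw [abs_of_nonneg (by positivity)]
    linarith
  have e3 : |a r t * (V (u r t') - V (u r t))| ≤ m * (B * (C * Δ)) := by
    rw [abs_mul]
    exact mul_le_mul ha ((hBl _ _ h1' h1).trans (mul_le_mul_of_nonneg_left hΔ hB0))
      (abs_nonneg _) hm
  have e4 : |b r t / 2 * (‖u r t'‖ ^ 2 - ‖u r t‖ ^ 2)| ≤ m / 2 * (C * Δ * (2 * C)) := by
    rw [abs_mul]
    refine mul_le_mul ?_ ?_ (abs_nonneg _) (by positivity)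
    · rw [abs_div, abs_two]; linarith
    · rw [sq_sub_sq, mul_comm, abs_mul]
      refine mul_le_mul ((abs_norm_sub_norm_le _ _).trans hΔ) ?_ (abs_nonneg _) (by positivity)
      rw [abs_of_nonneg (by positivity)]
      linarith
  have e5 : |1 / 2 * ⟪u r t' - u r t,
      ar r • (ur u r t' + ur u r t) + a r t • (urr u r t' + urr u r t)⟫| ≤
      1 / 2 * (C * Δ * (m * (2 * C) + m * (2 * C))) := by
    rw [abs_mul, abs_of_pos (by norm_num : (0 : ℝ) < 1 / 2)]
    refine mul_le_mul_of_nonneg_left ((abs_real_inner_le_norm _ _).trans ?_) (by norm_num)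
    refine mul_le_mul hΔ ((norm_add_le _ _).trans ?_) (norm_nonneg _) (by positivity)
    rw [norm_smul, norm_smul]
    exact add_le_add
      (mul_le_mul har ((norm_add_le _ _).trans (by linarith)) (norm_nonneg _) hm)
      (mul_le_mul ha ((norm_add_le _ _).trans (by linarith)) (norm_nonneg _) hm)
  unfold enIncrement
  refine (abs_sub _ _).trans ((add_le_add ((abs_add_le _ _).trans (add_le_add ((abs_add_le _ _).trans
    (add_le_add ((abs_add_le _ _).trans (add_le_add e1 e2)) e3)) e4)) e5).trans (le_of_eq ?_))
  ring

/-- The increment of the energy between two times. -/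
lemma integral_enDensity_sub (hV : ContDiff ℝ 2 V) (hu : IsRadialSolution d V u)
    (hC : SolBound u C) (hκ : 0 < κ) {t' : ℝ} (ht : 0 < t) (ht' : 0 < t')
    {a b : ℝ → ℝ → ℝ} {ar at' bt : ℝ → ℝ} (ha : TimeWeight κ M t a at')
    (hb : TimeWeight κ M t b bt) (har : ∀ r, HasDerivAt (fun r => a r t) (ar r) r)
    (harc : Continuous ar) (harb : ∀ r, 0 ≤ r → |ar r| ≤ M * Real.exp (-κ * r))
    (hal : ∀ r, 0 ≤ r → |a r t' - a r t| ≤ M * Real.exp (-κ * r) * |t' - t|)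
    (hbl : ∀ r, 0 ≤ r → |b r t' - b r t| ≤ M * Real.exp (-κ * r) * |t' - t|) :
    (∫ r in Ioi (0 : ℝ), enDensity V u a b r t') - (∫ r in Ioi (0 : ℝ), enDensity V u a b r t) =
      ∫ r in Ioi (0 : ℝ), enIncrement V u a b ar t r t' := by
  obtain ⟨B, hB0, hB, hBl⟩ := exists_potential_bound hV C
  have hBV : ∀ x : Euc n, ‖x‖ ≤ C → |V x| ≤ B := fun x hx => (hB x hx).1
  have hC0 := hC.nonneg
  have hM : 0 ≤ M := by
    have := (abs_nonneg _).trans (ha.bound 0 le_rfl)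
    simpa using this
  have i1 : IntegrableOn (fun r => enDensity V u a b r t) (Ioi 0) :=
    integrableOn_of_exp_bound (M := M * (C ^ 2 + B)) hκ
      (continuous_enDensity hV hu ht (ha.cont t) (hb.cont t)).continuousOn
      (fun r hr => (abs_enDensity_le hC hBV ht hr.le (ha.bound r hr.le) (hb.bound r hr.le)).trans
        (le_of_eq (by ring)))
  have i2 : IntegrableOn (fun r => enDensity V u a b r t') (Ioi 0) := by
    refine integrableOn_of_exp_bound (M := M * (1 + |t' - t|) * (C ^ 2 + B)) hκ
      (continuous_enDensity hV hu ht' (ha.cont t') (hb.cont t')).continuousOn (fun r hr => ?_)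
    have hw : ∀ w : ℝ → ℝ → ℝ, |w r t| ≤ M * Real.exp (-κ * r) →
        |w r t' - w r t| ≤ M * Real.exp (-κ * r) * |t' - t| →
        |w r t'| ≤ M * (1 + |t' - t|) * Real.exp (-κ * r) := fun w h1 h2 => by
      have h3 := abs_add_le (w r t' - w r t) (w r t)
      rw [sub_add_cancel] at h3
      linarith
    refine (abs_enDensity_le hC hBV ht' hr.le (hw a (ha.bound r hr.le) (hal r hr.le))
      (hw b (hb.bound r hr.le) (hbl r hr.le))).trans (le_of_eq (by ring))
  have i3 : IntegrableOn (fun r => enIncrement V u a b ar t r t') (Ioi 0) :=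
    integrableOn_of_exp_bound (M := M * (4 * C ^ 2 + B + B * C) * |t' - t|) hκ
      (continuous_enIncrement hV hu ht ht' ha.cont hb.cont harc).continuousOn
      (fun r hr => (abs_enIncrement_le hu hC hBV hBl ht ht' hr.le (ha.bound r hr.le)
        (hb.bound r hr.le) (harb r hr.le) (hal r hr.le) (hbl r hr.le)).trans (le_of_eq (by ring)))
  set Y : ℝ → ℝ := fun r => 1 / 2 * (a r t * ⟪u r t' - u r t, ur u r t' + ur u r t⟫) with hY
  set Y' : ℝ → ℝ := fun r => 1 / 2 * (ar r * ⟪u r t' - u r t, ur u r t' + ur u r t⟫ +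
    a r t * (⟪u r t' - u r t, urr u r t' + urr u r t⟫ +
      ⟪ur u r t' - ur u r t, ur u r t' + ur u r t⟫)) with hY'
  have hYd : ∀ r, HasDerivAt Y (Y' r) r := fun r =>
    (((har r).mul (((hu.hasDerivAt_r ht' r).sub (hu.hasDerivAt_r ht r)).inner ℝ
      ((hu.hasDerivAt_rr ht' r).add (hu.hasDerivAt_rr ht r)))).const_mul (1 / 2))
  have hid : ∀ r, enDensity V u a b r t' - enDensity V u a b r t -
      enIncrement V u a b ar t r t' = Y' r := fun r => by
    simp only [enDensity, enIncrement, hY', inner_add_right, inner_smul_right, inner_sub_left,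
      real_inner_self_eq_norm_sq]
    rw [real_inner_comm (ur u r t') (ur u r t)]
    ring
  have hYb : ∀ r > 0, |Y r| ≤ M * (2 * C ^ 2) * Real.exp (-κ * r) := fun r hr => by
    simp only [hY]
    rw [abs_mul, abs_mul, abs_of_pos (by norm_num : (0 : ℝ) < 1 / 2)]
    have h1 := hC.norm_u hr.le ht
    have h1' := hC.norm_u hr.le ht'
    have h2 := hC.norm_ur hr.le ht
    have h2' := hC.norm_ur hr.le ht'
    have h3 : |⟪u r t' - u r t, ur u r t' + ur u r t⟫| ≤ (2 * C) * (2 * C) :=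
      (abs_real_inner_le_norm _ _).trans (mul_le_mul ((norm_sub_le _ _).trans (by linarith))
        ((norm_add_le _ _).trans (by linarith)) (norm_nonneg _) (by positivity))
    have h4 := mul_le_mul (ha.bound r hr.le) h3 (abs_nonneg _) (by positivity)
    linarith
  have hYi : IntegrableOn Y' (Ioi 0) := by
    have : Y' = fun r => enDensity V u a b r t' - enDensity V u a b r t -
      enIncrement V u a b ar t r t' := funext fun r => (hid r).symm
    rw [this]
    exact (i2.sub i1).sub i3
  have h0 : Tendsto (fun r : ℝ => M * (2 * C ^ 2) * Real.exp (-κ * r)) atTop (𝓝 0) := by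
    have := (Real.tendsto_exp_neg_atTop_nhds_zero.comp
      (tendsto_id.const_mul_atTop hκ)).const_mul (M * (2 * C ^ 2))
    simpa [Function.comp_def] using this
  have hlim : Tendsto Y atTop (𝓝 0) :=
    squeeze_zero_norm' ((eventually_gt_atTop 0).mono fun r hr => hYb r hr) h0
  have hzero := integral_Ioi_of_hasDerivAt_of_tendsto (a := 0)
    (hYd 0).continuousAt.continuousWithinAt (fun r _ => hYd r) hYi hlim
  have hY0 : Y 0 = 0 := by simp [hY, hu.neumann t ht, hu.neumann t' ht']
  rw [hY0, sub_zero] at hzero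
  have hInt := (integral_congr_ae (Eventually.of_forall hid)).trans hzero
  have i21 : IntegrableOn (fun r => enDensity V u a b r t' - enDensity V u a b r t) (Ioi 0) :=
    i2.sub i1
  rw [integral_sub i21 i3, integral_sub i2 i1] at hInt
  linarith

lemma tendsto_enIncrement (hV : ContDiff ℝ 2 V) (hu : IsRadialSolution d V u)
    (hC : SolBound u C) (ht : 0 < t) {a b : ℝ → ℝ → ℝ} {ar at' bt : ℝ → ℝ} {r : ℝ} (hr : 0 < r)
    (ha : HasDerivAt (a r) (at' r) t) (hb : HasDerivAt (b r) (bt r) t) :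
    Tendsto (fun t' => (t' - t)⁻¹ * enIncrement V u a b ar t r t') (𝓝[≠] t)
      (𝓝 (enDeriv V u a b ar at' bt t r)) := by
  have hut := hu.hasDerivAt_t ht r
  have s1 := hasDerivAt_iff_tendsto_slope.1 ha
  have s2 := hasDerivAt_iff_tendsto_slope.1 hb
  have s3 := hasDerivAt_iff_tendsto_slope.1 (hasDerivAt_comp_potential hV hut)
  have s4 := hasDerivAt_iff_tendsto_slope.1 hut.norm_sq
  have s5 := hasDerivAt_iff_tendsto_slope.1 hut
  have c1 : Tendsto (fun s => u r s) (𝓝[≠] t) (𝓝 (u r t)) :=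
    hut.continuousAt.tendsto.mono_left nhdsWithin_le_nhds
  have c2 : Tendsto (fun s => ur u r s) (𝓝[≠] t) (𝓝 (ur u r t)) :=
    (hu.continuousAt_ur_time hC hr.le ht).tendsto.mono_left nhdsWithin_le_nhds
  have c3 : Tendsto (fun s => urr u r s) (𝓝[≠] t) (𝓝 (urr u r t)) :=
    (hu.continuousAt_urr_time hV hC hr ht).tendsto.mono_left nhdsWithin_le_nhds
  have c4 : Tendsto (fun s => V (u r s)) (𝓝[≠] t) (𝓝 (V (u r t))) :=
    (hV.continuous.tendsto _).comp c1
  have h := ((((s1.mul (((c2.norm.pow 2).div_const 2).add c4)).add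
    (s2.mul ((c1.norm.pow 2).div_const 2))).add (s3.const_mul (a r t))).add
    (s4.const_mul (b r t / 2))).sub ((s5.inner (((c2.add_const (ur u r t)).const_smul (ar r)).add
      ((c3.add_const (urr u r t)).const_smul (a r t)))).const_mul (1 / 2))
  refine (h.congr' ?_).trans (le_of_eq ?_)
  · filter_upwards with t'
    simp only [slope_def_field, slope_def_module, enIncrement, inner_smul_left]
    simp only [div_eq_inv_mul, RCLike.conj_to_real]
    ring
  · congr 1
    simp only [enDeriv, inner_add_right, inner_smul_right]
    ring

/-- The time derivative of the weighted energy. -/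
lemma hasDerivAt_energy (hV : ContDiff ℝ 2 V) (hu : IsRadialSolution d V u)
    (hC : SolBound u C) (hκ : 0 < κ) (ht : 0 < t)
    {a b : ℝ → ℝ → ℝ} {ar at' bt : ℝ → ℝ} (ha : TimeWeight κ M t a at')
    (hb : TimeWeight κ M t b bt) (har : ∀ r, HasDerivAt (fun r => a r t) (ar r) r)
    (harc : Continuous ar) (harb : ∀ r, 0 ≤ r → |ar r| ≤ M * Real.exp (-κ * r)) :
    HasDerivAt (fun t => ∫ r in Ioi (0 : ℝ), enDensity V u a b r t)
      (∫ r in Ioi (0 : ℝ), enDeriv V u a b ar at' bt t r) t := by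
  obtain ⟨B, hB0, hB, hBl⟩ := exists_potential_bound hV C
  have hBV : ∀ x : Euc n, ‖x‖ ≤ C → |V x| ≤ B := fun x hx => (hB x hx).1
  have hev : ∀ᶠ t' in 𝓝[≠] t, 0 < t' ∧ t' ≠ t ∧
      (∀ r, 0 ≤ r → |a r t' - a r t| ≤ M * Real.exp (-κ * r) * |t' - t|) ∧
      ∀ r, 0 ≤ r → |b r t' - b r t| ≤ M * Real.exp (-κ * r) * |t' - t| := by
    filter_upwards [nhdsWithin_le_nhds (Ioi_mem_nhds ht), self_mem_nhdsWithin,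
      nhdsWithin_le_nhds ha.lip, nhdsWithin_le_nhds hb.lip] with t' h1 h2 h3 h4
    exact ⟨h1, h2, h3, h4⟩
  rw [hasDerivAt_iff_tendsto_slope]
  have hDCT : Tendsto (fun t' => ∫ r in Ioi (0 : ℝ), (t' - t)⁻¹ * enIncrement V u a b ar t r t')
      (𝓝[≠] t) (𝓝 (∫ r in Ioi (0 : ℝ), enDeriv V u a b ar at' bt t r)) := by
    refine tendsto_integral_filter_of_dominated_convergence
      (fun r => M * (4 * C ^ 2 + B + B * C) * Real.exp (-κ * r)) ?_ ?_
      ((exp_neg_integrableOn_Ioi 0 hκ).const_mul _) ?_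
    · filter_upwards [hev] with t' h
      exact ((continuous_enIncrement hV hu ht h.1 ha.cont hb.cont harc).const_mul
        _).aestronglyMeasurable
    · filter_upwards [hev] with t' h
      refine (ae_restrict_iff' measurableSet_Ioi).2 (Eventually.of_forall fun r hr => ?_)
      have hr' : 0 ≤ r := (mem_Ioi.1 hr).le
      have h1 := abs_enIncrement_le hu hC hBV hBl ht h.1 hr' (ha.bound r hr') (hb.bound r hr')
        (harb r hr') (h.2.2.1 r hr') (h.2.2.2 r hr')
      have h2 : 0 < |t' - t| := abs_pos.2 (sub_ne_zero.2 h.2.1)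
      rw [norm_mul, norm_inv, Real.norm_eq_abs, Real.norm_eq_abs, inv_mul_le_iff₀ h2]
      linarith
    · refine (ae_restrict_iff' measurableSet_Ioi).2 (Eventually.of_forall fun r hr => ?_)
      exact tendsto_enIncrement hV hu hC ht hr (ha.deriv r) (hb.deriv r)
  refine hDCT.congr' ?_
  filter_upwards [hev] with t' h
  rw [slope_def_field, integral_enDensity_sub hV hu hC hκ ht h.1 ha hb har harc harb h.2.2.1 h.2.2.2,
    integral_const_mul, div_eq_inv_mul]

end EnergyDerivative

section TravellingWeight

/-- The exponential weight, travelling at speed `q` and growing in time at rate `α`. -/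
def travWeight (β α p κ q r₀ t₀ r t : ℝ) : ℝ :=
  β * Real.exp (α * (t - t₀)) * expWeight p κ (r - r₀ - q * (t - t₀))

/-- The space derivative of `travWeight`. -/
def travWeight₁ (β α p κ q r₀ t₀ r t : ℝ) : ℝ :=
  β * Real.exp (α * (t - t₀)) * expWeight₁ p κ (r - r₀ - q * (t - t₀))

/-- The second space derivative of `travWeight`. -/
def travWeight₂ (β α p κ q r₀ t₀ r t : ℝ) : ℝ :=
  β * Real.exp (α * (t - t₀)) * expWeight₂ p κ (r - r₀ - q * (t - t₀))

variable {β α p κ q r₀ t₀ r t : ℝ}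

lemma hasDerivAt_travWeight :
    HasDerivAt (fun r => travWeight β α p κ q r₀ t₀ r t) (travWeight₁ β α p κ q r₀ t₀ r t) r := by
  have h1 : HasDerivAt (fun r : ℝ => r - r₀ - q * (t - t₀)) 1 r :=
    ((hasDerivAt_id r).sub_const _).sub_const _
  simpa [travWeight, travWeight₁, Function.comp_def] using
    ((hasDerivAt_expWeight p κ _).comp r h1).const_mul (β * Real.exp (α * (t - t₀)))

lemma hasDerivAt_travWeight₁ :
    HasDerivAt (fun r => travWeight₁ β α p κ q r₀ t₀ r t) (travWeight₂ β α p κ q r₀ t₀ r t) r := by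
  have h1 : HasDerivAt (fun r : ℝ => r - r₀ - q * (t - t₀)) 1 r :=
    ((hasDerivAt_id r).sub_const _).sub_const _
  simpa [travWeight₁, travWeight₂, Function.comp_def] using
    ((hasDerivAt_expWeight₁ p κ _).comp r h1).const_mul (β * Real.exp (α * (t - t₀)))

lemma hasDerivAt_travWeight_time : HasDerivAt (fun t => travWeight β α p κ q r₀ t₀ r t)
    (α * travWeight β α p κ q r₀ t₀ r t - q * travWeight₁ β α p κ q r₀ t₀ r t) t := by
  have h1 : HasDerivAt (fun t : ℝ => t - t₀) 1 t := (hasDerivAt_id t).sub_const _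
  have h2 : HasDerivAt (fun t : ℝ => r - r₀ - q * (t - t₀)) (-(q * 1)) t :=
    (h1.const_mul q).const_sub _
  refine (((h1.const_mul α).exp.const_mul β).mul
    ((hasDerivAt_expWeight p κ _).comp t h2)).congr_deriv ?_
  simp only [travWeight, travWeight₁, Function.comp_def]
  ring

lemma continuous_travWeight₁ : Continuous fun r => travWeight₁ β α p κ q r₀ t₀ r t := by
  have := continuous_expWeight₁ p κ
  unfold travWeight₁
  fun_prop

lemma continuous_travWeight₂ : Continuous fun r => travWeight₂ β α p κ q r₀ t₀ r t := by
  have := continuous_expWeight₂ p κ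
  unfold travWeight₂
  fun_prop

lemma travWeight_nonneg (hβ : 0 ≤ β) : 0 ≤ travWeight β α p κ q r₀ t₀ r t := by
  have := expWeight_pos p κ (r - r₀ - q * (t - t₀))
  unfold travWeight
  positivity

lemma abs_travWeight₁_le (hβ : 0 ≤ β) (hp : 0 ≤ p) (hκ : 0 ≤ κ) :
    |travWeight₁ β α p κ q r₀ t₀ r t| ≤ (p + κ) * travWeight β α p κ q r₀ t₀ r t := by
  have := abs_expWeight₁_le (r - r₀ - q * (t - t₀)) hp hκ
  have h0 : 0 ≤ β * Real.exp (α * (t - t₀)) := by positivity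
  rw [travWeight₁, travWeight, abs_mul, abs_of_nonneg h0]
  nlinarith [mul_le_mul_of_nonneg_left this h0]

lemma abs_travWeight₂_le (hβ : 0 ≤ β) (hp : 0 ≤ p) (hκ : 0 ≤ κ) :
    |travWeight₂ β α p κ q r₀ t₀ r t| ≤ 3 * (p + κ) ^ 2 * travWeight β α p κ q r₀ t₀ r t := by
  have := abs_expWeight₂_le (r - r₀ - q * (t - t₀)) hp hκ
  have h0 : 0 ≤ β * Real.exp (α * (t - t₀)) := by positivity
  rw [travWeight₂, travWeight, abs_mul, abs_of_nonneg h0]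
  nlinarith [mul_le_mul_of_nonneg_left this h0]

lemma travWeight_le (hβ : 0 ≤ β) (hα : 0 ≤ α) (hκ : 0 ≤ κ) (hq : 0 ≤ q) {τ : ℝ}
    (hτ : |t - t₀| ≤ τ) : travWeight β α p κ q r₀ t₀ r t ≤
      β * Real.exp (α * τ + κ * |r₀| + κ * q * τ) * Real.exp (-κ * r) := by
  have h1 := expWeight_le_exp_right p κ (r - r₀ - q * (t - t₀))
  have h2 := (le_abs_self _).trans hτ
  unfold travWeight
  calc _ ≤ β * Real.exp (α * (t - t₀)) * Real.exp (-κ * (r - r₀ - q * (t - t₀))) := by gcongr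
    _ = β * Real.exp (α * (t - t₀) + κ * r₀ + κ * q * (t - t₀)) * Real.exp (-κ * r) := by
        rw [mul_assoc, mul_assoc, ← Real.exp_add, ← Real.exp_add]; ring_nf
    _ ≤ _ := by gcongr; exact le_abs_self _

/-- A common constant for the exponential bounds on `travWeight` and its derivatives. -/
def travBound (β α p κ q r₀ τ : ℝ) : ℝ :=
  (1 + (p + κ) + 3 * (p + κ) ^ 2 + α + q * (p + κ)) *
    (β * Real.exp (α * τ + κ * |r₀| + κ * q * τ))

lemma mul_travWeight_le (hβ : 0 ≤ β) (hα : 0 ≤ α) (hp : 0 ≤ p) (hκ : 0 ≤ κ) (hq : 0 ≤ q) {τ m : ℝ}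
    (hτ : |t - t₀| ≤ τ) (hm : m ≤ 1 + (p + κ) + 3 * (p + κ) ^ 2 + α + q * (p + κ)) :
    m * travWeight β α p κ q r₀ t₀ r t ≤ travBound β α p κ q r₀ τ * Real.exp (-κ * r) := by
  have h1 := travWeight_le (p := p) (r := r) (r₀ := r₀) hβ hα hκ hq hτ
  have h0 := travWeight_nonneg (α := α) (p := p) (κ := κ) (q := q) (r₀ := r₀) (t₀ := t₀) (r := r)
    (t := t) hβ
  rw [travBound, mul_assoc]
  exact mul_le_mul hm h1 h0 (by positivity)

lemma abs_travWeight_time_le (hβ : 0 ≤ β) (hα : 0 ≤ α) (hp : 0 ≤ p) (hκ : 0 ≤ κ) (hq : 0 ≤ q)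
    {τ : ℝ} (hτ : |t - t₀| ≤ τ) :
    |α * travWeight β α p κ q r₀ t₀ r t - q * travWeight₁ β α p κ q r₀ t₀ r t| ≤
      travBound β α p κ q r₀ τ * Real.exp (-κ * r) := by
  have h0 := travWeight_nonneg (α := α) (p := p) (κ := κ) (q := q) (r₀ := r₀) (t₀ := t₀) (r := r)
    (t := t) hβ
  have h1 := abs_travWeight₁_le (α := α) (q := q) (r₀ := r₀) (t₀ := t₀) (r := r) (t := t) hβ hp hκ
  refine le_trans ?_ (mul_travWeight_le (m := α + q * (p + κ)) hβ hα hp hκ hq hτ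
    (by nlinarith [sq_nonneg (p + κ)]))
  refine (abs_sub _ _).trans ?_
  rw [abs_mul, abs_mul, abs_of_nonneg hα, abs_of_nonneg hq, abs_of_nonneg h0]
  nlinarith [mul_le_mul_of_nonneg_left h1 hq]

lemma timeWeight_travWeight (hβ : 0 ≤ β) (hα : 0 ≤ α) (hp : 0 ≤ p) (hκ : 0 ≤ κ) (hq : 0 ≤ q)
    {M : ℝ} (hM : travBound β α p κ q r₀ (|t - t₀| + 1) ≤ M) :
    TimeWeight κ M t (travWeight β α p κ q r₀ t₀)
      (fun r => α * travWeight β α p κ q r₀ t₀ r t - q * travWeight₁ β α p κ q r₀ t₀ r t) where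
  cont t' := continuous_iff_continuousAt.2 fun r => hasDerivAt_travWeight.continuousAt
  deriv r := hasDerivAt_travWeight_time
  bound r _ := by
    rw [abs_of_nonneg (travWeight_nonneg hβ)]
    have := mul_travWeight_le (t := t) (t₀ := t₀) (r := r) (r₀ := r₀) (m := 1) hβ hα hp hκ hq
      (show |t - t₀| ≤ |t - t₀| + 1 by linarith)
      (by nlinarith [sq_nonneg (p + κ), mul_nonneg hq hp, mul_nonneg hq hκ])
    rw [one_mul] at this
    exact this.trans (by gcongr)
  lip := by
    filter_upwards [Metric.closedBall_mem_nhds t one_pos] with t' ht' r _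
    refine Convex.norm_image_sub_le_of_norm_hasDerivWithin_le (s := Metric.closedBall t 1)
      (fun s _ => hasDerivAt_travWeight_time.hasDerivWithinAt) (fun s hs => ?_)
      (convex_closedBall _ _) (Metric.mem_closedBall_self zero_le_one) ht'
    have hs' : |s - t₀| ≤ |t - t₀| + 1 := by
      have h1 := abs_add_le (s - t) (t - t₀)
      rw [sub_add_sub_cancel] at h1
      rw [Metric.mem_closedBall, Real.dist_eq] at hs
      linarith
    exact (abs_travWeight_time_le hβ hα hp hκ hq hs').trans (by gcongr)

end TravellingWeight

section PointwiseDissipation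

variable {E : Type*} [NormedAddCommGroup E] [InnerProductSpace ℝ E]

lemma mul_inner_le {χ ψ μ q : ℝ} {p D : E} (hχ : 0 < χ) (hμ0 : 0 ≤ μ)
    (hμ2 : μ ^ 2 ≤ 2 * q ^ 2 * ψ * χ) :
    μ * ⟪p, D⟫ ≤ 1 / 2 * χ * ‖D‖ ^ 2 + q ^ 2 * ψ * ‖p‖ ^ 2 := by
  have h1 : μ * ⟪p, D⟫ ≤ μ * (‖p‖ * ‖D‖) := by gcongr; exact real_inner_le_norm _ _
  refine h1.trans ?_
  have h2 : 0 ≤ (χ * ‖D‖ - μ * ‖p‖) ^ 2 := sq_nonneg _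
  have h3 := mul_le_mul_of_nonneg_right hμ2 (sq_nonneg ‖p‖)
  have h4 : χ * (μ * (‖p‖ * ‖D‖)) ≤ χ * (1 / 2 * χ * ‖D‖ ^ 2 + q ^ 2 * ψ * ‖p‖ ^ 2) := by
    linarith
  exact le_of_mul_le_mul_left h4 hχ

lemma reaction_le {ψ q κ β C CV l I : ℝ} {x g : E} (hκ : 0 ≤ κ) (hq : 0 ≤ q) (hψ : 0 ≤ ψ)
    (hβ : 0 ≤ β) (hCV : 0 ≤ CV) (hx : ‖x‖ ≤ C) (hβl : 2 * κ * q * CV ≤ β * (l / 4))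
    (hκl : κ * q ≤ l / 4)
    (hI : I = 0 ∧ l / 2 * ‖x‖ ^ 2 ≤ ⟪x, g⟫ ∨ I = 1 ∧ ‖g‖ ≤ CV * ‖x‖) :
    2 * κ * q * CV * ψ * ‖x‖ ^ 2 - β * ψ * ⟪x, g⟫ + β * (κ * q * ψ * ‖x‖ ^ 2) ≤
      C ^ 2 * (2 * κ * q * CV + β * CV + β * κ * q) * (ψ * I) := by
  rcases hI with ⟨rfl, h⟩ | ⟨rfl, h⟩
  · have h1 := mul_le_mul_of_nonneg_left h (mul_nonneg hβ hψ)
    have h2 := mul_le_mul_of_nonneg_right hβl (mul_nonneg hψ (sq_nonneg ‖x‖))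
    have h3 := mul_le_mul_of_nonneg_right hκl (mul_nonneg hβ (mul_nonneg hψ (sq_nonneg ‖x‖)))
    linarith
  · have h1 : -⟪x, g⟫ ≤ CV * ‖x‖ ^ 2 := by
      have h4 := neg_le_of_abs_le (abs_real_inner_le_norm x g)
      linarith [mul_le_mul_of_nonneg_left h (norm_nonneg x)]
    have h2 := mul_le_mul_of_nonneg_left h1 (mul_nonneg hβ hψ)
    have hx2 : ‖x‖ ^ 2 ≤ C ^ 2 := pow_le_pow_left₀ (norm_nonneg _) hx 2
    have h3 := mul_le_mul_of_nonneg_left hx2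
      (by positivity : 0 ≤ (2 * κ * q * CV + β * CV + β * κ * q) * ψ)
    linarith

/-- The pointwise dissipation estimate, in terms of the values `χ`, `χ₁` and `ψ`, `ψ₁`, `ψ₂` of the
weights and of their derivatives, of the solution `x`, of its derivatives `p` (in space) and `v`
(in time), of the potential `W` and of its gradient `g`, and of the curvature term `k`. -/
lemma dissipation_le {χ χ₁ ψ ψ₁ ψ₂ c κ β W : ℝ} {x p v g k : E}
    (hc : 0 ≤ c) (hκ : 0 ≤ κ) (hχ : 0 < χ) (hψ : 0 ≤ ψ)
    (hψχ : ψ ≤ 2 * χ) (hμ0 : 0 ≤ c * χ - χ₁) (hμ : c * χ - χ₁ ≤ 2 * (c + κ) * ψ)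
    (hμ2 : (c * χ - χ₁) ^ 2 ≤ 2 * (c + κ) ^ 2 * ψ * χ)
    (hψ2 : ψ₂ - c * ψ₁ ≤ κ * (c + κ) * ψ) (hψ1 : c * ψ - ψ₁ ≤ (c + κ) * ψ)
    (hβ : (c + κ) ^ 2 + κ * (c + κ) ≤ β) {C CV l I : ℝ} (hC : 0 ≤ C) (hCV : 0 ≤ CV) (hx : ‖x‖ ≤ C) (hp : ‖p‖ ≤ C)
    (hv : ‖v‖ ≤ C) (hW : |W| ≤ CV * ‖x‖ ^ 2) (hβl : 2 * κ * (c + κ) * CV ≤ β * (l / 4))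
    (hκl : κ * (c + κ) ≤ l / 4)
    (hI : I = 0 ∧ l / 2 * ‖x‖ ^ 2 ≤ ⟪x, g⟫ ∨ I = 1 ∧ ‖g‖ ≤ CV * ‖x‖) :
    -χ * ‖v + c • p‖ ^ 2 + (c * χ - χ₁) * ⟪p, v + c • p⟫ +
        κ * (c * χ - χ₁) * (‖p‖ ^ 2 / 2 + W) + χ * ⟪k, v + c • p⟫ +
        β * (-ψ * ‖p‖ ^ 2 - ψ * ⟪x, g⟫ + (ψ₂ + c * κ * ψ - (c + κ) * ψ₁) * (‖x‖ ^ 2 / 2) +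
          ψ * ⟪x, k⟫) ≤
      -(1 / 2) * χ * ‖v + c • p‖ ^ 2 + C ^ 2 * (2 * κ * (c + κ) * CV + β * CV + β * κ * (c + κ)) *
        (ψ * I) + ((1 + c) * C + 2 * β * C) * (χ * ‖k‖) := by
  set q := c + κ with hq
  have hq0 : 0 ≤ q := by positivity
  have hβ0 : 0 ≤ β := le_trans (by positivity) hβ
  set D := v + c • p with hD
  set μ := c * χ - χ₁ with hμd
  have hDn : ‖D‖ ≤ (1 + c) * C := by
    refine (norm_add_le _ _).trans ?_
    rw [norm_smul, Real.norm_of_nonneg hc]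
    nlinarith
  have e1 : μ * ⟪p, D⟫ ≤ 1 / 2 * χ * ‖D‖ ^ 2 + q ^ 2 * ψ * ‖p‖ ^ 2 :=
    mul_inner_le hχ hμ0 hμ2
  have e2 : κ * μ * (‖p‖ ^ 2 / 2 + W) ≤ κ * q * ψ * ‖p‖ ^ 2 +
      2 * κ * q * CV * ψ * ‖x‖ ^ 2 := by
    have h1 := mul_le_mul_of_nonneg_left hμ hκ
    have h2 := mul_le_mul_of_nonneg_right h1 (by positivity : 0 ≤ ‖p‖ ^ 2 / 2)
    have h3 : κ * μ * W ≤ κ * (2 * q * ψ) * (CV * ‖x‖ ^ 2) := by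
      refine (mul_le_mul_of_nonneg_left ((le_abs_self W).trans hW) (by positivity)).trans ?_
      exact mul_le_mul_of_nonneg_right h1 ((abs_nonneg _).trans hW)
    linarith
  have e3 : χ * ⟪k, D⟫ ≤ (1 + c) * C * (χ * ‖k‖) := by
    have h1 : ⟪k, D⟫ ≤ ‖k‖ * ((1 + c) * C) :=
      (real_inner_le_norm _ _).trans (by gcongr)
    nlinarith
  have e4 : β * (ψ * ⟪x, k⟫) ≤ 2 * β * C * (χ * ‖k‖) := by
    have h1 : ⟪x, k⟫ ≤ C * ‖k‖ := (real_inner_le_norm _ _).trans (by gcongr)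
    have h2 : ψ * ⟪x, k⟫ ≤ 2 * χ * (C * ‖k‖) :=
      (mul_le_mul_of_nonneg_left h1 hψ).trans (by gcongr)
    nlinarith
  have e5 : (ψ₂ + c * κ * ψ - q * ψ₁) * (‖x‖ ^ 2 / 2) ≤ κ * q * ψ * ‖x‖ ^ 2 := by
    have h1 : ψ₂ + c * κ * ψ - q * ψ₁ ≤ 2 * (κ * q * ψ) := by
      have := mul_le_mul_of_nonneg_left hψ1 hκ
      rw [hq] at *
      linarith
    have := mul_le_mul_of_nonneg_right h1 (by positivity : 0 ≤ ‖x‖ ^ 2 / 2)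
    linarith
  have e6 : ((q ^ 2 + κ * q) * ψ) * ‖p‖ ^ 2 ≤ β * ψ * ‖p‖ ^ 2 := by gcongr
  have e5' := mul_le_mul_of_nonneg_left e5 hβ0
  have e7 := reaction_le (q := q) hκ hq0 hψ hβ0 hCV hx hβl hκl hI
  linarith

end PointwiseDissipation

section EnergyFlux

variable {d : ℕ} {V : Euc n → ℝ} {u : ℝ → ℝ → Euc n} {C κ M t : ℝ}

lemma abs_enDeriv_le (hC : SolBound u C) {B : ℝ}
    (hB : ∀ x : Euc n, ‖x‖ ≤ C → |V x| ≤ B ∧ ‖gradient V x‖ ≤ B)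
    {a b : ℝ → ℝ → ℝ} {ar at' bt : ℝ → ℝ} {r m : ℝ} (ht : 0 < t) (hr : 0 ≤ r)
    (ha : |a r t| ≤ m) (hb : |b r t| ≤ m) (har : |ar r| ≤ m) (hat : |at' r| ≤ m)
    (hbt : |bt r| ≤ m) :
    |enDeriv V u a b ar at' bt t r| ≤ m * (4 * C ^ 2 + B + B * C) := by
  have hC0 := hC.nonneg
  have h1 := hC.norm_u hr ht
  have h2 := hC.norm_ur hr ht
  have h3 := hC.norm_urr hr ht
  have h4 := hC.norm_ut hr ht
  obtain ⟨hB1, hB2⟩ := hB _ h1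
  have hB0 : 0 ≤ B := (abs_nonneg _).trans hB1
  have hm : 0 ≤ m := (abs_nonneg _).trans ha
  have s1 : ‖u r t‖ ^ 2 ≤ C ^ 2 := pow_le_pow_left₀ (norm_nonneg _) h1 2
  have s2 : ‖ur u r t‖ ^ 2 ≤ C ^ 2 := pow_le_pow_left₀ (norm_nonneg _) h2 2
  have e1 : |at' r * (‖ur u r t‖ ^ 2 / 2 + V (u r t))| ≤ m * (C ^ 2 / 2 + B) := by
    rw [abs_mul]
    refine mul_le_mul hat ((abs_add_le _ _).trans ?_) (abs_nonneg _) hm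
    rw [abs_of_nonneg (by positivity : 0 ≤ ‖ur u r t‖ ^ 2 / 2)]
    linarith
  have e2 : |bt r * (‖u r t‖ ^ 2 / 2)| ≤ m * (C ^ 2 / 2) := by
    rw [abs_mul]
    refine mul_le_mul hbt ?_ (abs_nonneg _) hm
    rw [abs_of_nonneg (by positivity)]
    linarith
  have e3 : |a r t * ⟪gradient V (u r t), ut u r t⟫| ≤ m * (B * C) := by
    rw [abs_mul]
    exact mul_le_mul ha ((abs_real_inner_le_norm _ _).trans
      (mul_le_mul hB2 h4 (norm_nonneg _) hB0)) (abs_nonneg _) hm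
  have e4 : |b r t * ⟪u r t, ut u r t⟫| ≤ m * (C * C) := by
    rw [abs_mul]
    exact mul_le_mul hb ((abs_real_inner_le_norm _ _).trans
      (mul_le_mul h1 h4 (norm_nonneg _) hC0)) (abs_nonneg _) hm
  have e5 : |⟪ut u r t, ar r • ur u r t + a r t • urr u r t⟫| ≤ C * (m * C + m * C) := by
    refine (abs_real_inner_le_norm _ _).trans (mul_le_mul h4 ((norm_add_le _ _).trans ?_)
      (norm_nonneg _) hC0)
    rw [norm_smul, norm_smul]
    exact add_le_add (mul_le_mul har h2 (norm_nonneg _) hm) (mul_le_mul ha h3 (norm_nonneg _) hm)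
  unfold enDeriv
  refine (abs_sub _ _).trans ((add_le_add ((abs_add_le _ _).trans (add_le_add ((abs_add_le _ _).trans
    (add_le_add ((abs_add_le _ _).trans (add_le_add e1 e2)) e3)) e4)) e5).trans (le_of_eq ?_))
  ring

lemma continuousOn_enDeriv (hV : ContDiff ℝ 2 V) (hu : IsRadialSolution d V u) (ht : 0 < t)
    {a b : ℝ → ℝ → ℝ} {ar at' bt : ℝ → ℝ} (ha : Continuous fun r => a r t)
    (hb : Continuous fun r => b r t) (har : Continuous ar) (hat : Continuous at')
    (hbt : Continuous bt) : ContinuousOn (enDeriv V u a b ar at' bt t) (Ioi 0) := by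
  have h1 := hu.continuous_u ht
  have h2 := hu.continuous_ur ht
  have h3 := hV.continuous.comp h1
  have h4 := hu.cont_rr t ht
  have h5 := hu.continuousOn_ut hV ht
  have h6 := (contDiff_gradient hV).continuous.comp h1
  unfold enDeriv
  exact ((((hat.mul (((h2.norm.pow 2).div_const 2).add h3)).add
    (hbt.mul ((h1.norm.pow 2).div_const 2))).continuousOn.add
    (ha.continuousOn.mul (h6.continuousOn.inner h5))).add
    (hb.continuousOn.mul (h1.continuousOn.inner h5))).sub
    (h5.inner ((har.smul h2).add (ha.smul h4)).continuousOn)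

/-- The flux whose divergence is added to the integrand of the derivative of the energy. -/
def enFlux (V : Euc n → ℝ) (u : ℝ → ℝ → Euc n) (c : ℝ) (a b : ℝ → ℝ → ℝ) (br : ℝ → ℝ)
    (t r : ℝ) : ℝ :=
  -c * (a r t * (‖ur u r t‖ ^ 2 / 2 - V (u r t))) - b r t * ⟪u r t, ur u r t⟫ +
    br r * (‖u r t‖ ^ 2 / 2)

/-- The derivative of the flux. -/
def enFluxDeriv (V : Euc n → ℝ) (u : ℝ → ℝ → Euc n) (c : ℝ) (a b : ℝ → ℝ → ℝ) (ar brr : ℝ → ℝ)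
    (t r : ℝ) : ℝ :=
  -c * (ar r * (‖ur u r t‖ ^ 2 / 2 - V (u r t)) +
      a r t * (⟪ur u r t, urr u r t⟫ - ⟪gradient V (u r t), ur u r t⟫)) -
    b r t * (⟪u r t, urr u r t⟫ + ‖ur u r t‖ ^ 2) + brr r * (‖u r t‖ ^ 2 / 2)

lemma hasDerivAt_enFlux (hV : ContDiff ℝ 2 V) (hu : IsRadialSolution d V u) (ht : 0 < t) {c r : ℝ}
    {a b : ℝ → ℝ → ℝ} {ar br brr : ℝ → ℝ} (har : HasDerivAt (fun r => a r t) (ar r) r)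
    (hbr : HasDerivAt (fun r => b r t) (br r) r) (hbrr : HasDerivAt br (brr r) r) :
    HasDerivAt (enFlux V u c a b br t) (enFluxDeriv V u c a b ar brr t r) r := by
  have h1 := hu.hasDerivAt_r ht r
  have h2 := hu.hasDerivAt_rr ht r
  have h3 := hasDerivAt_comp_potential hV h1
  have h := ((((har.mul ((h2.norm_sq.div_const 2).sub h3)).const_mul (-c)).sub
    (hbr.mul (h1.inner ℝ h2))).add (hbrr.mul (h1.norm_sq.div_const 2)))
  refine h.congr_deriv ?_
  simp only [enFluxDeriv, real_inner_self_eq_norm_sq, Pi.sub_apply]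
  ring

lemma abs_enFlux_le (hC : SolBound u C) {B c : ℝ} (hc : 0 ≤ c)
    (hB : ∀ x : Euc n, ‖x‖ ≤ C → |V x| ≤ B)
    {a b : ℝ → ℝ → ℝ} {br : ℝ → ℝ} {r m : ℝ} (ht : 0 < t) (hr : 0 ≤ r)
    (ha : |a r t| ≤ m) (hb : |b r t| ≤ m) (hbr : |br r| ≤ m) :
    |enFlux V u c a b br t r| ≤ m * (c * (C ^ 2 + B) + 2 * C ^ 2) := by
  have hC0 := hC.nonneg
  have h1 := hC.norm_u hr ht
  have h2 := hC.norm_ur hr ht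
  have hB1 := hB _ h1
  have hm : 0 ≤ m := (abs_nonneg _).trans ha
  have s1 : ‖u r t‖ ^ 2 ≤ C ^ 2 := pow_le_pow_left₀ (norm_nonneg _) h1 2
  have s2 : ‖ur u r t‖ ^ 2 ≤ C ^ 2 := pow_le_pow_left₀ (norm_nonneg _) h2 2
  have e1 : |-c * (a r t * (‖ur u r t‖ ^ 2 / 2 - V (u r t)))| ≤ c * (m * (C ^ 2 + B)) := by
    rw [abs_mul, abs_neg, abs_of_nonneg hc, abs_mul]
    refine mul_le_mul_of_nonneg_left (mul_le_mul ha ((abs_sub _ _).trans ?_) (abs_nonneg _) hm) hc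
    rw [abs_of_nonneg (by positivity : 0 ≤ ‖ur u r t‖ ^ 2 / 2)]
    linarith [sq_nonneg C]
  have e2 : |b r t * ⟪u r t, ur u r t⟫| ≤ m * (C * C) := by
    rw [abs_mul]
    exact mul_le_mul hb ((abs_real_inner_le_norm _ _).trans
      (mul_le_mul h1 h2 (norm_nonneg _) hC0)) (abs_nonneg _) hm
  have e3 : |br r * (‖u r t‖ ^ 2 / 2)| ≤ m * C ^ 2 := by
    rw [abs_mul]
    refine mul_le_mul hbr ?_ (abs_nonneg _) hm
    rw [abs_of_nonneg (by positivity)]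
    linarith [sq_nonneg C]
  unfold enFlux
  refine (abs_add_le _ _).trans ((add_le_add ((abs_sub _ _).trans (add_le_add e1 e2)) e3).trans
    (le_of_eq ?_))
  ring

lemma abs_enFluxDeriv_le (hC : SolBound u C) {B c : ℝ} (hc : 0 ≤ c)
    (hB : ∀ x : Euc n, ‖x‖ ≤ C → |V x| ≤ B ∧ ‖gradient V x‖ ≤ B)
    {a b : ℝ → ℝ → ℝ} {ar brr : ℝ → ℝ} {r m : ℝ} (ht : 0 < t) (hr : 0 ≤ r)
    (ha : |a r t| ≤ m) (hb : |b r t| ≤ m) (har : |ar r| ≤ m) (hbrr : |brr r| ≤ m) :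
    |enFluxDeriv V u c a b ar brr t r| ≤ m * (c * (2 * C ^ 2 + B + B * C) + 3 * C ^ 2) := by
  have hC0 := hC.nonneg
  have h1 := hC.norm_u hr ht
  have h2 := hC.norm_ur hr ht
  have h3 := hC.norm_urr hr ht
  obtain ⟨hB1, hB2⟩ := hB _ h1
  have hB0 : 0 ≤ B := (abs_nonneg _).trans hB1
  have hm : 0 ≤ m := (abs_nonneg _).trans ha
  have s1 : ‖u r t‖ ^ 2 ≤ C ^ 2 := pow_le_pow_left₀ (norm_nonneg _) h1 2
  have s2 : ‖ur u r t‖ ^ 2 ≤ C ^ 2 := pow_le_pow_left₀ (norm_nonneg _) h2 2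
  have i1 : |⟪ur u r t, urr u r t⟫| ≤ C * C :=
    (abs_real_inner_le_norm _ _).trans (mul_le_mul h2 h3 (norm_nonneg _) hC0)
  have i2 : |⟪gradient V (u r t), ur u r t⟫| ≤ B * C :=
    (abs_real_inner_le_norm _ _).trans (mul_le_mul hB2 h2 (norm_nonneg _) hB0)
  have i3 : |⟪u r t, urr u r t⟫| ≤ C * C :=
    (abs_real_inner_le_norm _ _).trans (mul_le_mul h1 h3 (norm_nonneg _) hC0)
  have e1 : |ar r * (‖ur u r t‖ ^ 2 / 2 - V (u r t))| ≤ m * (C ^ 2 + B) := by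
    rw [abs_mul]
    refine mul_le_mul har ((abs_sub _ _).trans ?_) (abs_nonneg _) hm
    rw [abs_of_nonneg (by positivity : 0 ≤ ‖ur u r t‖ ^ 2 / 2)]
    linarith [sq_nonneg C]
  have e2 : |a r t * (⟪ur u r t, urr u r t⟫ - ⟪gradient V (u r t), ur u r t⟫)| ≤
      m * (C * C + B * C) := by
    rw [abs_mul]
    exact mul_le_mul ha ((abs_sub _ _).trans (add_le_add i1 i2)) (abs_nonneg _) hm
  have e3 : |b r t * (⟪u r t, urr u r t⟫ + ‖ur u r t‖ ^ 2)| ≤ m * (C * C + C ^ 2) := by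
    rw [abs_mul]
    refine mul_le_mul hb ((abs_add_le _ _).trans (add_le_add i3 ?_)) (abs_nonneg _) hm
    rwa [abs_of_nonneg (by positivity)]
  have e4 : |brr r * (‖u r t‖ ^ 2 / 2)| ≤ m * C ^ 2 := by
    rw [abs_mul]
    refine mul_le_mul hbrr ?_ (abs_nonneg _) hm
    rw [abs_of_nonneg (by positivity)]
    linarith [sq_nonneg C]
  have e5 : |-c * (ar r * (‖ur u r t‖ ^ 2 / 2 - V (u r t)) +
      a r t * (⟪ur u r t, urr u r t⟫ - ⟪gradient V (u r t), ur u r t⟫))| ≤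
      c * (m * (C ^ 2 + B) + m * (C * C + B * C)) := by
    rw [abs_mul, abs_neg, abs_of_nonneg hc]
    exact mul_le_mul_of_nonneg_left ((abs_add_le _ _).trans (add_le_add e1 e2)) hc
  unfold enFluxDeriv
  refine (abs_add_le _ _).trans ((add_le_add ((abs_sub _ _).trans (add_le_add e5 e3)) e4).trans
    (le_of_eq ?_))
  ring

lemma continuous_enFluxDeriv (hV : ContDiff ℝ 2 V) (hu : IsRadialSolution d V u) (ht : 0 < t)
    {c : ℝ} {a b : ℝ → ℝ → ℝ} {ar brr : ℝ → ℝ} (ha : Continuous fun r => a r t)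
    (hb : Continuous fun r => b r t) (har : Continuous ar) (hbrr : Continuous brr) :
    Continuous (enFluxDeriv V u c a b ar brr t) := by
  have h1 := hu.continuous_u ht
  have h2 := hu.continuous_ur ht
  have h3 := hV.continuous.comp h1
  have h4 := hu.cont_rr t ht
  have h6 := (contDiff_gradient hV).continuous.comp h1
  unfold enFluxDeriv
  exact ((continuous_const.mul ((har.mul (((h2.norm.pow 2).div_const 2).sub h3)).add
    (ha.mul ((h2.inner h4).sub (h6.inner h2))))).sub
    (hb.mul ((h1.inner h4).add (h2.norm.pow 2)))).add (hbrr.mul ((h1.norm.pow 2).div_const 2))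

/-- The time derivative of the energy, after addition of the divergence of the flux. -/
lemma integral_enDeriv_eq (hV : ContDiff ℝ 2 V) (hu : IsRadialSolution d V u)
    (hC : SolBound u C) (hκ : 0 < κ) (ht : 0 < t) {c : ℝ} (hc : 0 ≤ c)
    {a b : ℝ → ℝ → ℝ} {ar at' br brr bt : ℝ → ℝ} (ha : TimeWeight κ M t a at')
    (hb : TimeWeight κ M t b bt) (hat : Continuous at') (hbt : Continuous bt)
    (hatb : ∀ r, 0 ≤ r → |at' r| ≤ M * Real.exp (-κ * r))
    (hbtb : ∀ r, 0 ≤ r → |bt r| ≤ M * Real.exp (-κ * r))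
    (har : ∀ r, HasDerivAt (fun r => a r t) (ar r) r)
    (harc : Continuous ar) (harb : ∀ r, 0 ≤ r → |ar r| ≤ M * Real.exp (-κ * r))
    (hbr : ∀ r, HasDerivAt (fun r => b r t) (br r) r) (hbrr : ∀ r, HasDerivAt br (brr r) r)
    (hbrb : ∀ r, 0 ≤ r → |br r| ≤ M * Real.exp (-κ * r)) (hbrrc : Continuous brr)
    (hbrrb : ∀ r, 0 ≤ r → |brr r| ≤ M * Real.exp (-κ * r)) :
    IntegrableOn (fun r => enDeriv V u a b ar at' bt t r + enFluxDeriv V u c a b ar brr t r) (Ioi 0) ∧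
    ∫ r in Ioi (0 : ℝ), enDeriv V u a b ar at' bt t r =
      (∫ r in Ioi (0 : ℝ), (enDeriv V u a b ar at' bt t r + enFluxDeriv V u c a b ar brr t r)) +
        (c * (a 0 t * V (u 0 t)) + br 0 * (‖u 0 t‖ ^ 2 / 2)) := by
  obtain ⟨B, hB0, hB, -⟩ := exists_potential_bound hV C
  have hBV : ∀ x : Euc n, ‖x‖ ≤ C → |V x| ≤ B := fun x hx => (hB x hx).1
  have i1 : IntegrableOn (enDeriv V u a b ar at' bt t) (Ioi 0) :=
    integrableOn_of_exp_bound (M := M * (4 * C ^ 2 + B + B * C)) hκ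
      (continuousOn_enDeriv hV hu ht (ha.cont t) (hb.cont t) harc hat hbt)
      fun r hr => (abs_enDeriv_le hC hB ht hr.le (ha.bound r hr.le) (hb.bound r hr.le)
        (harb r hr.le) (hatb r hr.le) (hbtb r hr.le)).trans (le_of_eq (by ring))
  have hfb : ∀ r > 0, |enFluxDeriv V u c a b ar brr t r| ≤
      M * (c * (2 * C ^ 2 + B + B * C) + 3 * C ^ 2) * Real.exp (-κ * r) := fun r hr =>
    (abs_enFluxDeriv_le hC hc hB ht hr.le (ha.bound r hr.le) (hb.bound r hr.le)
        (harb r hr.le) (hbrrb r hr.le)).trans (le_of_eq (by ring))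
  have hfc : Continuous (enFluxDeriv V u c a b ar brr t) :=
    continuous_enFluxDeriv hV hu ht (ha.cont t) (hb.cont t) harc hbrrc
  have i2 : IntegrableOn (enFluxDeriv V u c a b ar brr t) (Ioi 0) :=
    integrableOn_of_exp_bound hκ hfc.continuousOn hfb
  have hInt := integral_deriv_of_exp_bound (M := M * (c * (C ^ 2 + B) + 2 * C ^ 2)) hκ
    (fun r => hasDerivAt_enFlux (c := c) hV hu ht (har r) (hbr r) (hbrr r)) hfc
    (fun r hr => (abs_enFlux_le hC hc hBV ht hr.le (ha.bound r hr.le) (hb.bound r hr.le)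
        (hbrb r hr.le)).trans (le_of_eq (by ring))) hfb
  refine ⟨i1.add i2, ?_⟩
  rw [integral_add i1 i2, hInt]
  simp only [enFlux, hu.neumann t ht, norm_zero, inner_zero_right]
  ring

end EnergyFlux

section EnergyInequality

variable {d : ℕ} {V : Euc n → ℝ} {D : EscData n V} {u : ℝ → ℝ → Euc n}
  {C ν K cHom δ L₀ : ℝ} {rHom : ℝ → ℝ}

local notation "fEsc" => rescF V d D.lmin u δ L₀ rHom

lemma expWeight_le_exp_abs {p κ κ' : ℝ} (hp : κ' ≤ p) (hκ : κ' ≤ κ) (x : ℝ) :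
    expWeight p κ x ≤ Real.exp (-κ' * |x|) := by
  rcases le_total 0 x with h | h
  · refine (expWeight_le_exp_right p κ x).trans (Real.exp_le_exp.2 ?_)
    rw [abs_of_nonneg h]
    nlinarith
  · refine (expWeight_le_exp_left p κ x).trans (Real.exp_le_exp.2 ?_)
    rw [abs_of_nonpos h]
    nlinarith

lemma EscSetting.expWeight_le_of_escape (S : EscSetting d V D u C ν K cHom δ L₀ rHom)
    {p κ κ' x₀ r t : ℝ} (hp : κ' ≤ p) (hκ : κ' ≤ κ) (ht : 0 < t)
    (hu : D.dEsc < ‖u r t‖) :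
    expWeight p κ (r - x₀) ≤ Real.exp (p * (fEsc t - x₀)) * Real.exp (-κ' * |r - fEsc t|) +
      Real.exp (-κ * (rHom t - x₀)) * Real.exp (-κ' * |r - rHom t|) := by
  rcases le_or_gt r (fEsc t) with h | h
  · refine le_add_of_le_of_nonneg ((expWeight_le_exp_left _ _ _).trans ?_) (by positivity)
    rw [← Real.exp_add, abs_of_nonpos (by linarith)]
    exact Real.exp_le_exp.2 (by nlinarith)
  rcases le_or_gt r (rHom t) with h' | h'
  · have h1 := S.F0_le_of_esc_lt ht.le h h'
    have h2 := S.norm_le_dEsc ((S.rsc_le_esc ht.le).trans h.le) ht S.δ_eq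
      (h1.trans (by linarith [sq_nonneg δ]))
    exact absurd hu (not_lt.2 h2)
  · refine le_add_of_nonneg_of_le (by positivity) ((expWeight_le_exp_right _ _ _).trans ?_)
    rw [← Real.exp_add, abs_of_nonneg (by linarith)]
    exact Real.exp_le_exp.2 (by nlinarith)

lemma expWeight_mul_norm_curv_le (hd : 1 ≤ d) (hu : IsRadialSolution d V u) (hC : SolBound u C)
    {c κ κ' q τ r r₀ t : ℝ} (hc : κ' ≤ c) (hκ : κ' ≤ κ) (hκ' : 0 < κ') (hq : 0 ≤ q) (hτ : 0 ≤ τ)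
    (ht : 0 < t) (hr : 0 < r) (hr₀ : 0 < r₀) :
    expWeight c κ (r - r₀ - q * τ) * ‖curv d u r t‖ ≤
      2 * d * C * (Real.exp (-c * r₀ / 2) * Real.exp (-κ' * |r - r₀ / 2|) +
        1 / r₀ * Real.exp (-κ' * |r - r₀ - q * τ|)) := by
  have hC0 := hC.nonneg
  have hqτ := mul_nonneg hq hτ
  have hd0 : (0 : ℝ) < d := by exact_mod_cast hd
  rw [mul_add]
  rcases le_total r (r₀ / 2) with h | h
  · refine le_add_of_le_of_nonneg ?_ (by positivity)
    have h1 : expWeight c κ (r - r₀ - q * τ) ≤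
        Real.exp (-c * r₀ / 2) * Real.exp (-κ' * |r - r₀ / 2|) := by
      refine (expWeight_le_exp_left _ _ _).trans ?_
      rw [← Real.exp_add, abs_of_nonpos (by linarith)]
      refine Real.exp_le_exp.2 ?_
      nlinarith [mul_nonneg (hκ'.le.trans hc) hqτ]
    have h2 := hu.norm_curv_le hd hC ht hr
    calc _ ≤ (Real.exp (-c * r₀ / 2) * Real.exp (-κ' * |r - r₀ / 2|)) * (d * C) :=
          mul_le_mul h1 h2 (norm_nonneg _) (by positivity)
      _ ≤ (Real.exp (-c * r₀ / 2) * Real.exp (-κ' * |r - r₀ / 2|)) * (2 * d * C) := by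
          refine mul_le_mul_of_nonneg_left ?_ (by positivity)
          nlinarith [mul_nonneg hd0.le hC0]
      _ = _ := by ring
  · refine le_add_of_nonneg_of_le (by positivity) ?_
    have h2 : ‖curv d u r t‖ ≤ 2 * d * C / r₀ := by
      refine (SolBound.norm_curv_le_div hd hC ht hr).trans ?_
      rw [div_le_div_iff₀ hr hr₀]
      nlinarith [mul_nonneg hd0.le hC0]
    calc _ ≤ Real.exp (-κ' * |r - r₀ - q * τ|) * (2 * d * C / r₀) :=
          mul_le_mul (expWeight_le_exp_abs hc hκ _) h2 (norm_nonneg _) (by positivity)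
      _ = _ := by ring

/-- The weighted energy in a travelling frame. -/
def travEnergy (V : Euc n → ℝ) (u : ℝ → ℝ → Euc n) (β c κ r₀ t₀ t : ℝ) : ℝ :=
  ∫ r in Ioi (0 : ℝ), enDensity V u (travWeight 1 (c * κ) c κ (c + κ) r₀ t₀)
    (travWeight β (c * κ) (c + κ) κ (c + κ) r₀ t₀) r t

lemma integral_two_exp_abs_le {κ : ℝ} (hκ : 0 < κ) {a₁ a₂ ρ₁ ρ₂ : ℝ} (h₁ : 0 ≤ a₁) (h₂ : 0 ≤ a₂) :
    IntegrableOn (fun r => a₁ * Real.exp (-κ * |r - ρ₁|) + a₂ * Real.exp (-κ * |r - ρ₂|)) (Ioi 0) ∧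
    ∫ r in Ioi (0 : ℝ), (a₁ * Real.exp (-κ * |r - ρ₁|) + a₂ * Real.exp (-κ * |r - ρ₂|)) ≤
      2 / κ * (a₁ + a₂) := by
  have i1 := ((integrable_exp_abs hκ ρ₁).const_mul a₁).integrableOn (s := Ioi 0)
  have i2 := ((integrable_exp_abs hκ ρ₂).const_mul a₂).integrableOn (s := Ioi 0)
  have hle : ∀ ρ : ℝ, ∫ r in Ioi (0 : ℝ), Real.exp (-κ * |r - ρ|) ≤ 2 / κ := fun ρ => by
    simpa using setIntegral_exp_abs_le (ρ := ρ) (A := Ioi 0) hκ le_rfl fun r _ => abs_nonneg _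
  refine ⟨i1.add i2, ?_⟩
  rw [integral_add i1 i2, integral_const_mul, integral_const_mul]
  nlinarith [mul_le_mul_of_nonneg_left (hle ρ₁) h₁, mul_le_mul_of_nonneg_left (hle ρ₂) h₂]

lemma integrableOn_travDissip (hV : ContDiff ℝ 2 V) (hu : IsRadialSolution d V u)
    (hC : SolBound u C) {α p κ q r₀ t₀ t c : ℝ} (hα : 0 ≤ α) (hκ : 0 < κ) (hq : 0 ≤ q) (ht : 0 < t) :
    IntegrableOn (fun r => travWeight 1 α p κ q r₀ t₀ r t * ‖ut u r t + c • ur u r t‖ ^ 2)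
      (Ioi 0) := by
  refine integrableOn_of_exp_bound
    (M := 1 * Real.exp (α * |t - t₀| + κ * |r₀| + κ * q * |t - t₀|) * (C + |c| * C) ^ 2) hκ
    ((continuous_iff_continuousAt.2 fun r => hasDerivAt_travWeight.continuousAt).continuousOn.mul
      (hu.continuousOn_dissip hV c ht)) fun r hr => ?_
  have h0 := travWeight_nonneg (α := α) (p := p) (κ := κ) (q := q) (r₀ := r₀) (t₀ := t₀) (r := r)
    (t := t) zero_le_one
  rw [abs_of_nonneg (by positivity)]
  have h1 : ‖ut u r t + c • ur u r t‖ ≤ C + |c| * C := by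
    refine (norm_add_le _ _).trans (add_le_add (hC.norm_ut hr.le ht) ?_)
    rw [norm_smul, Real.norm_eq_abs]
    exact mul_le_mul_of_nonneg_left (hC.norm_ur hr.le ht) (abs_nonneg _)
  have h2 := travWeight_le (p := p) (r := r) (r₀ := r₀) zero_le_one hα hκ.le hq (le_refl |t - t₀|)
  calc _ ≤ 1 * Real.exp (α * |t - t₀| + κ * |r₀| + κ * q * |t - t₀|) * Real.exp (-κ * r) *
        (C + |c| * C) ^ 2 :=
        mul_le_mul h2 (pow_le_pow_left₀ (norm_nonneg _) h1 2) (by positivity) (by positivity)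
    _ = _ := by ring

lemma enDeriv_add_enFluxDeriv_eq (hu : IsRadialSolution d V u) {β c κ r₀ t₀ t r : ℝ} (ht : 0 < t)
    (hr : 0 < r) :
    enDeriv V u (travWeight 1 (c * κ) c κ (c + κ) r₀ t₀)
        (travWeight β (c * κ) (c + κ) κ (c + κ) r₀ t₀)
        (fun r => travWeight₁ 1 (c * κ) c κ (c + κ) r₀ t₀ r t)
        (fun r => c * κ * travWeight 1 (c * κ) c κ (c + κ) r₀ t₀ r t -
          (c + κ) * travWeight₁ 1 (c * κ) c κ (c + κ) r₀ t₀ r t)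
        (fun r => c * κ * travWeight β (c * κ) (c + κ) κ (c + κ) r₀ t₀ r t -
          (c + κ) * travWeight₁ β (c * κ) (c + κ) κ (c + κ) r₀ t₀ r t) t r +
      enFluxDeriv V u c (travWeight 1 (c * κ) c κ (c + κ) r₀ t₀)
        (travWeight β (c * κ) (c + κ) κ (c + κ) r₀ t₀)
        (fun r => travWeight₁ 1 (c * κ) c κ (c + κ) r₀ t₀ r t)
        (fun r => travWeight₂ β (c * κ) (c + κ) κ (c + κ) r₀ t₀ r t) t r =
    Real.exp (c * κ * (t - t₀)) *
      (-expWeight c κ (r - r₀ - (c + κ) * (t - t₀)) * ‖ut u r t + c • ur u r t‖ ^ 2 +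
        (c * expWeight c κ (r - r₀ - (c + κ) * (t - t₀)) -
          expWeight₁ c κ (r - r₀ - (c + κ) * (t - t₀))) * ⟪ur u r t, ut u r t + c • ur u r t⟫ +
        κ * (c * expWeight c κ (r - r₀ - (c + κ) * (t - t₀)) -
          expWeight₁ c κ (r - r₀ - (c + κ) * (t - t₀))) * (‖ur u r t‖ ^ 2 / 2 + V (u r t)) +
        expWeight c κ (r - r₀ - (c + κ) * (t - t₀)) * ⟪curv d u r t, ut u r t + c • ur u r t⟫ +
        β * (-expWeight (c + κ) κ (r - r₀ - (c + κ) * (t - t₀)) * ‖ur u r t‖ ^ 2 -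
          expWeight (c + κ) κ (r - r₀ - (c + κ) * (t - t₀)) * ⟪u r t, gradient V (u r t)⟫ +
          (expWeight₂ (c + κ) κ (r - r₀ - (c + κ) * (t - t₀)) +
            c * κ * expWeight (c + κ) κ (r - r₀ - (c + κ) * (t - t₀)) -
            (c + κ) * expWeight₁ (c + κ) κ (r - r₀ - (c + κ) * (t - t₀))) * (‖u r t‖ ^ 2 / 2) +
          expWeight (c + κ) κ (r - r₀ - (c + κ) * (t - t₀)) * ⟪u r t, curv d u r t⟫)) := by
  have hpde := hu.ut_eq hr ht
  have hrr : urr u r t = ut u r t + gradient V (u r t) - curv d u r t := by rw [hpde]; abel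
  have hnorm : ‖ut u r t + c • ur u r t‖ ^ 2 =
      ‖ut u r t‖ ^ 2 + 2 * (c * ⟪ut u r t, ur u r t⟫) + c ^ 2 * ‖ur u r t‖ ^ 2 := by
    rw [norm_add_sq_real, inner_smul_right, norm_smul, mul_pow, Real.norm_eq_abs, sq_abs]
  rw [hnorm]
  simp only [enDeriv, enFluxDeriv, travWeight, travWeight₁, travWeight₂, hrr, inner_add_right,
    inner_sub_right, inner_smul_right, real_inner_self_eq_norm_sq]
  rw [real_inner_comm (ut u r t) (ur u r t), real_inner_comm (ut u r t) (gradient V (u r t)),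
    real_inner_comm (ur u r t) (gradient V (u r t)), real_inner_comm (ut u r t) (curv d u r t),
    real_inner_comm (ur u r t) (curv d u r t)]
  ring

end EnergyInequality

section EnergyEstimates

variable {d : ℕ} {V : Euc n → ℝ} {D : EscData n V} {u : ℝ → ℝ → Euc n}
  {C ν K cHom δ L₀ : ℝ} {rHom : ℝ → ℝ}

local notation "fEsc" => rescF V d D.lmin u δ L₀ rHom

lemma EscSetting.travDissipation_le (S : EscSetting d V D u C ν K cHom δ L₀ rHom)
    {c κ κ' β CV r₀ t₀ t r : ℝ} (hκ' : 0 < κ') (hκ'c : κ' ≤ c) (hκ'κ : κ' ≤ κ)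
    (hκl : κ * (c + κ) ≤ D.lmin / 4) (hCV : 0 ≤ CV)
    (hgrad : ∀ x : Euc n, ‖x‖ ≤ C → ‖gradient V x‖ ≤ CV * ‖x‖)
    (hpot : ∀ x : Euc n, ‖x‖ ≤ C → |V x| ≤ CV * ‖x‖ ^ 2)
    (hβ : (c + κ) ^ 2 + κ * (c + κ) ≤ β) (hβl : 2 * κ * (c + κ) * CV ≤ β * (D.lmin / 4))
    (hr₀ : 0 < r₀) (ht₀ : 0 < t₀) (ht : t₀ ≤ t) (hr : 0 < r) :
    enDeriv V u (travWeight 1 (c * κ) c κ (c + κ) r₀ t₀)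
        (travWeight β (c * κ) (c + κ) κ (c + κ) r₀ t₀)
        (fun r => travWeight₁ 1 (c * κ) c κ (c + κ) r₀ t₀ r t)
        (fun r => c * κ * travWeight 1 (c * κ) c κ (c + κ) r₀ t₀ r t -
          (c + κ) * travWeight₁ 1 (c * κ) c κ (c + κ) r₀ t₀ r t)
        (fun r => c * κ * travWeight β (c * κ) (c + κ) κ (c + κ) r₀ t₀ r t -
          (c + κ) * travWeight₁ β (c * κ) (c + κ) κ (c + κ) r₀ t₀ r t) t r +
      enFluxDeriv V u c (travWeight 1 (c * κ) c κ (c + κ) r₀ t₀)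
        (travWeight β (c * κ) (c + κ) κ (c + κ) r₀ t₀)
        (fun r => travWeight₁ 1 (c * κ) c κ (c + κ) r₀ t₀ r t)
        (fun r => travWeight₂ β (c * κ) (c + κ) κ (c + κ) r₀ t₀ r t) t r ≤
    -(1 / 2) * (travWeight 1 (c * κ) c κ (c + κ) r₀ t₀ r t * ‖ut u r t + c • ur u r t‖ ^ 2) +
      Real.exp (c * κ * (t - t₀)) *
        (C ^ 2 * (2 * κ * (c + κ) * CV + β * CV + β * κ * (c + κ)) *
          (Real.exp ((c + κ) * (fEsc t - (r₀ + (c + κ) * (t - t₀)))) *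
              Real.exp (-κ' * |r - fEsc t|) +
            Real.exp (-κ * (rHom t - (r₀ + (c + κ) * (t - t₀)))) *
              Real.exp (-κ' * |r - rHom t|)) +
        ((1 + c) * C + 2 * β * C) * (2 * d * C) *
          (Real.exp (-c * r₀ / 2) * Real.exp (-κ' * |r - r₀ / 2|) +
            1 / r₀ * Real.exp (-κ' * |r - (r₀ + (c + κ) * (t - t₀))|))) := by
  have hc : 0 ≤ c := hκ'.le.trans hκ'c
  have hκ : 0 ≤ κ := hκ'.le.trans hκ'κ
  have hβ0 : 0 ≤ β := le_trans (by positivity) hβ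
  have htp : 0 < t := ht₀.trans_le ht
  have hC0 := S.bound.nonneg
  have hd1 : 1 ≤ d := le_trans one_le_two S.two_le
  have hx := S.bound.norm_u hr.le htp
  rw [enDeriv_add_enFluxDeriv_eq S.sol htp hr]
  have hxx : r - r₀ - (c + κ) * (t - t₀) = r - (r₀ + (c + κ) * (t - t₀)) := by ring
  have hI : ∃ I : ℝ, (I = 0 ∧ D.lmin / 2 * ‖u r t‖ ^ 2 ≤ ⟪u r t, gradient V (u r t)⟫ ∨
      I = 1 ∧ ‖gradient V (u r t)‖ ≤ CV * ‖u r t‖) ∧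
      expWeight (c + κ) κ (r - r₀ - (c + κ) * (t - t₀)) * I ≤
        Real.exp ((c + κ) * (fEsc t - (r₀ + (c + κ) * (t - t₀)))) *
              Real.exp (-κ' * |r - fEsc t|) +
            Real.exp (-κ * (rHom t - (r₀ + (c + κ) * (t - t₀)))) *
              Real.exp (-κ' * |r - rHom t|) := by
    rcases le_or_gt ‖u r t‖ D.dEsc with h | h
    · refine ⟨0, Or.inl ⟨rfl, ?_⟩, by rw [mul_zero]; positivity⟩
      simpa using inner_gradient_ge S.smooth S.zero_mem.1 (D.esc_lower 0 S.zero_mem)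
        (x := u r t) (by simpa using h)
    · refine ⟨1, Or.inr ⟨rfl, hgrad _ hx⟩, ?_⟩
      rw [mul_one, hxx]
      exact S.expWeight_le_of_escape (by linarith) hκ'κ htp h
  obtain ⟨I, hI, hψI⟩ := hI
  have key := dissipation_le (χ := expWeight c κ (r - r₀ - (c + κ) * (t - t₀)))
    (g := gradient V (u r t)) (k := curv d u r t) (l := D.lmin) (I := I)
    hc hκ (expWeight_pos _ _ _) (expWeight_pos (c + κ) κ _).le
    (expWeight_add_le _ hc hκ) (expWeight_defect_nonneg _ hc hκ) (expWeight_defect_le _ hc hκ)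
    (expWeight_defect_sq_le _ hc hκ) (expWeight₂_sub_le _ hc hκ) (expWeight₁_defect_le _ hc hκ)
    hβ hC0 hCV hx (S.bound.norm_ur hr.le htp) (S.bound.norm_ut hr.le htp) (hpot _ hx) hβl hκl hI
  have hcurv := expWeight_mul_norm_curv_le hd1 S.sol S.bound (q := c + κ) (τ := t - t₀)
    hκ'c hκ'κ hκ' (by positivity) (by linarith) htp hr hr₀
  have h1 := mul_le_mul_of_nonneg_left hψI
    (by positivity : 0 ≤ C ^ 2 * (2 * κ * (c + κ) * CV + β * CV + β * κ * (c + κ)))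
  have h2 := mul_le_mul_of_nonneg_left hcurv
    (by positivity : 0 ≤ (1 + c) * C + 2 * β * C)
  rw [hxx] at key h1 h2 ⊢
  have h3 := mul_le_mul_of_nonneg_left (key.trans (add_le_add (add_le_add le_rfl h1) h2))
    (Real.exp_pos (c * κ * (t - t₀))).le
  refine h3.trans (le_of_eq ?_)
  simp only [travWeight, hxx]
  ring

lemma travBoundary_le {β c κ r₀ t₀ t CV : ℝ} (hC : SolBound u C) (hc : 0 ≤ c) (hκ : 0 ≤ κ)
    (hβ : 0 ≤ β) (hCV : 0 ≤ CV) (hpot : ∀ x : Euc n, ‖x‖ ≤ C → |V x| ≤ CV * ‖x‖ ^ 2)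
    (hr₀ : 0 < r₀) (ht : 0 < t) (htt : t₀ ≤ t) :
    c * (travWeight 1 (c * κ) c κ (c + κ) r₀ t₀ 0 t * V (u 0 t)) +
        travWeight₁ β (c * κ) (c + κ) κ (c + κ) r₀ t₀ 0 t * (‖u 0 t‖ ^ 2 / 2) ≤
      (c * CV + (c + 2 * κ) * β) * C ^ 2 *
        (Real.exp (c * κ * (t - t₀)) * Real.exp (-c * r₀ / 2)) := by
  have hx := hC.norm_u le_rfl ht
  have hx2 : ‖u 0 t‖ ^ 2 ≤ C ^ 2 := pow_le_pow_left₀ (norm_nonneg _) hx 2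
  have hχ : expWeight c κ (0 - r₀ - (c + κ) * (t - t₀)) ≤ Real.exp (-c * r₀ / 2) := by
    refine (expWeight_le_exp_left _ _ _).trans (Real.exp_le_exp.2 ?_)
    nlinarith [mul_nonneg hc (mul_nonneg (add_nonneg hc hκ) (sub_nonneg.2 htt)),
      mul_nonneg hc hr₀.le]
  have hψ := expWeight_add_le (0 - r₀ - (c + κ) * (t - t₀)) hc hκ
  set E := Real.exp (c * κ * (t - t₀)) with hE
  have hE0 : 0 < E := Real.exp_pos _
  set e := Real.exp (-c * r₀ / 2)
  have e0 : 0 < e := Real.exp_pos _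
  have ha : travWeight 1 (c * κ) c κ (c + κ) r₀ t₀ 0 t ≤ E * e := by
    rw [travWeight, one_mul]
    exact mul_le_mul_of_nonneg_left hχ hE0.le
  have hb : travWeight β (c * κ) (c + κ) κ (c + κ) r₀ t₀ 0 t ≤ β * (2 * (E * e)) := by
    rw [travWeight, mul_assoc]
    refine mul_le_mul_of_nonneg_left ?_ hβ
    have : E * expWeight (c + κ) κ (0 - r₀ - (c + κ) * (t - t₀)) ≤ E * (2 * e) :=
      mul_le_mul_of_nonneg_left (hψ.trans (by linarith)) hE0.le
    linarith
  have hV1 : V (u 0 t) ≤ CV * C ^ 2 :=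
    ((le_abs_self _).trans (hpot _ hx)).trans (mul_le_mul_of_nonneg_left hx2 hCV)
  have ha0 : 0 ≤ travWeight 1 (c * κ) c κ (c + κ) r₀ t₀ 0 t := travWeight_nonneg zero_le_one
  have h1 : travWeight 1 (c * κ) c κ (c + κ) r₀ t₀ 0 t * V (u 0 t) ≤ E * e * (CV * C ^ 2) :=
    (mul_le_mul_of_nonneg_left hV1 ha0).trans (mul_le_mul_of_nonneg_right ha (by positivity))
  have h2 : travWeight₁ β (c * κ) (c + κ) κ (c + κ) r₀ t₀ 0 t ≤
      (c + κ + κ) * (β * (2 * (E * e))) :=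
    ((le_abs_self _).trans (abs_travWeight₁_le hβ (by positivity) hκ)).trans
      (mul_le_mul_of_nonneg_left hb (by positivity))
  have h3 : travWeight₁ β (c * κ) (c + κ) κ (c + κ) r₀ t₀ 0 t * (‖u 0 t‖ ^ 2 / 2) ≤
      (c + κ + κ) * (β * (2 * (E * e))) * (C ^ 2 / 2) :=
    (mul_le_mul_of_nonneg_right h2 (by positivity)).trans
      (mul_le_mul_of_nonneg_left (by linarith) (by positivity))
  have h4 := mul_le_mul_of_nonneg_left h1 hc
  refine (add_le_add h4 h3).trans (le_of_eq (by ring))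

end EnergyEstimates

section EnergyDecay

variable {d : ℕ} {V : Euc n → ℝ} {D : EscData n V} {u : ℝ → ℝ → Euc n}
  {C ν K cHom δ L₀ : ℝ} {rHom : ℝ → ℝ}

local notation "fEsc" => rescF V d D.lmin u δ L₀ rHom

lemma integral_combination {F g₁ g₂ : ℝ → ℝ} {s : Set ℝ} (a E K₁ K₂ : ℝ)
    (hF : IntegrableOn F s) (h₁ : IntegrableOn g₁ s) (h₂ : IntegrableOn g₂ s) :
    IntegrableOn (fun r => a * F r + E * (K₁ * g₁ r + K₂ * g₂ r)) s ∧
    ∫ r in s, (a * F r + E * (K₁ * g₁ r + K₂ * g₂ r)) =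
      a * (∫ r in s, F r) + E * (K₁ * (∫ r in s, g₁ r) + K₂ * ∫ r in s, g₂ r) := by
  have i0 : IntegrableOn (fun r => a * F r) s := hF.const_mul a
  have i1 : IntegrableOn (fun r => K₁ * g₁ r) s := h₁.const_mul K₁
  have i2 : IntegrableOn (fun r => K₂ * g₂ r) s := h₂.const_mul K₂
  have i3 : IntegrableOn (fun r => K₁ * g₁ r + K₂ * g₂ r) s := i1.add i2
  have i4 : IntegrableOn (fun r => E * (K₁ * g₁ r + K₂ * g₂ r)) s := i3.const_mul E
  refine ⟨i0.add i4, ?_⟩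
  rw [integral_add i0 i4, integral_const_mul, integral_const_mul, integral_add i1 i2,
    integral_const_mul, integral_const_mul]

lemma EscSetting.exists_travEnergy_deriv_le (S : EscSetting d V D u C ν K cHom δ L₀ rHom)
    {c κ : ℝ} (hc : 0 < c) (hκ : 0 < κ) (hκl : κ * (c + κ) ≤ D.lmin / 4) :
    ∃ β C₄ : ℝ, 0 < β ∧ 0 ≤ C₄ ∧ ∀ r₀ t₀ t, 0 < r₀ → 0 < t₀ → t₀ ≤ t →
      ∃ G', HasDerivAt (travEnergy V u β c κ r₀ t₀) G' t ∧
        G' ≤ -(1 / 2) * (∫ r in Ioi (0 : ℝ), travWeight 1 (c * κ) c κ (c + κ) r₀ t₀ r t *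
          ‖ut u r t + c • ur u r t‖ ^ 2) +
          C₄ * (Real.exp (c * κ * (t - t₀)) *
            (Real.exp ((c + κ) * (fEsc t - (r₀ + (c + κ) * (t - t₀)))) +
              Real.exp (-κ * (rHom t - (r₀ + (c + κ) * (t - t₀)))) +
              Real.exp (-c * r₀ / 2) + 1 / r₀)) := by
  obtain ⟨CV, hCV, -, hgrad, hpot⟩ := exists_quadratic_bound S.smooth S.zero_mem.1 S.map_zero C
  have hl := D.lmin_pos
  have hC0 := S.bound.nonneg
  set q := c + κ with hq
  have hq0 : 0 < q := by positivity
  set κ' := min c κ with hκ'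
  have hκ'0 : 0 < κ' := lt_min hc hκ
  set β := q ^ 2 + κ * q + 8 * κ * q * CV / D.lmin with hβ
  have hβ0 : 0 < β := by positivity
  have hβ1 : q ^ 2 + κ * q ≤ β := le_add_of_nonneg_right (by positivity)
  have hβl : 2 * κ * q * CV ≤ β * (D.lmin / 4) := by
    have h1 : 8 * κ * q * CV / D.lmin * (D.lmin / 4) = 2 * κ * q * CV := by field_simp; ring
    rw [← h1]
    exact mul_le_mul_of_nonneg_right (le_add_of_nonneg_left (by positivity)) (by positivity)
  set K₁ := C ^ 2 * (2 * κ * q * CV + β * CV + β * κ * q) with hK₁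
  set K₂ := ((1 + c) * C + 2 * β * C) * (2 * d * C) with hK₂
  set K₃ := (c * CV + (c + 2 * κ) * β) * C ^ 2 with hK₃
  have hK₁0 : 0 ≤ K₁ := by positivity
  have hK₂0 : 0 ≤ K₂ := by positivity
  have hK₃0 : 0 ≤ K₃ := by positivity
  refine ⟨β, 2 / κ' * (K₁ + K₂) + K₃, hβ0, by positivity, fun r₀ t₀ t hr₀ ht₀ htt => ?_⟩
  have ht : 0 < t := ht₀.trans_le htt
  set τ := |t - t₀| + 1 with hτ
  have hτt : |t - t₀| ≤ τ := by linarith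
  set Ma := travBound 1 (c * κ) c κ q r₀ τ
  set Mb := travBound β (c * κ) q κ q r₀ τ
  have hcκ : 0 ≤ c * κ := by positivity
  have wa := timeWeight_travWeight (t := t) (t₀ := t₀) (M := max Ma Mb) zero_le_one hcκ hc.le hκ.le
    hq0.le (le_max_left Ma Mb)
  have wb := timeWeight_travWeight (t := t) (t₀ := t₀) (M := max Ma Mb) hβ0.le hcκ hq0.le hκ.le
    hq0.le (le_max_right Ma Mb)
  have lea : ∀ {x r : ℝ}, x ≤ Ma * Real.exp (-κ * r) → x ≤ max Ma Mb * Real.exp (-κ * r) :=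
    fun h => h.trans (mul_le_mul_of_nonneg_right (le_max_left _ _) (Real.exp_pos _).le)
  have leb : ∀ {x r : ℝ}, x ≤ Mb * Real.exp (-κ * r) → x ≤ max Ma Mb * Real.exp (-κ * r) :=
    fun h => h.trans (mul_le_mul_of_nonneg_right (le_max_right _ _) (Real.exp_pos _).le)
  have cont : ∀ {β α p κ q r₀ t₀ t : ℝ}, Continuous fun r => travWeight β α p κ q r₀ t₀ r t :=
    continuous_iff_continuousAt.2 fun r => hasDerivAt_travWeight.continuousAt
  have harb : ∀ r, 0 ≤ r → |travWeight₁ 1 (c * κ) c κ q r₀ t₀ r t| ≤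
      max Ma Mb * Real.exp (-κ * r) := fun r _ => lea ((abs_travWeight₁_le zero_le_one hc.le hκ.le).trans
        (mul_travWeight_le zero_le_one hcκ hc.le hκ.le hq0.le hτt (by
          nlinarith [sq_nonneg (c + κ), mul_pos hq0 hq0])))
  have hbrb : ∀ r, 0 ≤ r → |travWeight₁ β (c * κ) q κ q r₀ t₀ r t| ≤
      max Ma Mb * Real.exp (-κ * r) := fun r _ => leb ((abs_travWeight₁_le hβ0.le hq0.le hκ.le).trans
        (mul_travWeight_le hβ0.le hcκ hq0.le hκ.le hq0.le hτt (by
          nlinarith [sq_nonneg (q + κ), mul_pos hq0 hq0, mul_pos hq0 hκ])))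
  have hbrrb : ∀ r, 0 ≤ r → |travWeight₂ β (c * κ) q κ q r₀ t₀ r t| ≤
      max Ma Mb * Real.exp (-κ * r) := fun r _ => leb ((abs_travWeight₂_le hβ0.le hq0.le hκ.le).trans
        (mul_travWeight_le hβ0.le hcκ hq0.le hκ.le hq0.le hτt (by
          nlinarith [mul_pos hq0 hq0, mul_pos hq0 hκ])))
  have hder := hasDerivAt_energy S.smooth S.sol S.bound hκ ht wa wb
    (fun r => hasDerivAt_travWeight) continuous_travWeight₁ harb
  obtain ⟨hInt, heq⟩ := integral_enDeriv_eq S.smooth S.sol S.bound hκ ht hc.le wa wb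
    ((cont.const_mul _).sub (continuous_travWeight₁.const_mul _))
    ((cont.const_mul _).sub (continuous_travWeight₁.const_mul _))
    (fun r _ => lea (abs_travWeight_time_le zero_le_one hcκ hc.le hκ.le hq0.le hτt))
    (fun r _ => leb (abs_travWeight_time_le hβ0.le hcκ hq0.le hκ.le hq0.le hτt))
    (fun r => hasDerivAt_travWeight) continuous_travWeight₁ harb
    (fun r => hasDerivAt_travWeight) (fun r => hasDerivAt_travWeight₁) hbrb
    continuous_travWeight₂ hbrrb
  refine ⟨_, hder, ?_⟩
  rw [heq]
  have hbd := travBoundary_le (u := u) (V := V) (r₀ := r₀) (t₀ := t₀) S.bound hc.le hκ.le hβ0.le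
    hCV hpot hr₀ ht htt
  set E := Real.exp (c * κ * (t - t₀)) with hE
  have hE0 : 0 < E := Real.exp_pos _
  set x₀ := r₀ + q * (t - t₀) with hx₀
  set A₁ := Real.exp (q * (fEsc t - x₀)) with hA₁
  set A₂ := Real.exp (-κ * (rHom t - x₀)) with hA₂
  set A₃ := Real.exp (-c * r₀ / 2) with hA₃
  obtain ⟨i1, j1⟩ := integral_two_exp_abs_le (ρ₁ := fEsc t) (ρ₂ := rHom t) hκ'0
    (Real.exp_pos (q * (fEsc t - x₀))).le (Real.exp_pos (-κ * (rHom t - x₀))).le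
  obtain ⟨i2, j2⟩ := integral_two_exp_abs_le (ρ₁ := r₀ / 2) (ρ₂ := x₀) hκ'0
    (Real.exp_pos (-c * r₀ / 2)).le (by positivity : 0 ≤ 1 / r₀)
  rw [← hA₁, ← hA₂] at i1 j1
  rw [← hA₃] at i2 j2
  have i0 := integrableOn_travDissip (t₀ := t₀) (r₀ := r₀) (p := c) (c := c) S.smooth S.sol S.bound
    hcκ hκ hq0.le ht
  obtain ⟨i3, hsum⟩ := integral_combination (-(1 / 2)) E K₁ K₂ i0 i1 i2
  have hmono := setIntegral_mono_on hInt i3 measurableSet_Ioi fun r hr =>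
    S.travDissipation_le hκ'0 (min_le_left _ _) (min_le_right _ _) hκl hCV hgrad hpot hβ1 hβl hr₀
      ht₀ htt hr
  have hA₁0 : 0 < A₁ := Real.exp_pos _
  have hA₂0 : 0 < A₂ := Real.exp_pos _
  have hA₃0 : 0 < A₃ := Real.exp_pos _
  have hr₀0 : 0 < 1 / r₀ := by positivity
  have hfin : E * (K₁ * (2 / κ' * (A₁ + A₂)) + K₂ * (2 / κ' * (A₃ + 1 / r₀))) + K₃ * (E * A₃) ≤
      (2 / κ' * (K₁ + K₂) + K₃) * (E * (A₁ + A₂ + A₃ + 1 / r₀)) := by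
    have h1 : 0 ≤ E * (2 / κ' * (K₁ * (A₃ + 1 / r₀) + K₂ * (A₁ + A₂)) +
        K₃ * (A₁ + A₂ + 1 / r₀)) := by positivity
    refine (le_add_of_nonneg_right h1).trans (le_of_eq ?_)
    generalize 1 / r₀ = y
    generalize 2 / κ' = z
    ring
  have hmid := mul_le_mul_of_nonneg_left (add_le_add (mul_le_mul_of_nonneg_left j1 hK₁0)
    (mul_le_mul_of_nonneg_left j2 hK₂0)) hE0.le
  refine (add_le_add (hmono.trans (le_of_eq hsum)) hbd).trans ?_
  rw [add_assoc]
  exact add_le_add le_rfl ((add_le_add hmid le_rfl).trans hfin)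

end EnergyDecay

section EnergyBounds

variable {d : ℕ} {V : Euc n → ℝ} {D : EscData n V} {u : ℝ → ℝ → Euc n}
  {C ν K cHom δ L₀ : ℝ} {rHom : ℝ → ℝ}

local notation "fEsc" => rescF V d D.lmin u δ L₀ rHom

lemma abs_travDensity_le (hC : SolBound u C) {B : ℝ} (hB : ∀ x : Euc n, ‖x‖ ≤ C → |V x| ≤ B)
    {β c κ κ' r₀ t₀ t r : ℝ} (hβ : 0 ≤ β) (hκ' : 0 ≤ κ') (hκ'c : κ' ≤ c) (hκ'κ : κ' ≤ κ)
    (ht : 0 < t) (hr : 0 ≤ r) :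
    |enDensity V u (travWeight 1 (c * κ) c κ (c + κ) r₀ t₀)
        (travWeight β (c * κ) (c + κ) κ (c + κ) r₀ t₀) r t| ≤
      (1 + β) * Real.exp (c * κ * (t - t₀)) * (C ^ 2 + B) *
        Real.exp (-κ' * |r - (r₀ + (c + κ) * (t - t₀))|) := by
  have hxx : r - r₀ - (c + κ) * (t - t₀) = r - (r₀ + (c + κ) * (t - t₀)) := by ring
  have hE := Real.exp_pos (c * κ * (t - t₀))
  have he := Real.exp_pos (-κ' * |r - (r₀ + (c + κ) * (t - t₀))|)
  have h1 : |travWeight 1 (c * κ) c κ (c + κ) r₀ t₀ r t| ≤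
      (1 + β) * Real.exp (c * κ * (t - t₀)) *
        Real.exp (-κ' * |r - (r₀ + (c + κ) * (t - t₀))|) := by
    rw [abs_of_nonneg (travWeight_nonneg zero_le_one), travWeight, hxx]
    exact mul_le_mul (by nlinarith) (expWeight_le_exp_abs hκ'c hκ'κ _)
      (expWeight_pos _ _ _).le (by positivity)
  have h2 : |travWeight β (c * κ) (c + κ) κ (c + κ) r₀ t₀ r t| ≤
      (1 + β) * Real.exp (c * κ * (t - t₀)) *
        Real.exp (-κ' * |r - (r₀ + (c + κ) * (t - t₀))|) := by
    rw [abs_of_nonneg (travWeight_nonneg hβ), travWeight, hxx]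
    exact mul_le_mul (by nlinarith) (expWeight_le_exp_abs (by linarith) hκ'κ _)
      (expWeight_pos _ _ _).le (by positivity)
  exact (abs_enDensity_le hC hB ht hr h1 h2).trans (le_of_eq (by ring))

lemma integrableOn_travDensity (hV : ContDiff ℝ 2 V) (hu : IsRadialSolution d V u)
    (hC : SolBound u C) {β c κ r₀ t₀ t : ℝ} (hβ : 0 ≤ β) (hc : 0 < c) (hκ : 0 < κ) (ht : 0 < t) :
    IntegrableOn (fun r => enDensity V u (travWeight 1 (c * κ) c κ (c + κ) r₀ t₀)
        (travWeight β (c * κ) (c + κ) κ (c + κ) r₀ t₀) r t) (Ioi 0) := by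
  obtain ⟨B, -, hB, -⟩ := exists_potential_bound hV C
  have cont : ∀ {β α p κ q r₀ t₀ t : ℝ}, Continuous fun r => travWeight β α p κ q r₀ t₀ r t :=
    continuous_iff_continuousAt.2 fun r => hasDerivAt_travWeight.continuousAt
  refine Integrable.mono' (((integrable_exp_abs (lt_min hc hκ)
    (r₀ + (c + κ) * (t - t₀))).const_mul ((1 + β) * Real.exp (c * κ * (t - t₀)) *
      (C ^ 2 + B))).integrableOn)
    (continuous_enDensity hV hu ht cont cont).aestronglyMeasurable
    ((ae_restrict_iff' measurableSet_Ioi).2 (Eventually.of_forall fun r hr => ?_))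
  exact abs_travDensity_le hC (fun x hx => (hB x hx).1) hβ (lt_min hc hκ).le (min_le_left _ _)
    (min_le_right _ _) ht (le_of_lt hr)

lemma exists_travEnergy_le (hV : ContDiff ℝ 2 V) (hu : IsRadialSolution d V u)
    (hC : SolBound u C) {β c κ : ℝ} (hβ : 0 ≤ β) (hc : 0 < c) (hκ : 0 < κ) :
    ∃ C₆ : ℝ, 0 ≤ C₆ ∧ ∀ r₀ t₀, 0 < t₀ → travEnergy V u β c κ r₀ t₀ t₀ ≤ C₆ := by
  obtain ⟨B, hB0, hB, -⟩ := exists_potential_bound hV C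
  have hκ' := lt_min hc hκ
  refine ⟨(1 + β) * (C ^ 2 + B) * (2 / min c κ), by positivity, fun r₀ t₀ ht₀ => ?_⟩
  have hi := (integrable_exp_abs hκ' r₀).const_mul ((1 + β) * (C ^ 2 + B))
  have h1 := setIntegral_mono_on (integrableOn_travDensity (r₀ := r₀) (t₀ := t₀) hV hu hC hβ hc hκ
    ht₀) (hi.integrableOn (s := Ioi 0)) measurableSet_Ioi fun r hr => (le_abs_self _).trans
      ((abs_travDensity_le hC (fun x hx => (hB x hx).1) hβ hκ'.le (min_le_left _ _)
        (min_le_right _ _) ht₀ (le_of_lt hr)).trans (le_of_eq (by simp)))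
  refine h1.trans ?_
  rw [integral_const_mul]
  refine mul_le_mul_of_nonneg_left ?_ (by positivity)
  simpa using setIntegral_exp_abs_le (ρ := r₀) (A := Ioi 0) hκ' le_rfl fun r _ => abs_nonneg _

lemma EscSetting.exists_le_travEnergy (S : EscSetting d V D u C ν K cHom δ L₀ rHom)
    {β c κ : ℝ} (hβ : 0 ≤ β) (hc : 0 < c) (hκ : 0 < κ) :
    ∃ C₅ : ℝ, 0 ≤ C₅ ∧ ∀ r₀ t₀ t, 0 < t →
      -(C₅ * (Real.exp (c * κ * (t - t₀)) *
        (Real.exp (c * (fEsc t - (r₀ + (c + κ) * (t - t₀)))) +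
          Real.exp (-κ * (rHom t - (r₀ + (c + κ) * (t - t₀))))))) ≤
      travEnergy V u β c κ r₀ t₀ t := by
  obtain ⟨B, hB0, hB, -⟩ := exists_potential_bound S.smooth C
  have hκ' := lt_min hc hκ
  have hl := D.lmin_pos
  refine ⟨B * (2 / min c κ), by positivity, fun r₀ t₀ t ht => ?_⟩
  set x₀ := r₀ + (c + κ) * (t - t₀) with hx₀
  obtain ⟨i1, j1⟩ := integral_two_exp_abs_le (ρ₁ := fEsc t) (ρ₂ := rHom t) hκ'
    (Real.exp_pos (c * (fEsc t - x₀))).le (Real.exp_pos (-κ * (rHom t - x₀))).le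
  set E := Real.exp (c * κ * (t - t₀)) with hE
  have hE0 : 0 < E := Real.exp_pos _
  have i2 := i1.const_mul (-(B * E))
  have h1 := setIntegral_mono_on i2 (integrableOn_travDensity (r₀ := r₀) (t₀ := t₀) S.smooth S.sol
    S.bound hβ hc hκ ht) measurableSet_Ioi fun r hr => by
    have hr0 : 0 ≤ r := le_of_lt hr
    have ha : travWeight 1 (c * κ) c κ (c + κ) r₀ t₀ r t = E * expWeight c κ (r - x₀) := by
      rw [travWeight, one_mul, hx₀, sub_sub]
    have hb : 0 ≤ travWeight β (c * κ) (c + κ) κ (c + κ) r₀ t₀ r t := travWeight_nonneg hβ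
    have hχ := expWeight_pos c κ (r - x₀)
    have h2 : E * expWeight c κ (r - x₀) * V (u r t) ≤
        enDensity V u (travWeight 1 (c * κ) c κ (c + κ) r₀ t₀)
          (travWeight β (c * κ) (c + κ) κ (c + κ) r₀ t₀) r t := by
      rw [enDensity, ha]
      have h3 : 0 ≤ E * expWeight c κ (r - x₀) * (‖ur u r t‖ ^ 2 / 2) := by positivity
      have h4 := mul_nonneg hb (by positivity : 0 ≤ ‖u r t‖ ^ 2 / 2)
      linarith
    refine le_trans ?_ h2
    rcases le_or_gt ‖u r t‖ D.dEsc with h | h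
    · have h5 := potential_sub_ge S.smooth S.zero_mem.1 (D.esc_lower 0 S.zero_mem)
        (x := u r t) (by simpa using h)
      have h6 : 0 ≤ V (u r t) := by
        have h7 : 0 ≤ D.lmin / 2 / 2 * ‖u r t - 0‖ ^ 2 := by positivity
        linarith [S.map_zero]
      refine le_trans ?_ (by positivity : 0 ≤ E * expWeight c κ (r - x₀) * V (u r t))
      rw [neg_mul]
      exact neg_nonpos.2 (by positivity)
    · have h5 := S.expWeight_le_of_escape (x₀ := x₀) (min_le_left c κ) (min_le_right c κ) ht h
      have h6 := (abs_le.1 (hB _ (S.bound.norm_u hr0 ht)).1).1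
      have h7 := mul_le_mul_of_nonneg_left h6 (by positivity : 0 ≤ E * expWeight c κ (r - x₀))
      have h8 := mul_le_mul_of_nonneg_left h5 (by positivity : 0 ≤ B * E)
      linarith
  rw [integral_const_mul] at h1
  refine le_trans ?_ h1
  have h2 := mul_le_mul_of_nonneg_left j1 (by positivity : 0 ≤ B * E)
  linarith

end EnergyBounds

section DiscreteDissipation

variable {d : ℕ} {V : Euc n → ℝ} {D : EscData n V} {u : ℝ → ℝ → Euc n}
  {C ν K cHom δ L₀ : ℝ} {rHom : ℝ → ℝ}

local notation "fEsc" => rescF V d D.lmin u δ L₀ rHom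

lemma sub_le_of_hasDerivAt_le {H H' : ℝ → ℝ} {a b m : ℝ} (hab : a ≤ b)
    (hH : ∀ s ∈ Icc a b, HasDerivAt H (H' s) s) (hm : ∀ s ∈ Icc a b, H' s ≤ m) :
    H b - H a ≤ m * (b - a) := by
  refine Convex.image_sub_le_mul_sub_of_deriv_le (convex_Icc a b)
    (fun s hs => (hH s hs).continuousAt.continuousWithinAt)
    (fun s hs => (hH s (interior_subset hs)).differentiableAt.differentiableWithinAt)
    (fun s hs => ?_) a (left_mem_Icc.2 hab) b (right_mem_Icc.2 hab) hab
  rw [(hH s (interior_subset hs)).deriv]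
  exact hm s (interior_subset hs)

lemma sum_le_of_hasDerivAt_le {G G' : ℝ → ℝ} {m : ℕ → ℝ} {A μ θ η : ℝ} (hA : 0 ≤ A) (hμ : 0 < μ)
    (hη : 0 < η) (hη1 : η ≤ 1) {N : ℕ}
    (hG : ∀ s : ℝ, 0 ≤ s → s ≤ N → HasDerivAt G (G' s) s)
    (h0 : ∀ s : ℝ, 0 ≤ s → s ≤ N → G' s ≤ A * Real.exp (-μ * s) + θ)
    (hm : ∀ j < N, ∀ s ∈ Icc (j : ℝ) (j + η), G' s ≤ -m j + (A * Real.exp (-μ * s) + θ)) :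
    η * ∑ j ∈ Finset.range N, m j ≤ G 0 - G N + A / μ + θ * N := by
  set H : ℝ → ℝ := fun s => G s + A / μ * Real.exp (-μ * s) - θ * s with hH
  have hHd : ∀ s : ℝ, 0 ≤ s → s ≤ N → HasDerivAt H (G' s - (A * Real.exp (-μ * s) + θ)) s := by
    intro s h1 h2
    have e1 : HasDerivAt (fun s : ℝ => Real.exp (-μ * s)) (Real.exp (-μ * s) * (-μ)) s := by
      simpa using ((hasDerivAt_id s).const_mul (-μ)).exp
    have e2 := ((hG s h1 h2).add (e1.const_mul (A / μ))).sub ((hasDerivAt_id s).const_mul θ)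
    refine e2.congr_deriv ?_
    field_simp
    ring
  set H' : ℝ → ℝ := fun s => G' s - (A * Real.exp (-μ * s) + θ) with hH'
  have key : ∀ k : ℕ, k ≤ N → H k ≤ H 0 - η * ∑ j ∈ Finset.range k, m j := by
    intro k
    induction k with
    | zero => simp
    | succ k ih =>
      intro hk
      have hkN : ((k : ℝ) + 1) ≤ N := by exact_mod_cast hk
      have h1 := ih (by omega)
      have hk0 : (0 : ℝ) ≤ k := Nat.cast_nonneg k
      have h2 := sub_le_of_hasDerivAt_le (H' := H') (a := (k : ℝ)) (b := k + η) (m := -m k) (by linarith)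
        (fun s hs => hHd s (by linarith [hs.1]) (by linarith [hs.2]))
        (fun s hs => by simp only [hH']; linarith [hm k (by omega) s hs])
      have h3 := sub_le_of_hasDerivAt_le (H' := H') (a := (k : ℝ) + η) (b := k + 1) (m := 0) (by linarith)
        (fun s hs => hHd s (by linarith [hs.1]) (by linarith [hs.2]))
        (fun s hs => by simp only [hH']; linarith [h0 s (by linarith [hs.1]) (by linarith [hs.2])])
      rw [Finset.sum_range_succ, Nat.cast_succ]
      nlinarith
  have h1 := key N le_rfl
  have h2 : 0 ≤ A / μ * Real.exp (-μ * N) := by positivity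
  simp only [hH, mul_zero, Real.exp_zero, mul_one, sub_zero] at h1
  linarith

lemma EscSetting.le_travDissip (S : EscSetting d V D u C ν K cHom δ L₀ rHom)
    {c κ γ C₃ ε L r₀ t₀ t x : ℝ} {j : ℕ} (hc : 0 < c) (hκ : 0 < κ) (hγ : γ ≤ κ)
    (ht₀ : 0 < t₀) (ht : t ∈ Icc (t₀ + j) (t₀ + j + 1)) (hxL : L < x)
    (hx : x - r₀ - c * j ≤ γ * j + C₃)
    (hdis : ε ≤ ∫ r in Icc (x - L) (x + L), ‖ut u r t + c • ur u r t‖ ^ 2) :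
    Real.exp (-c * L - c ^ 2) / (1 + Real.exp ((c + κ) * (C₃ + L))) *
        Real.exp (c * (x - r₀ - c * j)) * ε ≤
      ∫ r in Ioi (0 : ℝ), travWeight 1 (c * κ) c κ (c + κ) r₀ t₀ r t *
        ‖ut u r t + c • ur u r t‖ ^ 2 := by
  have hj : (0 : ℝ) ≤ j := Nat.cast_nonneg j
  have htp : 0 < t := by linarith [ht.1]
  have hInt := integrableOn_travDissip (t₀ := t₀) (r₀ := r₀) (p := c) (c := c) S.smooth S.sol
    S.bound (mul_pos hc hκ).le hκ (add_pos hc hκ).le htp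
  have hsub : Icc (x - L) (x + L) ⊆ Ioi 0 := fun r hr => by
    have : (0 : ℝ) < r := by linarith [hr.1]
    exact this
  have hnn : ∀ r, 0 ≤ travWeight 1 (c * κ) c κ (c + κ) r₀ t₀ r t *
      ‖ut u r t + c • ur u r t‖ ^ 2 := fun r =>
    mul_nonneg (travWeight_nonneg zero_le_one) (by positivity)
  set c₁ := Real.exp (-c * L - c ^ 2) / (1 + Real.exp ((c + κ) * (C₃ + L))) *
        Real.exp (c * (x - r₀ - c * j)) with hc₁
  have hc₁0 : 0 < c₁ := by positivity
  have hdi : IntegrableOn (fun r => ‖ut u r t + c • ur u r t‖ ^ 2) (Icc (x - L) (x + L)) :=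
    ((S.sol.continuousOn_dissip S.smooth c htp).mono hsub).integrableOn_Icc
  have hw : ∀ r ∈ Icc (x - L) (x + L), c₁ ≤ travWeight 1 (c * κ) c κ (c + κ) r₀ t₀ r t := by
    intro r hr
    have hs1 : (j : ℝ) ≤ t - t₀ := by linarith [ht.1]
    have hs2 : t - t₀ ≤ j + 1 := by linarith [ht.2]
    have hM : r - r₀ - (c + κ) * (t - t₀) ≤ C₃ + L := by
      nlinarith [hr.2, mul_le_mul_of_nonneg_left hs1 (add_pos hc hκ).le,
        mul_le_mul_of_nonneg_right hγ hj]
    have h1 := le_expWeight (p := c) (κ := κ) (add_pos hc hκ) hM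
    rw [travWeight, one_mul]
    refine le_trans ?_ (mul_le_mul_of_nonneg_left h1 (Real.exp_pos _).le)
    rw [hc₁, mul_div_assoc', div_mul_eq_mul_div, ← Real.exp_add, ← Real.exp_add]
    refine div_le_div_of_nonneg_right (Real.exp_le_exp.2 ?_) (by positivity)
    nlinarith [mul_le_mul_of_nonneg_left hr.1 hc.le,
      mul_le_mul_of_nonneg_left hs2 (sq_nonneg c)]
  calc c₁ * ε ≤ c₁ * ∫ r in Icc (x - L) (x + L), ‖ut u r t + c • ur u r t‖ ^ 2 :=
        mul_le_mul_of_nonneg_left hdis hc₁0.le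
    _ = ∫ r in Icc (x - L) (x + L), c₁ * ‖ut u r t + c • ur u r t‖ ^ 2 := by
        rw [integral_const_mul]
    _ ≤ ∫ r in Icc (x - L) (x + L), travWeight 1 (c * κ) c κ (c + κ) r₀ t₀ r t *
        ‖ut u r t + c • ur u r t‖ ^ 2 :=
        setIntegral_mono_on (hdi.const_mul c₁) (hInt.mono_set hsub) measurableSet_Icc fun r hr =>
          mul_le_mul_of_nonneg_right (hw r hr) (by positivity)
    _ ≤ _ := setIntegral_mono_set hInt (Eventually.of_forall hnn) hsub.eventuallyLE

end DiscreteDissipation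

section SummedDissipation

variable {d : ℕ} {V : Euc n → ℝ} {D : EscData n V} {u : ℝ → ℝ → Euc n}
  {C ν K cHom δ L₀ : ℝ} {rHom : ℝ → ℝ}

local notation "fEsc" => rescF V d D.lmin u δ L₀ rHom

lemma exp_mul_exp_farField_le {c κ r₀ h s M x : ℝ} (hc : 0 < c) (hκ : 0 < κ) (hs : s ≤ M)
    (hh : x ≤ h - r₀) :
    Real.exp (c * κ * s) * Real.exp (-κ * (h - (r₀ + (c + κ) * s))) ≤
      Real.exp ((c * κ + κ * (c + κ)) * M) * Real.exp (-κ * x) := by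
  rw [← Real.exp_add, ← Real.exp_add]
  refine Real.exp_le_exp.2 ?_
  have h1 := mul_le_mul_of_nonneg_left hs (by positivity : 0 ≤ c * κ + κ * (c + κ))
  have h2 := mul_le_mul_of_nonneg_left hh hκ.le
  linarith

lemma pollution_le {c κ γ C₃ y r₀ h s M x : ℝ} (hc : 0 < c) (hκ : 0 < κ)
    (hγq : (c + κ) * γ ≤ κ ^ 2 / 2) (hs0 : 0 ≤ s) (hs : s ≤ M) (hy : y - r₀ - c * s ≤ γ * s + C₃)
    (hh : x ≤ h - r₀) (hx : 0 < x) (hxr : x ≤ r₀) :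
    Real.exp (c * κ * s) * (Real.exp ((c + κ) * (y - (r₀ + (c + κ) * s))) +
        Real.exp (-κ * (h - (r₀ + (c + κ) * s))) + Real.exp (-c * r₀ / 2) + 1 / r₀) ≤
      Real.exp ((c + κ) * C₃) * Real.exp (-(κ ^ 2 / 2) * s) +
        Real.exp ((c * κ + κ * (c + κ)) * M) *
          (Real.exp (-κ * x) + Real.exp (-c * x / 2) + 1 / x) := by
  have h1 : Real.exp (c * κ * s) * Real.exp ((c + κ) * (y - (r₀ + (c + κ) * s))) ≤
      Real.exp ((c + κ) * C₃) * Real.exp (-(κ ^ 2 / 2) * s) := by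
    rw [← Real.exp_add, ← Real.exp_add]
    refine Real.exp_le_exp.2 ?_
    have e1 := mul_le_mul_of_nonneg_left hy (add_pos hc hκ).le
    have e2 := mul_le_mul_of_nonneg_right hγq hs0
    linarith
  have h2 := exp_mul_exp_farField_le hc hκ hs hh
  have hE : Real.exp (c * κ * s) ≤ Real.exp ((c * κ + κ * (c + κ)) * M) := by
    refine Real.exp_le_exp.2 ?_
    have e1 := mul_le_mul_of_nonneg_left hs (mul_pos hc hκ).le
    have e2 : 0 ≤ κ * (c + κ) * M := mul_nonneg (by positivity) (hs0.trans hs)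
    linarith
  have h3 : Real.exp (c * κ * s) * Real.exp (-c * r₀ / 2) ≤
      Real.exp ((c * κ + κ * (c + κ)) * M) * Real.exp (-c * x / 2) :=
    mul_le_mul hE (Real.exp_le_exp.2 (by nlinarith)) (Real.exp_pos _).le (Real.exp_pos _).le
  have h4 : Real.exp (c * κ * s) * (1 / r₀) ≤
      Real.exp ((c * κ + κ * (c + κ)) * M) * (1 / x) :=
    mul_le_mul hE (one_div_le_one_div_of_le hx hxr) (one_div_nonneg.2 (hx.le.trans hxr))
      (Real.exp_pos _).le
  linarith

lemma exists_small_remainder {c κ : ℝ} (hc : 0 < c) (hκ : 0 < κ) (C₄ P ρ R : ℝ) {θ : ℝ}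
    (hθ : 0 < θ) : ∃ x : ℝ, 0 < x ∧ ρ < x ∧
      C₄ * (P * (Real.exp (-κ * x) + Real.exp (-c * x / 2) + 1 / x)) ≤ θ ∧
      P * Real.exp (-κ * x) ≤ 1 ∧ Real.exp (c * (R - x)) ≤ θ := by
  have e : ∀ {a : ℝ}, 0 < a → Tendsto (fun x : ℝ => Real.exp (-a * x)) atTop (𝓝 0) := fun ha => by
    refine Real.tendsto_exp_atBot.comp ?_
    exact tendsto_id.const_mul_atTop_of_neg (neg_lt_zero.2 ha)
  have e1 := e hκ
  have e2 : Tendsto (fun x : ℝ => Real.exp (-c * x / 2)) atTop (𝓝 0) := by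
    refine (e (half_pos hc)).congr fun x => ?_
    congr 1
    ring
  have e3 : Tendsto (fun x : ℝ => 1 / x) atTop (𝓝 0) := by
    simpa using tendsto_inv_atTop_zero (𝕜 := ℝ)
  have f1 := (((e1.add e2).add e3).const_mul P).const_mul C₄
  have f2 := e1.const_mul P
  have f3 : Tendsto (fun x : ℝ => Real.exp (c * (R - x))) atTop (𝓝 0) := by
    have := (e hc).const_mul (Real.exp (c * R))
    rw [mul_zero] at this
    refine this.congr fun x => ?_
    rw [← Real.exp_add]
    congr 1
    ring
  simp only [add_zero, mul_zero] at f1 f2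
  obtain ⟨x, h1, h2, h3, h4, h5⟩ := ((eventually_gt_atTop 0).and ((eventually_gt_atTop ρ).and
    ((f1.eventually_lt_const hθ).and ((f2.eventually_lt_const one_pos).and
      (f3.eventually_lt_const hθ))))).exists
  exact ⟨x, h1, h2, h3.le, h4.le, h5.le⟩

lemma EscSetting.exists_sum_exp_le (S : EscSetting d V D u C ν K cHom δ L₀ rHom)
    (hnd : HNonDeg V) (hbist : HOnlyBist V) {c κ γ C₃ : ℝ} (hc : 0 < c)
    (hempty : ¬ (PhiInv V c 0).Nonempty) (hκ : 0 < κ) (hκl : κ * (c + κ) ≤ D.lmin / 4)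
    (hγ : γ ≤ κ) (hγq : (c + κ) * γ ≤ κ ^ 2 / 2)
    (hgrow : ∀ t s, 0 ≤ t → 0 ≤ s → fEsc (t + s) - fEsc t - c * s ≤ γ * s + C₃) :
    ∃ A B : ℝ, 0 ≤ A ∧ 1 ≤ B ∧ ∀ M : ℕ, ∃ T R : ℝ, ∀ t, T ≤ t → R ≤ fEsc t → ∀ N ≤ M,
      ∑ j ∈ Finset.range N, Real.exp (c * (fEsc (t + j) - fEsc t - c * j)) ≤
        A + B * Real.exp (c * (fEsc (t + N) - fEsc t - c * N)) := by
  obtain ⟨ε, L, RA, TA, η, hε, hL, hLR, hTA, hη, hη1, hdis⟩ := S.exists_dissip_ge hnd hbist hc hempty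
  obtain ⟨β, C₄, hβ, hC₄, hder⟩ := S.exists_travEnergy_deriv_le hc hκ hκl
  obtain ⟨C₆, hC₆, hup⟩ := exists_travEnergy_le S.smooth S.sol S.bound hβ.le hc hκ
  obtain ⟨C₅, hC₅, hlow⟩ := S.exists_le_travEnergy hβ.le hc hκ
  set c₁ := Real.exp (-c * L - c ^ 2) / (1 + Real.exp ((c + κ) * (C₃ + L))) with hc₁
  have hc₁0 : 0 < c₁ := by positivity
  set w := η * (1 / 2 * c₁ * ε) with hw
  have hw0 : 0 < w := by positivity
  set A₀ := C₄ * Real.exp ((c + κ) * C₃) with hA₀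
  have hA₀0 : 0 ≤ A₀ := by positivity
  set μ := κ ^ 2 / 2 with hμ
  have hμ0 : 0 < μ := by positivity
  refine ⟨1 + (C₆ + C₅ + A₀ / μ + 1) / w, 1 + C₅ / w, by positivity,
    le_add_of_nonneg_right (by positivity), fun M => ?_⟩
  have hθ : (0 : ℝ) < 1 / (M + 1) := by positivity
  set θ : ℝ := 1 / (M + 1) with hθd
  obtain ⟨x, hx0, hxρ, hx1, hx2, hx3⟩ := exists_small_remainder hc hκ C₄
    (Real.exp ((c * κ + κ * (c + κ)) * M)) (rsc d D.lmin) RA hθ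
  obtain ⟨TH, hTH, hfar⟩ := S.exists_le_rHom_sub_esc x
  refine ⟨max TA TH, x, fun t₀ ht₀ hf₀ N hN => ?_⟩
  have ht₀p : 0 < t₀ := hTA.trans_le ((le_max_left _ _).trans ht₀)
  have hHx : x ≤ rHom t₀ - fEsc t₀ :=
    hfar t₀ ((le_max_right _ _).trans ht₀) (hxρ.trans_le hf₀)
  have hHs : ∀ s : ℝ, 0 ≤ s → x ≤ rHom (t₀ + s) - fEsc t₀ := fun s hs =>
    hHx.trans (sub_le_sub_right (S.monotone_rHom (by linarith)) _)
  have hNM : (N : ℝ) ≤ M := by exact_mod_cast hN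
  have hθN : ∀ k : ℕ, k ≤ M → θ * k ≤ 1 := fun k hk => by
    have : (k : ℝ) ≤ M := by exact_mod_cast hk
    rw [hθd, div_mul_eq_mul_div, one_mul, div_le_one (by positivity)]
    linarith
  set r₀ := fEsc t₀ with hr₀
  have hr₀p : 0 < r₀ := hx0.trans_le hf₀
  choose! G' hG' hGle using fun t (ht : t₀ ≤ t) => hder r₀ t₀ t hr₀p ht₀p ht
  set I : ℝ → ℝ := fun t => ∫ r in Ioi (0 : ℝ), travWeight 1 (c * κ) c κ (c + κ) r₀ t₀ r t *
    ‖ut u r t + c • ur u r t‖ ^ 2 with hI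
  have hI0 : ∀ t, 0 ≤ I t := fun t => integral_nonneg fun r =>
    mul_nonneg (travWeight_nonneg zero_le_one) (by positivity)
  have hGs : ∀ s : ℝ, 0 ≤ s → s ≤ N →
      G' (t₀ + s) ≤ -(1 / 2) * I (t₀ + s) + (A₀ * Real.exp (-μ * s) + θ) := by
    intro s h0 h1
    refine (hGle (t₀ + s) (by linarith)).trans (add_le_add le_rfl ?_)
    have h2 := pollution_le hc hκ hγq h0 (h1.trans hNM) (hgrow t₀ s ht₀p.le h0) (hHs s h0) hx0 hf₀
    have h3 := mul_le_mul_of_nonneg_left h2 hC₄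
    rw [add_sub_cancel_left]
    refine h3.trans ?_
    rw [mul_add, hA₀, mul_assoc]
    exact add_le_add le_rfl hx1
  have hsum := sum_le_of_hasDerivAt_le (G := fun s => travEnergy V u β c κ r₀ t₀ (t₀ + s))
    (G' := fun s => G' (t₀ + s)) (N := N) (θ := θ) (m := fun j => 1 / 2 * c₁ * ε *
      (Real.exp (c * (fEsc (t₀ + j) - r₀ - c * j)) - θ)) hA₀0 hμ0 hη hη1
    (fun s h0 _ => (hG' (t₀ + s) (by linarith)).comp_const_add t₀ s)
    (fun s h0 h1 => (hGs s h0 h1).trans (by linarith [hI0 (t₀ + s)]))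
    (fun j hj s hs => by
      have hj0 : (0 : ℝ) ≤ j := Nat.cast_nonneg j
      have hjN : (j : ℝ) + 1 ≤ N := by exact_mod_cast hj
      refine (hGs s (by linarith [hs.1]) (by linarith [hs.2])).trans (add_le_add ?_ le_rfl)
      rcases le_or_gt RA (fEsc (t₀ + j)) with h | h
      · have h1 := S.le_travDissip (t := t₀ + s) (j := j) hc hκ hγ ht₀p
          ⟨by linarith [hs.1], by linarith [hs.2]⟩ (hLR.trans_le h) (hgrow t₀ j ht₀p.le hj0)
          (hdis (t₀ + j) (((le_max_left _ _).trans ht₀).trans (by linarith)) h (t₀ + s)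
            ⟨by linarith [hs.1], by linarith [hs.2]⟩)
        have h2 : 0 ≤ 1 / 2 * c₁ * ε * θ := by positivity
        change c₁ * Real.exp (c * (fEsc (t₀ + j) - r₀ - c * j)) * ε ≤ I (t₀ + s) at h1
        linarith
      · have h1 : Real.exp (c * (fEsc (t₀ + j) - r₀ - c * j)) ≤ θ := by
          refine le_trans (Real.exp_le_exp.2 (mul_le_mul_of_nonneg_left ?_ hc.le)) hx3
          nlinarith
        have h2 : 1 / 2 * c₁ * ε * (Real.exp (c * (fEsc (t₀ + j) - r₀ - c * j)) - θ) ≤ 0 :=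
          mul_nonpos_of_nonneg_of_nonpos (by positivity) (by linarith)
        linarith [hI0 (t₀ + s)])
  have hG0 := hup r₀ t₀ ht₀p
  have hN0 : (0 : ℝ) ≤ N := Nat.cast_nonneg N
  have hGN := hlow r₀ t₀ (t₀ + N) (by linarith)
  have hfarN := (exp_mul_exp_farField_le hc hκ hNM (hHs N hN0)).trans hx2
  have hexp : Real.exp (c * κ * N) * Real.exp (c * (fEsc (t₀ + N) - (r₀ + (c + κ) * N))) =
      Real.exp (c * (fEsc (t₀ + N) - r₀ - c * N)) := by
    rw [← Real.exp_add]
    congr 1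
    ring
  rw [add_sub_cancel_left, mul_add, hexp] at hGN
  have hGN' := mul_le_mul_of_nonneg_left hfarN hC₅
  simp only [add_zero, ← Finset.mul_sum, Finset.sum_sub_distrib, Finset.sum_const,
    Finset.card_range, nsmul_eq_mul] at hsum
  set total := ∑ j ∈ Finset.range N, Real.exp (c * (fEsc (t₀ + j) - r₀ - c * j)) with htotal
  set e := Real.exp (c * (fEsc (t₀ + N) - r₀ - c * N)) with he
  have he0 : 0 < e := Real.exp_pos _
  have hθN' := hθN N hN
  have h1 : w * (total - 1) ≤ C₆ + C₅ * (e + 1) + A₀ / μ + 1 := by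
    have h2 : w * (total - 1) ≤ w * (total - N * θ) :=
      mul_le_mul_of_nonneg_left (by linarith) hw0.le
    have h3 : w * (total - N * θ) = η * (1 / 2 * c₁ * ε * (total - N * θ)) := by rw [hw]; ring
    linarith
  have h4 : total - 1 ≤ (C₆ + C₅ * (e + 1) + A₀ / μ + 1) / w := by
    rw [le_div_iff₀ hw0]
    linarith
  have h5 : (C₆ + C₅ * (e + 1) + A₀ / μ + 1) / w = (C₆ + C₅ + A₀ / μ + 1) / w + C₅ / w * e := by
    ring
  linarith

end SummedDissipation

/-! ### Mean speeds -/

section MeanSpeed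

variable {f : ℝ → ℝ} {c₁ C₁ : ℝ}

lemma isBoundedUnder_le_div_atTop (hgrow : ∀ t s, 0 ≤ t → 0 ≤ s → f (t + s) ≤ f t + c₁ * s + C₁) :
    IsBoundedUnder (· ≤ ·) atTop fun t => f t / t := by
  refine ⟨|f 0| + c₁ + |C₁|, eventually_map.2 ?_⟩
  filter_upwards [eventually_ge_atTop 1] with t ht
  have h := hgrow 0 t le_rfl (by linarith)
  rw [zero_add] at h
  rw [div_le_iff₀ (by linarith)]
  nlinarith [le_abs_self (f 0), le_abs_self C₁, abs_nonneg (f 0), abs_nonneg C₁]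

lemma isBoundedUnder_ge_div_atTop (hf : ∀ t, 0 ≤ t → 0 ≤ f t) :
    IsBoundedUnder (· ≥ ·) atTop fun t => f t / t := by
  refine ⟨0, eventually_map.2 ?_⟩
  filter_upwards [eventually_ge_atTop 0] with t ht
  exact div_nonneg (hf t ht) ht

lemma bddAbove_increments (hgrow : ∀ t s, 0 ≤ t → 0 ≤ s → f (t + s) ≤ f t + c₁ * s + C₁) {s : ℝ}
    (hs : 0 ≤ s) : BddAbove {x : ℝ | ∃ t ≥ (0:ℝ), x = f (t + s) - f t} := by
  refine ⟨c₁ * s + C₁, ?_⟩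
  rintro x ⟨t, ht, rfl⟩
  linarith [hgrow t s ht hs]

lemma increment_le_sSup (hgrow : ∀ t s, 0 ≤ t → 0 ≤ s → f (t + s) ≤ f t + c₁ * s + C₁) {t s : ℝ}
    (ht : 0 ≤ t) (hs : 0 ≤ s) : f (t + s) - f t ≤ sSup {x : ℝ | ∃ t ≥ (0:ℝ), x = f (t + s) - f t} :=
  le_csSup (bddAbove_increments hgrow hs) ⟨t, ht, rfl⟩

lemma sSup_increments_le {s b : ℝ} (h : ∀ t, 0 ≤ t → f (t + s) - f t ≤ b) :
    sSup {x : ℝ | ∃ t ≥ (0:ℝ), x = f (t + s) - f t} ≤ b := by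
  refine csSup_le ⟨_, 0, le_rfl, rfl⟩ ?_
  rintro x ⟨t, ht, rfl⟩
  exact h t ht

lemma isBoundedUnder_le_sSup_increments
    (hgrow : ∀ t s, 0 ≤ t → 0 ≤ s → f (t + s) ≤ f t + c₁ * s + C₁) :
    IsBoundedUnder (· ≤ ·) atTop
      fun s => sSup {x : ℝ | ∃ t ≥ (0:ℝ), x = f (t + s) - f t} / s := by
  refine ⟨c₁ + |C₁|, eventually_map.2 ?_⟩
  filter_upwards [eventually_ge_atTop 1] with s hs
  have h := sSup_increments_le (f := f) (s := s) (b := c₁ * s + C₁)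
    fun t ht => by linarith [hgrow t s ht (by linarith)]
  rw [div_le_iff₀ (by linarith)]
  nlinarith [le_abs_self C₁, abs_nonneg C₁]

lemma isCoboundedUnder_le_sSup_increments (hf : ∀ t, 0 ≤ t → 0 ≤ f t)
    (hgrow : ∀ t s, 0 ≤ t → 0 ≤ s → f (t + s) ≤ f t + c₁ * s + C₁) :
    IsCoboundedUnder (· ≤ ·) atTop
      fun s => sSup {x : ℝ | ∃ t ≥ (0:ℝ), x = f (t + s) - f t} / s := by
  refine IsBoundedUnder.isCoboundedUnder_le ⟨-f 0, eventually_map.2 ?_⟩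
  filter_upwards [eventually_ge_atTop 1] with s hs
  have h := increment_le_sSup hgrow le_rfl (show 0 ≤ s by linarith)
  rw [zero_add] at h
  rw [le_div_iff₀ (by linarith)]
  nlinarith [hf s (by linarith), hf 0 le_rfl]

lemma limsup_div_le_cbarF (hf : ∀ t, 0 ≤ t → 0 ≤ f t)
    (hgrow : ∀ t s, 0 ≤ t → 0 ≤ s → f (t + s) ≤ f t + c₁ * s + C₁) :
    limsup (fun t => f t / t) atTop ≤ cbarF f := by
  refine le_of_forall_pos_le_add fun ε hε => ?_
  have h1 : ∀ᶠ s in atTop, sSup {x : ℝ | ∃ t ≥ (0:ℝ), x = f (t + s) - f t} / s <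
      cbarF f + ε / 2 :=
    eventually_lt_of_limsup_lt (by change cbarF f < _; linarith)
      (isBoundedUnder_le_sSup_increments hgrow)
  refine limsup_le_of_le (isBoundedUnder_ge_div_atTop hf).isCoboundedUnder_le ?_
  filter_upwards [h1, eventually_ge_atTop 1, eventually_ge_atTop (f 0 / (ε / 2))] with s h hs hs'
  have h2 := increment_le_sSup hgrow le_rfl (show 0 ≤ s by linarith)
  rw [zero_add] at h2
  have hs0 : 0 < s := by linarith
  rw [div_lt_iff₀ hs0] at h
  rw [div_le_iff₀ (by linarith)] at hs'
  rw [div_le_iff₀ hs0]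
  linarith

lemma exists_increment_le (hc₁ : 0 ≤ c₁)
    (hgrow : ∀ t s, 0 ≤ t → 0 ≤ s → f (t + s) ≤ f t + c₁ * s + C₁) {b : ℝ} (hb : cbarF f < b)
    (hb0 : 0 ≤ b) :
    ∃ C, ∀ t s, 0 ≤ t → 0 ≤ s → f (t + s) - f t ≤ b * s + C := by
  have h1 : ∀ᶠ s in atTop, sSup {x : ℝ | ∃ t ≥ (0:ℝ), x = f (t + s) - f t} / s < b :=
    eventually_lt_of_limsup_lt hb (isBoundedUnder_le_sSup_increments hgrow)
  obtain ⟨s₀, hs₀⟩ := eventually_atTop.1 h1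
  refine ⟨c₁ * |s₀| + |C₁|, fun t s ht hs => ?_⟩
  have h2 : 0 ≤ c₁ * |s₀| := by positivity
  by_cases h : s₀ ≤ s ∧ 0 < s
  · have h3 := hs₀ s h.1
    rw [div_lt_iff₀ h.2] at h3
    linarith [increment_le_sSup hgrow ht hs, abs_nonneg C₁]
  · have h3 : s ≤ |s₀| := by
      by_contra! h4
      exact h ⟨(le_abs_self _).trans h4.le, (abs_nonneg _).trans_lt h4⟩
    linarith [hgrow t s ht hs, mul_le_mul_of_nonneg_left h3 hc₁, mul_nonneg hb0 hs, le_abs_self C₁]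

lemma cbarF_le (hf : ∀ t, 0 ≤ t → 0 ≤ f t)
    (hgrow : ∀ t s, 0 ≤ t → 0 ≤ s → f (t + s) ≤ f t + c₁ * s + C₁) {b C : ℝ}
    (h : ∀ t s, 0 ≤ t → 0 ≤ s → f (t + s) - f t ≤ b * s + C) : cbarF f ≤ b := by
  refine le_of_forall_pos_le_add fun ε hε => ?_
  refine limsup_le_of_le (isCoboundedUnder_le_sSup_increments hf hgrow) ?_
  filter_upwards [eventually_gt_atTop 0, eventually_ge_atTop (C / ε)] with s hs hs'
  rw [div_le_iff₀ hε] at hs'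
  rw [div_le_iff₀ hs]
  refine sSup_increments_le fun t ht => ?_
  linarith [h t s ht hs.le]

lemma le_liminf_div (hgrow : ∀ t s, 0 ≤ t → 0 ≤ s → f (t + s) ≤ f t + c₁ * s + C₁) {c C t₁ : ℝ}
    (h : ∀ t, t₁ ≤ t → c * t - C ≤ f t) : c ≤ liminf (fun t => f t / t) atTop := by
  refine le_of_forall_pos_le_add fun ε hε => ?_
  rw [← sub_le_iff_le_add]
  refine le_liminf_of_le (isBoundedUnder_le_div_atTop hgrow).isCoboundedUnder_ge ?_
  filter_upwards [eventually_gt_atTop 0, eventually_ge_atTop (C / ε), eventually_ge_atTop t₁]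
    with t ht ht' ht₁
  rw [div_le_iff₀ hε] at ht'
  rw [le_div_iff₀ ht]
  linarith [h t ht₁]

end MeanSpeed

lemma exists_speed_phiInv_empty {V : Euc n → ℝ} (hdisc : HDiscVel V) {m : Euc n} (hm : m ∈ MinSet V)
    {a b : ℝ} (hab : a < b) (ha : 0 ≤ a) : ∃ c ∈ Ioo a b, ¬(PhiInv V c m).Nonempty := by
  by_contra! h
  have hsub : Ioo a b ⊆ interior {c : ℝ | 0 ≤ c ∧ (PhiInv V c m).Nonempty} :=
    interior_maximal (fun c hc => ⟨ha.trans hc.1.le, h c hc⟩) isOpen_Ioo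
  rw [hdisc m hm] at hsub
  exact hsub (show (a + b) / 2 ∈ Ioo a b from ⟨by linarith, by linarith⟩)

section Conclusion

variable {d : ℕ} {V : Euc n → ℝ} {D : EscData n V} {u : ℝ → ℝ → Euc n}
  {C ν K cHom δ L₀ : ℝ} {rHom : ℝ → ℝ}

local notation "fEsc" => rescF V d D.lmin u δ L₀ rHom

theorem EscSetting.cbarF_le_liminf (S : EscSetting d V D u C ν K cHom δ L₀ rHom) (hnd : HNonDeg V)
    (hbist : HOnlyBist V) (hdisc : HDiscVel V) :
    cbarF fEsc ≤ liminf (fun t => fEsc t / t) atTop := by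
  by_contra! hlt
  obtain ⟨C₁, hC₁, hgrow⟩ := S.exists_esc_growth
  have hf0 : ∀ t, 0 ≤ t → 0 ≤ fEsc t := fun t ht => S.esc_nonneg ht
  have hno := S.cNoEsc_pos.le
  have hlim0 : 0 ≤ liminf (fun t => fEsc t / t) atTop :=
    le_liminf_div hgrow (C := 0) (t₁ := 0) (fun t ht => by simpa using hf0 t ht)
  set b := cbarF fEsc with hb
  have hb0 : 0 < b := hlim0.trans_lt hlt
  have hl := D.lmin_pos
  obtain ⟨κ, hκ, hκl⟩ : ∃ κ, 0 < κ ∧ κ * (b + κ) ≤ D.lmin / 4 := by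
    refine ⟨min 1 (D.lmin / (4 * (b + 1))), by positivity, ?_⟩
    have h1 := min_le_left 1 (D.lmin / (4 * (b + 1)))
    have h2 := min_le_right 1 (D.lmin / (4 * (b + 1)))
    rw [le_div_iff₀ (by positivity)] at h2
    have h3 : 0 < min 1 (D.lmin / (4 * (b + 1))) := by positivity
    nlinarith
  obtain ⟨ε, hε, hεκ, hεq⟩ : ∃ ε, 0 < ε ∧ 2 * ε ≤ κ ∧ (b + κ) * (2 * ε) ≤ κ ^ 2 / 2 := by
    refine ⟨min (κ / 2) (κ ^ 2 / (4 * (b + κ))), by positivity, ?_, ?_⟩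
    · linarith [min_le_left (κ / 2) (κ ^ 2 / (4 * (b + κ)))]
    · have h2 := min_le_right (κ / 2) (κ ^ 2 / (4 * (b + κ)))
      rw [le_div_iff₀ (by positivity)] at h2
      linarith
  obtain ⟨c, ⟨hac, hcb⟩, hempty⟩ := exists_speed_phiInv_empty hdisc S.zero_mem
    (max_lt hlt (sub_lt_self b hε)) (le_max_of_le_left hlim0)
  obtain ⟨hlc, hεc⟩ := max_lt_iff.1 hac
  have hc0 : 0 < c := hlim0.trans_lt hlc
  obtain ⟨C₃, hC₃⟩ := exists_increment_le hno hgrow (show cbarF fEsc < b + ε by linarith)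
    (by linarith)
  obtain ⟨A, B, hA, hB, hstar⟩ := S.exists_sum_exp_le hnd hbist hc0 hempty hκ
    ((mul_le_mul_of_nonneg_left (by linarith) hκ.le).trans hκl) hεκ
    ((mul_le_mul_of_nonneg_right (by linarith) (by linarith)).trans hεq) (C₃ := C₃)
    (fun t s ht hs => by
      have h1 := hC₃ t s ht hs
      have h2 : (b + ε - c) * s ≤ 2 * ε * s := mul_le_mul_of_nonneg_right (by linarith) hs
      linarith)
  rcases growth_dichotomy hc0 (show c < (c + b) / 2 by linarith) hA hB hno hC₁ hf0 hgrow hstar with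
    ⟨C', h⟩ | ⟨C', t₁, h⟩
  · linarith [cbarF_le hf0 hgrow h]
  · linarith [le_liminf_div hgrow h]

theorem EscSetting.mean_speed_eq (S : EscSetting d V D u C ν K cHom δ L₀ rHom) (hnd : HNonDeg V)
    (hbist : HOnlyBist V) (hdisc : HDiscVel V) :
    liminf (fun t => fEsc t / t) atTop = cbarF fEsc ∧
      limsup (fun t => fEsc t / t) atTop = cbarF fEsc := by
  obtain ⟨C₁, -, hgrow⟩ := S.exists_esc_growth
  have hf0 : ∀ t, 0 ≤ t → 0 ≤ fEsc t := fun t ht => S.esc_nonneg ht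
  have h1 := S.cbarF_le_liminf hnd hbist hdisc
  have h2 : liminf (fun t => fEsc t / t) atTop ≤ limsup (fun t => fEsc t / t) atTop :=
    liminf_le_limsup (isBoundedUnder_le_div_atTop hgrow) (isBoundedUnder_ge_div_atTop hf0)
  have h3 := limsup_div_le_cbarF hf0 hgrow
  exact ⟨le_antisymm (h2.trans h3) h1, le_antisymm h3 (h1.trans h2)⟩

end Conclusion

/-- mean invasion speed. -/
theorem stmt13 {n d k : ℕ} (hn : 1 ≤ n) (hd : 2 ≤ d) (hk : 2 ≤ k)
    (V : Euc n → ℝ) (hV : ContDiff ℝ (k : ℕ∞) V) (hcoerc : HCoerc V)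
    (D : EscData n V) (hgen : HGen V D.dEsc)
    (h0 : (0 : Euc n) ∈ MinSet V) (hV0 : V 0 = 0)
    (u : ℝ → ℝ → Euc n) (hu : IsRadialSolution d V u)
    (cHom : ℝ) (rHom : ℝ → ℝ) (hhom : HHomWith u 0 cHom rHom)
    (hrHom' : ∀ t : ℝ, 0 ≤ deriv rHom t)
    (hinv : 0 < cEscV u 0 D.dEsc rHom)
    (ν K δ L₀ cno : ℝ) (hν : 0 < ν) (hK : 0 < K)
    (hδ : δ = deltaEsc D.dEsc (wV V) (kappa0 D.lmin))
    (hL : L₀ = L0c (kappa0 D.lmin) ν K δ)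
    (hcno : cno = cNoEsc (kappa0 D.lmin) K L₀ δ)
    (hfire : FireIneq V d D.lmin D.dEsc u ν K)
    (hhull : HullBound V d D.lmin u δ L₀ rHom) :
    liminf (fun t => rescF V d D.lmin u δ L₀ rHom t / t) atTop =
        cbarF (rescF V d D.lmin u δ L₀ rHom) ∧
      limsup (fun t => rescF V d D.lmin u δ L₀ rHom t / t) atTop =
        cbarF (rescF V d D.lmin u δ L₀ rHom) := by
  obtain ⟨C, hC⟩ := hu.bounded
  have S : EscSetting d V D u C ν K cHom δ L₀ rHom :=
    { two_le := hd
      smooth := hV.of_le (by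
        rw [← WithTop.coe_ofNat, WithTop.coe_le_coe]
        exact_mod_cast hk)
      coerc := hcoerc
      zero_mem := h0
      map_zero := hV0
      sol := hu
      bound := hC
      ν_pos := hν
      K_pos := hK
      fire := hfire
      hom := hhom
      deriv_nonneg := hrHom'
      δ_eq := hδ
      L₀_eq := hL
      hull := hhull
      inv := hinv }
  exact S.mean_speed_eq hgen.1 hgen.2.1 hgen.2.2.1
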